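/- Let β and ρ belong to the Gevrey class G^s([p₀,0]) for some s ≥ 1, and let h ∈ C^{2,μ}(R̄) be a solution of the height-function formulation of the capillary-gravity stratified water-wave problem. Then h is smooth on R̄ and there exist constants L₂ ≥ L₁ ≥ 1 (independent of the order of differentiation) such that for every integer m ≥ 2 and every multi-index α = (α₁,α₂) with |α| = m one has ‖∂^α h‖_2 ≤ L₁^{α₁−1} L₂^{α₂} [(|α|−2)!]^s. Consequently h ∈ G^s(R̄); in particular, if s = 1 then h is real analytic on R̄. -/

import Mathlib

open Set

noncomputable section

/-- The closed strip `R̄ = ℝ × [p₀, 0]`. -/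
def Strip (p₀ : ℝ) : Set (ℝ × ℝ) := {z : ℝ × ℝ | p₀ ≤ z.2 ∧ z.2 ≤ 0}

/-- The mixed partial derivative `∂_q^a ∂_p^b f` of `f : ℝ² → ℝ` within the set `S`,
realized as the iterated Fréchet derivative within `S` applied to the corresponding
coordinate directions. -/
def mpw (S : Set (ℝ × ℝ)) (a b : ℕ) (f : ℝ × ℝ → ℝ) (z : ℝ × ℝ) : ℝ :=
  iteratedFDerivWithin ℝ (a + b) f S z
    (fun i => if (i : ℕ) < a then ((1 : ℝ), (0 : ℝ)) else ((0 : ℝ), (1 : ℝ)))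

/-- `∂_q^a ∂_p^b f` within the strip `R̄`. -/
def pd (p₀ : ℝ) (a b : ℕ) (f : ℝ × ℝ → ℝ) : ℝ × ℝ → ℝ := mpw (Strip p₀) a b f

/-- Euclidean distance on `ℝ²`. -/
def edist2 (z z' : ℝ × ℝ) : ℝ := Real.sqrt ((z.1 - z'.1) ^ 2 + (z.2 - z'.2) ^ 2)

/-- `sup_{R̄} |f|`. -/
def supS (p₀ : ℝ) (f : ℝ × ℝ → ℝ) : ℝ := sSup ((fun z => |f z|) '' Strip p₀)

/-- The Hölder seminorm of exponent `μ` of `f` over the strip `R̄`. -/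
def hsemi (p₀ μ : ℝ) (f : ℝ × ℝ → ℝ) : ℝ :=
  sSup {y | ∃ z ∈ Strip p₀, ∃ z' ∈ Strip p₀, z ≠ z' ∧ y = |f z - f z'| / (edist2 z z') ^ μ}

/-- The `C^k` sup-norm `‖f‖_k = Σ_{|α| ≤ k} sup_{R̄} |∂^α f|`. -/
def cknorm (p₀ : ℝ) (k : ℕ) (f : ℝ × ℝ → ℝ) : ℝ :=
  ∑ a ∈ Finset.range (k + 1), ∑ b ∈ Finset.range (k + 1 - a), supS p₀ (pd p₀ a b f)

/-- The Hölder norm `‖f‖_{k,μ} = ‖f‖_k + max_{|α| = k} [∂^α f]_μ`. -/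
def hnorm (p₀ μ : ℝ) (k : ℕ) (f : ℝ × ℝ → ℝ) : ℝ :=
  cknorm p₀ k f + sSup {y | ∃ a b : ℕ, a + b = k ∧ y = hsemi p₀ μ (pd p₀ a b f)}

/-- Boundedness of `f` on the strip (finiteness of `sup_{R̄} |f|`). -/
def bddS (p₀ : ℝ) (f : ℝ × ℝ → ℝ) : Prop := BddAbove ((fun z => |f z|) '' Strip p₀)

/-- Finiteness of the Hölder seminorm of `f` on the strip. -/
def bddH (p₀ μ : ℝ) (f : ℝ × ℝ → ℝ) : Prop :=
  BddAbove {y | ∃ z ∈ Strip p₀, ∃ z' ∈ Strip p₀, z ≠ z' ∧ y = |f z - f z'| / (edist2 z z') ^ μ}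

/-- Finiteness of the `C^{k,μ}(R̄)` norm. -/
def finCk (p₀ μ : ℝ) (k : ℕ) (f : ℝ × ℝ → ℝ) : Prop :=
  (∀ a b : ℕ, a + b ≤ k → bddS p₀ (pd p₀ a b f)) ∧
  (∀ a b : ℕ, a + b = k → bddH p₀ μ (pd p₀ a b f))

/-- Membership in `C^{k,μ}(R̄)`: `k` times continuously differentiable on the strip with
bounded derivatives, the top-order ones Hölder continuous of exponent `μ`. -/
def MemCk (p₀ μ : ℝ) (k : ℕ) (f : ℝ × ℝ → ℝ) : Prop :=
  ContDiffOn ℝ k f (Strip p₀) ∧ finCk p₀ μ k f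

/-- Gevrey regularity on `[p₀, 0]` of index `s`. -/
def GevreyOnIcc (s p₀ : ℝ) (f : ℝ → ℝ) : Prop :=
  ContDiffOn ℝ (⊤ : ℕ∞) f (Set.Icc p₀ 0) ∧
  ∃ M : ℝ, 1 ≤ M ∧ ∀ k : ℕ, ∀ p ∈ Set.Icc p₀ 0,
    |iteratedDerivWithin k f (Set.Icc p₀ 0) p| ≤ M ^ (k + 1) * (Nat.factorial k : ℝ) ^ s


open Filter Topology Asymptotics

def L2 (a b : ℝ) : ℝ × ℝ →L[ℝ] ℝ :=
  a • ContinuousLinearMap.fst ℝ ℝ ℝ + b • ContinuousLinearMap.snd ℝ ℝ ℝ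

@[simp] lemma L2_apply (a b : ℝ) (v : ℝ × ℝ) : L2 a b v = a * v.1 + b * v.2 := by
  simp [L2]

lemma L2_norm_le (a b : ℝ) : ‖L2 a b‖ ≤ |a| + |b| := by
  refine ContinuousLinearMap.opNorm_le_bound _ (by positivity) fun v => ?_
  rw [L2_apply, Real.norm_eq_abs]
  have h1 : |v.1| ≤ ‖v‖ := by simpa using norm_fst_le v
  have h2 : |v.2| ≤ ‖v‖ := by simpa using norm_snd_le v
  calc |a * v.1 + b * v.2| ≤ |a| * |v.1| + |b| * |v.2| := by
        refine (abs_add_le _ _).trans ?_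
        rw [abs_mul, abs_mul]
    _ ≤ (|a| + |b|) * ‖v‖ := by nlinarith [abs_nonneg a, abs_nonneg b]

lemma L2_sub (a b c d : ℝ) : L2 a b - L2 c d = L2 (a - c) (b - d) := by
  ext <;> simp

def Hol (S : Set (ℝ × ℝ)) (μ M : ℝ) (f : ℝ × ℝ → ℝ) : Prop :=
  ∀ z ∈ S, ∀ z' ∈ S, |f z - f z'| ≤ M * ‖z - z'‖ ^ μ

def Grad (S : Set (ℝ × ℝ)) (g u1 u2 : ℝ × ℝ → ℝ) : Prop :=
  ∀ z ∈ S, HasFDerivWithinAt g (L2 (u1 z) (u2 z)) S z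

lemma taylor1 {S : Set (ℝ × ℝ)} (hS : Convex ℝ S) {μ M : ℝ} (hμ : 0 < μ) (hM : 0 ≤ M)
    {g u1 u2 : ℝ × ℝ → ℝ} (hg : Grad S g u1 u2) (h1 : Hol S μ M u1) (h2 : Hol S μ M u2)
    {x y : ℝ × ℝ} (hx : x ∈ S) (hy : y ∈ S) :
    |g y - g x - (u1 x * (y.1 - x.1) + u2 x * (y.2 - x.2))| ≤ 2 * M * ‖y - x‖ ^ μ * ‖y - x‖ := by
  have hseg : segment ℝ x y ⊆ S := hS.segment_subset hx hy
  have := (convex_segment x y).norm_image_sub_le_of_norm_hasFDerivWithin_le' (𝕜 := ℝ)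
    (f := g) (f' := fun z => L2 (u1 z) (u2 z)) (φ := L2 (u1 x) (u2 x)) (C := 2 * M * ‖y - x‖ ^ μ)
    (fun z hz => (hg z (hseg hz)).mono hseg) (fun z hz => ?_) (left_mem_segment ℝ x y)
    (right_mem_segment ℝ x y)
  · simpa using this
  · rw [L2_sub]
    refine (L2_norm_le _ _).trans ?_
    have hzx : ‖z - x‖ ≤ ‖y - x‖ := by
      have := (norm_sub_le_of_mem_segment hz)
      simpa using this
    have hp : ‖z - x‖ ^ μ ≤ ‖y - x‖ ^ μ := Real.rpow_le_rpow (norm_nonneg _) hzx hμ.le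
    have e1 := h1 z (hseg hz) x hx
    have e2 := h2 z (hseg hz) x hx
    nlinarith [mul_le_mul_of_nonneg_left hp hM]

lemma hasFDerivWithinAt_of_taylor {S : Set (ℝ × ℝ)} {μ C : ℝ} (hμ : 0 < μ)
    {g : ℝ × ℝ → ℝ} {a b : ℝ} {x : ℝ × ℝ}
    (h : ∀ y ∈ S, |g y - g x - (a * (y.1 - x.1) + b * (y.2 - x.2))| ≤ C * ‖y - x‖ ^ μ * ‖y - x‖) :
    HasFDerivWithinAt g (L2 a b) S x := by
  rw [hasFDerivWithinAt_iff_isLittleO]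
  have h1 : (fun y => g y - g x - L2 a b (y - x)) =O[𝓝[S] x] fun y => ‖y - x‖ ^ μ * ‖y - x‖ := by
    refine IsBigO.of_bound C ?_
    filter_upwards [self_mem_nhdsWithin] with y hy
    have := h y hy
    rw [Real.norm_of_nonneg (by positivity : 0 ≤ ‖y - x‖ ^ μ * ‖y - x‖)]
    simpa [mul_assoc] using this
  refine h1.trans_isLittleO ?_
  have h2 : (fun y : ℝ × ℝ => ‖y - x‖ ^ μ) =o[𝓝[S] x] fun _ => (1 : ℝ) := by
    rw [isLittleO_one_iff]
    have : Tendsto (fun y : ℝ × ℝ => ‖y - x‖) (𝓝[S] x) (𝓝 0) := by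
      have : Tendsto (fun y : ℝ × ℝ => ‖y - x‖) (𝓝 x) (𝓝 ‖x - x‖) :=
        (Continuous.tendsto (by fun_prop) x)
      simp only [sub_self, norm_zero] at this
      exact this.mono_left nhdsWithin_le_nhds
    have := this.rpow_const (p := μ) (Or.inr hμ.le)
    rwa [Real.zero_rpow hμ.ne'] at this
  have h3 := h2.mul_isBigO (isBigO_refl (fun y : ℝ × ℝ => ‖y - x‖) (𝓝[S] x))
  simp only [one_mul] at h3
  exact h3.of_norm_right

lemma hasDerivAt_of_taylorC {μ C : ℝ} (hμ : 0 < μ) {Φ : ℂ → ℂ} {d z : ℂ}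
    (h : ∀ᶠ w in 𝓝 z, ‖Φ w - Φ z - (w - z) * d‖ ≤ C * ‖w - z‖ ^ μ * ‖w - z‖) :
    HasDerivAt Φ d z := by
  rw [hasDerivAt_iff_isLittleO]
  have h1 : (fun y => Φ y - Φ z - (y - z) • d) =O[𝓝 z] fun y => ‖y - z‖ ^ μ * ‖y - z‖ := by
    refine IsBigO.of_bound C ?_
    filter_upwards [h] with y hy
    rw [Real.norm_of_nonneg (by positivity : 0 ≤ ‖y - z‖ ^ μ * ‖y - z‖)]
    simpa [mul_assoc] using hy
  refine h1.trans_isLittleO ?_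
  have h2 : (fun y : ℂ => ‖y - z‖ ^ μ) =o[𝓝 z] fun _ => (1 : ℝ) := by
    rw [isLittleO_one_iff]
    have : Tendsto (fun y : ℂ => ‖y - z‖) (𝓝 z) (𝓝 ‖z - z‖) :=
        (Continuous.tendsto (by fun_prop) z)
    simp only [sub_self, norm_zero] at this
    have := this.rpow_const (p := μ) (Or.inr hμ.le)
    rwa [Real.zero_rpow hμ.ne'] at this
  have h3 := h2.mul_isBigO (isBigO_refl (fun y : ℂ => ‖y - z‖) (𝓝 z))
  simp only [one_mul] at h3
  exact h3.of_norm_right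

lemma pl_core {μ C : ℝ} (hμ : 0 < μ) (hμ1 : μ < 1) (hC : 0 ≤ C) {Ψ : ℂ → ℂ}
    (hd : DiffContOnCl ℂ Ψ {z | 0 < z.re})
    (hg : ∀ z : ℂ, 0 ≤ z.re → |(Ψ z).im| ≤ C * ‖z‖ ^ μ)
    (hb : ∀ x : ℝ, (Ψ (x * Complex.I)).im = 0) {z : ℂ} (hz : 0 ≤ z.re) : (Ψ z).im ≤ 0 := by
  have key : ∀ ε : ℝ, 0 < ε → (Ψ z).im ≤ ε * z.re := by
    intro ε hε
    set f : ℂ → ℂ := fun z => Complex.exp (-Complex.I * Ψ z - ε * z) with hf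
    have hn : ∀ w, ‖f w‖ = Real.exp ((Ψ w).im - ε * w.re) := by
      intro w
      rw [hf]; simp only [Complex.norm_exp]
      congr 1
      simp
    have hle : ‖f z‖ ≤ 1 := by
      refine PhragmenLindelof.right_half_plane_of_tendsto_zero_on_real (f := f) ?_ ?_ ?_ ?_ hz
      · refine Differentiable.comp_diffContOnCl (f := Complex.exp) (g := fun w => -Complex.I * Ψ w - ε * w)
          Complex.differentiable_exp ?_
        refine DiffContOnCl.sub ?_ ?_
        · exact hd.const_smul (-Complex.I)
        · exact (Differentiable.diffContOnCl (by fun_prop))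
      · refine ⟨μ, by linarith, C, ?_⟩
        refine IsBigO.of_bound 1 ?_
        filter_upwards [mem_inf_of_right (mem_principal_self _)] with w hw
        change 0 < w.re at hw
        rw [hn, Real.norm_of_nonneg (Real.exp_pos _).le, one_mul]
        refine Real.exp_le_exp.2 ?_
        have := (abs_le.1 (hg w hw.le)).2
        nlinarith
      · rw [tendsto_zero_iff_norm_tendsto_zero]
        have h1 : Tendsto (fun x : ℝ => C * x ^ μ - ε * x) atTop atBot := by
          have e1 : Tendsto (fun x : ℝ => x * (C * x ^ (-(1 - μ)) - ε)) atTop atBot := by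
            refine Tendsto.atTop_mul_neg (C := -ε) (by linarith) tendsto_id ?_
            have := (tendsto_rpow_neg_atTop (y := 1 - μ) (by linarith)).const_mul C
            simpa using this.sub_const ε
          refine e1.congr' ?_
          filter_upwards [eventually_gt_atTop 0] with x hx
          have : x * x ^ (-(1 - μ)) = x ^ μ := by
            nth_rewrite 1 [← Real.rpow_one x]
            rw [← Real.rpow_add hx]; congr 1; ring
          linear_combination C * this
        have h2 : Tendsto (fun x : ℝ => Real.exp (C * x ^ μ - ε * x)) atTop (𝓝 0) :=
          Real.tendsto_exp_atBot.comp h1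
        refine squeeze_zero' (Eventually.of_forall fun x => norm_nonneg _) ?_ h2
        filter_upwards [eventually_ge_atTop 0] with x hx
        rw [hn]
        refine Real.exp_le_exp.2 ?_
        have := (abs_le.1 (hg x (by simpa using hx))).2
        simp only [Complex.norm_real, Real.norm_of_nonneg hx] at this
        simpa using this
      · intro x
        rw [hn, hb]; simp
    rw [hn] at hle
    have := Real.exp_le_one_iff.1 hle
    linarith
  by_contra hcon
  push Not at hcon
  have := key ((Ψ z).im / (2 * (z.re + 1))) (by positivity)
  have h2 : (Ψ z).im / (2 * (z.re + 1)) * z.re < (Ψ z).im := by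
    rw [div_mul_eq_mul_div, div_lt_iff₀ (by linarith)]
    nlinarith
  linarith

def ymap (t1 t2 A : ℝ) (z : ℂ) : ℝ × ℝ := (-z.im - t1 / t2 * z.re, z.re / t2 - A)

lemma ymap_sub (t1 t2 A : ℝ) (ht2 : 0 < t2) (z w : ℂ) :
    ‖ymap t1 t2 A w - ymap t1 t2 A z‖ ≤ (1 + |t1 / t2| + 1 / t2) * ‖w - z‖ := by
  have hr : |(w - z).re| ≤ ‖w - z‖ := Complex.abs_re_le_norm _
  have hi : |(w - z).im| ≤ ‖w - z‖ := Complex.abs_im_le_norm _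
  have h0 := norm_nonneg (w - z)
  have hp : 0 < 1 / t2 := by positivity
  rw [Prod.norm_def]
  refine max_le ?_ ?_
  · have : (ymap t1 t2 A w - ymap t1 t2 A z).1 = -(w - z).im - t1 / t2 * (w - z).re := by
      simp [ymap]; ring
    rw [this, Real.norm_eq_abs]
    calc _ ≤ |(w - z).im| + |t1 / t2| * |(w - z).re| := by
          refine (abs_sub _ _).trans ?_
          rw [abs_neg, abs_mul]
      _ ≤ _ := by nlinarith [abs_nonneg (t1 / t2)]
  · have : (ymap t1 t2 A w - ymap t1 t2 A z).2 = 1 / t2 * (w - z).re := by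
      simp [ymap]; ring
    rw [this, Real.norm_eq_abs, abs_mul, abs_of_pos hp]
    nlinarith [abs_nonneg (t1 / t2)]

section
variable {μ M a b c t1 t2 A : ℝ} {G1 G2 U0 U1 U2 : ℝ × ℝ → ℝ}

def F1 (b c t1 t2 A : ℝ) (U0 U1 : ℝ × ℝ → ℝ) (z : ℂ) : ℂ :=
  ((b / c + t1 : ℝ) + (t2 : ℝ) * Complex.I) * (U0 (ymap t1 t2 A z) : ℝ) + (U1 (ymap t1 t2 A z) : ℝ)

lemma F1_holo (hμ : 0 < μ) (hc : 0 < c) (ht2 : 0 < t2) (hM : 0 ≤ M)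
    (hre : c * (t1 ^ 2 - t2 ^ 2) + b * t1 + a = 0) (him : 2 * c * t1 + b = 0)
    {O : Set ℂ} (hO : IsOpen O) {Ω : Set (ℝ × ℝ)} (hOΩ : ∀ z ∈ O, ymap t1 t2 A z ∈ Ω)
    (hT1 : ∀ y ∈ Ω, ∀ y' ∈ Ω, |G1 y' - G1 y - (U0 y * (y'.1 - y.1) + U1 y * (y'.2 - y.2))|
      ≤ M * ‖y' - y‖ ^ μ * ‖y' - y‖)
    (hT2 : ∀ y ∈ Ω, ∀ y' ∈ Ω, |G2 y' - G2 y - (U1 y * (y'.1 - y.1) + U2 y * (y'.2 - y.2))|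
      ≤ M * ‖y' - y‖ ^ μ * ‖y' - y‖)
    (heq : ∀ y ∈ Ω, a * U0 y + b * U1 y + c * U2 y = 0) :
    DifferentiableOn ℂ (F1 b c t1 t2 A U0 U1) O := by
  set α : ℂ := ((b / c + t1 : ℝ) + (t2 : ℝ) * Complex.I) with hα
  set Φ : ℂ → ℂ := fun z => α * (G1 (ymap t1 t2 A z) : ℝ) + (G2 (ymap t1 t2 A z) : ℝ) with hΦ
  set K := 1 + |t1 / t2| + 1 / t2 with hK
  have hK0 : 0 ≤ K := by positivity
  have hder : ∀ z ∈ O, HasDerivAt Φ (Complex.I * F1 b c t1 t2 A U0 U1 z) z := by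
    intro z hz
    refine hasDerivAt_of_taylorC (μ := μ) (C := (‖α‖ + 1) * M * K ^ μ * K) hμ ?_
    filter_upwards [hO.mem_nhds hz] with w hw
    set y := ymap t1 t2 A z with hy
    set y' := ymap t1 t2 A w with hy'
    have e1 := hT1 y (hOΩ z hz) y' (hOΩ w hw)
    have e2 := hT2 y (hOΩ z hz) y' (hOΩ w hw)
    set r1 := G1 y' - G1 y - (U0 y * (y'.1 - y.1) + U1 y * (y'.2 - y.2)) with hr1
    set r2 := G2 y' - G2 y - (U1 y * (y'.1 - y.1) + U2 y * (y'.2 - y.2)) with hr2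
    have hE := heq y (hOΩ z hz)
    have hid : Φ w - Φ z - (w - z) * (Complex.I * F1 b c t1 t2 A U0 U1 z)
        = α * (r1 : ℝ) + (r2 : ℝ) := by
      have hd1 : y'.1 - y.1 = -(w.im - z.im) - t1 / t2 * (w.re - z.re) := by
        simp [hy, hy', ymap]; ring
      have hd2 : y'.2 - y.2 = (w.re - z.re) / t2 := by
        simp [hy, hy', ymap]; ring
      have hF : F1 b c t1 t2 A U0 U1 z = α * (U0 y : ℝ) + (U1 y : ℝ) := rfl
      have hb : b = - 2 * c * t1 := by linarith
      have ha : a = c * (t1 ^ 2 + t2 ^ 2) := by rw [hb] at hre; nlinarith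
      have hU2 : U2 y = -((t1 * t1 + t2 * t2) * U0 y - 2 * t1 * U1 y) := by
        rw [ha, hb] at hE
        have : c * ((t1 ^ 2 + t2 ^ 2) * U0 y - 2 * t1 * U1 y + U2 y) = 0 := by linarith
        have := (mul_eq_zero.1 this).resolve_left hc.ne'
        linarith
      have hbc : b / c = -2 * t1 := by rw [hb]; field_simp
      rw [hF, hΦ]
      simp only []
      rw [← hy, ← hy', hr1, hr2, hd1, hd2, hU2, hα, hbc]
      apply Complex.ext
      · simp
        field_simp
        ring
      · simp
        field_simp
        ring
    rw [hid]
    have hyy : ‖y' - y‖ ≤ K * ‖w - z‖ := ymap_sub t1 t2 A ht2 z w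
    have hyp : ‖y' - y‖ ^ μ * ‖y' - y‖ ≤ K ^ μ * K * (‖w - z‖ ^ μ * ‖w - z‖) := by
      have : ‖y' - y‖ ^ μ ≤ K ^ μ * ‖w - z‖ ^ μ := by
        rw [← Real.mul_rpow hK0 (norm_nonneg _)]
        exact Real.rpow_le_rpow (norm_nonneg _) hyy hμ.le
      calc _ ≤ (K ^ μ * ‖w - z‖ ^ μ) * (K * ‖w - z‖) := by gcongr
        _ = _ := by ring
    calc ‖α * (r1 : ℝ) + (r2 : ℝ)‖ ≤ ‖α‖ * |r1| + |r2| := by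
          refine (norm_add_le _ _).trans ?_
          rw [norm_mul]
          simp
      _ ≤ ‖α‖ * (M * ‖y' - y‖ ^ μ * ‖y' - y‖) + (M * ‖y' - y‖ ^ μ * ‖y' - y‖) := by gcongr
      _ = (‖α‖ + 1) * M * (‖y' - y‖ ^ μ * ‖y' - y‖) := by ring
      _ ≤ (‖α‖ + 1) * M * (K ^ μ * K * (‖w - z‖ ^ μ * ‖w - z‖)) := by gcongr
      _ = _ := by ring
  have hdiff : DifferentiableOn ℂ Φ O := fun z hz =>
    (hder z hz).differentiableAt.differentiableWithinAt
  have h2 := hdiff.deriv hO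
  have h3 : DifferentiableOn ℂ (fun z => -Complex.I * deriv Φ z) O := h2.const_mul _
  refine h3.congr fun z hz => ?_
  rw [(hder z hz).deriv, ← mul_assoc]
  simp

lemma const_of_im_zero {O : Set ℂ} (hO : IsOpen O) (hconv : Convex ℝ O) {Ψ : ℂ → ℂ}
    (hd : DifferentiableOn ℂ Ψ O) (him : ∀ z ∈ O, (Ψ z).im = 0) {z w : ℂ} (hz : z ∈ O)
    (hw : w ∈ O) : Ψ z = Ψ w := by
  refine hO.is_const_of_deriv_eq_zero hconv.isPreconnected hd ?_ hz hw
  intro x hx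
  have hx' := (hd x hx).differentiableAt (hO.mem_nhds hx)
  have h1 := hx'.hasDerivAt.hasFDerivAt.restrictScalars ℝ
  have h2 := Complex.imCLM.hasFDerivAt.comp x h1
  have h3 : HasFDerivAt (fun y => (Ψ y).im) (0 : ℂ →L[ℝ] ℝ) x := by
    refine (hasFDerivAt_const (0 : ℝ) x).congr_of_eventuallyEq ?_
    filter_upwards [hO.mem_nhds hx] with y hy using him y hy
  have h4 := h2.unique h3
  have e1 := congrArg (fun L => L 1) h4
  have e2 := congrArg (fun L => L Complex.I) h4
  simp at e1 e2
  exact Complex.ext e2 e1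

lemma ymap_surj (ht2 : 0 < t2) (y : ℝ × ℝ) :
    ∃ z : ℂ, ymap t1 t2 A z = y ∧ z.re = t2 * (y.2 + A) := by
  refine ⟨⟨t2 * (y.2 + A), -(y.1 + t1 * (y.2 + A))⟩, ?_, rfl⟩
  ext
  · simp [ymap]; field_simp; ring
  · simp [ymap]; field_simp; ring

lemma F1_growth (hμ : 0 < μ) (ht2 : 0 < t2)
    (hU0 : ∀ y y', |U0 y - U0 y'| ≤ ‖y - y'‖ ^ μ) (hU1 : ∀ y y', |U1 y - U1 y'| ≤ ‖y - y'‖ ^ μ) :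
    ∃ C, 0 ≤ C ∧ ∀ z w, ‖F1 b c t1 t2 A U0 U1 z - F1 b c t1 t2 A U0 U1 w‖ ≤ C * ‖z - w‖ ^ μ := by
  set α : ℂ := ((b / c + t1 : ℝ) + (t2 : ℝ) * Complex.I) with hα
  set K := 1 + |t1 / t2| + 1 / t2 with hK
  have hK0 : 0 ≤ K := by positivity
  refine ⟨(‖α‖ + 1) * K ^ μ, by positivity, fun z w => ?_⟩
  set y := ymap t1 t2 A z with hy
  set y' := ymap t1 t2 A w with hy'
  have hyp : ‖y - y'‖ ^ μ ≤ K ^ μ * ‖z - w‖ ^ μ := by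
    rw [← Real.mul_rpow hK0 (norm_nonneg _)]
    exact Real.rpow_le_rpow (norm_nonneg _) (ymap_sub t1 t2 A ht2 w z) hμ.le
  have : F1 b c t1 t2 A U0 U1 z - F1 b c t1 t2 A U0 U1 w
      = α * ((U0 y - U0 y' : ℝ) : ℂ) + ((U1 y - U1 y' : ℝ) : ℂ) := by
    simp only [F1, ← hα, ← hy, ← hy']; push_cast; ring
  rw [this]
  calc _ ≤ ‖α‖ * |U0 y - U0 y'| + |U1 y - U1 y'| := by
        refine (norm_add_le _ _).trans ?_
        rw [norm_mul, Complex.norm_real, Complex.norm_real]; simp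
    _ ≤ ‖α‖ * ‖y - y'‖ ^ μ + ‖y - y'‖ ^ μ := by gcongr; exacts [hU0 _ _, hU1 _ _]
    _ = (‖α‖ + 1) * ‖y - y'‖ ^ μ := by ring
    _ ≤ (‖α‖ + 1) * (K ^ μ * ‖z - w‖ ^ μ) := by gcongr
    _ = _ := by ring

lemma holder_continuous (hμ : 0 < μ) {C : ℝ} {Ψ : ℂ → ℂ}
    (h : ∀ z w, ‖Ψ z - Ψ w‖ ≤ C * ‖z - w‖ ^ μ) : Continuous Ψ := by
  rw [continuous_iff_continuousAt]
  intro x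
  rw [ContinuousAt, tendsto_iff_norm_sub_tendsto_zero]
  refine squeeze_zero (fun _ => norm_nonneg _) (fun z => h z x) ?_
  have : Continuous fun z : ℂ => C * ‖z - x‖ ^ μ :=
    continuous_const.mul ((continuous_norm.comp (continuous_id.sub continuous_const)).rpow_const
      fun _ => Or.inr hμ.le)
  exact this.tendsto' _ _ (by simp [Real.zero_rpow hμ.ne'])

lemma roots (hc : 0 < c) (hell : b ^ 2 < 4 * a * c) : ∃ t1 t2 : ℝ, 0 < t2 ∧
    c * (t1 ^ 2 - t2 ^ 2) + b * t1 + a = 0 ∧ 2 * c * t1 + b = 0 := by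
  refine ⟨-b / (2 * c), Real.sqrt (4 * a * c - b ^ 2) / (2 * c), ?_, ?_, ?_⟩
  · have : 0 < Real.sqrt (4 * a * c - b ^ 2) := Real.sqrt_pos.2 (by linarith)
    positivity
  · rw [div_pow, div_pow, Real.sq_sqrt (by linarith)]
    field_simp
    ring
  · field_simp; ring

lemma U_const_of_F1 (hc : 0 < c) (ht2 : 0 < t2) {Ω : Set (ℝ × ℝ)}
    (heq : ∀ y ∈ Ω, a * U0 y + b * U1 y + c * U2 y = 0) {y y' : ℝ × ℝ} (hy : y ∈ Ω) (hy' : y' ∈ Ω)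
    {z z' : ℂ} (hz : ymap t1 t2 A z = y) (hz' : ymap t1 t2 A z' = y')
    (hF : F1 b c t1 t2 A U0 U1 z = F1 b c t1 t2 A U0 U1 z') :
    U0 y = U0 y' ∧ U1 y = U1 y' ∧ U2 y = U2 y' := by
  simp only [F1, hz, hz'] at hF
  have e1 := congrArg Complex.re hF
  have e2 := congrArg Complex.im hF
  simp [ht2.ne'] at e1 e2
  rw [e2] at e1
  have e3 : U1 y = U1 y' := by linarith
  refine ⟨e2, e3, ?_⟩
  have f1 := heq y hy
  have f2 := heq y' hy'
  rw [e2, e3] at f1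
  have : c * (U2 y - U2 y') = 0 := by linarith
  have := (mul_eq_zero.1 this).resolve_left hc.ne'
  linarith

lemma liouville_full (hμ : 0 < μ) (hμ1 : μ < 1) (hM : 0 ≤ M) (hc : 0 < c) (hell : b ^ 2 < 4 * a * c)
    (hU0 : ∀ y y', |U0 y - U0 y'| ≤ ‖y - y'‖ ^ μ) (hU1 : ∀ y y', |U1 y - U1 y'| ≤ ‖y - y'‖ ^ μ)
    (hT1 : ∀ y y', |G1 y' - G1 y - (U0 y * (y'.1 - y.1) + U1 y * (y'.2 - y.2))|
      ≤ M * ‖y' - y‖ ^ μ * ‖y' - y‖)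
    (hT2 : ∀ y y', |G2 y' - G2 y - (U1 y * (y'.1 - y.1) + U2 y * (y'.2 - y.2))|
      ≤ M * ‖y' - y‖ ^ μ * ‖y' - y‖)
    (heq : ∀ y, a * U0 y + b * U1 y + c * U2 y = 0) (y y' : ℝ × ℝ) :
    U0 y = U0 y' ∧ U1 y = U1 y' ∧ U2 y = U2 y' := by
  obtain ⟨t1, t2, ht2, hre, him⟩ := roots hc hell
  have hd := F1_holo (A := 0) hμ hc ht2 hM hre him isOpen_univ (Ω := univ)
    (fun _ _ => mem_univ _) (fun y _ y' _ => hT1 y y') (fun y _ y' _ => hT2 y y')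
    (fun y _ => heq y)
  rw [differentiableOn_univ] at hd
  obtain ⟨C, hC, hg⟩ := F1_growth (b := b) (c := c) (A := 0) (t1 := t1) hμ ht2 hU0 hU1
  obtain ⟨z, hz, -⟩ := ymap_surj (t1 := t1) (A := 0) ht2 y
  obtain ⟨z', hz', -⟩ := ymap_surj (t1 := t1) (A := 0) ht2 y'
  refine U_const_of_F1 hc ht2 (Ω := univ) (fun y _ => heq y) (mem_univ _) (mem_univ _) hz hz' ?_
  refine is_const_of_deriv_eq_zero hd (fun w => ?_) z z'
  set Fs := F1 b c t1 t2 0 U0 U1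
  have hb : ∀ R : ℝ, 0 < R → ‖deriv Fs w‖ ≤ C * R ^ (-(1 - μ)) := by
    intro R hR
    have hd' : Differentiable ℂ (fun x => Fs x - Fs w) := hd.sub_const _
    have := Complex.norm_deriv_le_of_forall_mem_sphere_norm_le (f := fun x => Fs x - Fs w)
      (C := C * R ^ μ) hR hd'.diffContOnCl (c := w) (fun x hx => by
        have := hg x w
        rwa [mem_sphere_iff_norm.1 hx] at this)
    rw [deriv_sub_const] at this
    refine this.trans (le_of_eq ?_)
    rw [mul_div_assoc, neg_sub, Real.rpow_sub hR, Real.rpow_one]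
  have ht : Tendsto (fun R : ℝ => C * R ^ (-(1 - μ))) atTop (𝓝 0) := by
    simpa using (tendsto_rpow_neg_atTop (y := 1 - μ) (by linarith)).const_mul C
  have := ge_of_tendsto ht ((eventually_gt_atTop 0).mono fun R hR => hb R hR)
  exact norm_le_zero_iff.1 this

lemma liouville_half (hμ : 0 < μ) (hμ1 : μ < 1) (hM : 0 ≤ M) (hc : 0 < c) (hell : b ^ 2 < 4 * a * c)
    (hU0 : ∀ y y', |U0 y - U0 y'| ≤ ‖y - y'‖ ^ μ) (hU1 : ∀ y y', |U1 y - U1 y'| ≤ ‖y - y'‖ ^ μ)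
    (A : ℝ)
    (hT1 : ∀ y y' : ℝ × ℝ, -A < y.2 → -A < y'.2 →
      |G1 y' - G1 y - (U0 y * (y'.1 - y.1) + U1 y * (y'.2 - y.2))| ≤ M * ‖y' - y‖ ^ μ * ‖y' - y‖)
    (hT2 : ∀ y y' : ℝ × ℝ, -A < y.2 → -A < y'.2 →
      |G2 y' - G2 y - (U1 y * (y'.1 - y.1) + U2 y * (y'.2 - y.2))| ≤ M * ‖y' - y‖ ^ μ * ‖y' - y‖)
    (heq : ∀ y : ℝ × ℝ, -A < y.2 → a * U0 y + b * U1 y + c * U2 y = 0)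
    (hbd : ∀ x x', U0 (x, -A) = U0 (x', -A)) (y y' : ℝ × ℝ) (hy : -A < y.2) (hy' : -A < y'.2) :
    U0 y = U0 y' ∧ U1 y = U1 y' ∧ U2 y = U2 y' := by
  obtain ⟨t1, t2, ht2, hre, him⟩ := roots hc hell
  set O : Set ℂ := {z | 0 < z.re} with hOdef
  have hO : IsOpen O := isOpen_lt continuous_const Complex.continuous_re
  have hOc : Convex ℝ O := convex_halfSpace_re_gt 0
  set Ω : Set (ℝ × ℝ) := {y | -A < y.2} with hΩ
  have hd := F1_holo (A := A) hμ hc ht2 hM hre him hO (Ω := Ω) (U2 := U2) (G1 := G1) (G2 := G2)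
    (U0 := U0) (U1 := U1)
    (fun z hz => by
      change -A < z.re / t2 - A
      have : 0 < z.re / t2 := div_pos hz ht2
      linarith) (fun y hy y' hy' => hT1 y y' hy hy') (fun y hy y' hy' => hT2 y y' hy hy')
    (fun y hy => heq y hy)
  obtain ⟨C, hC, hg⟩ := F1_growth (b := b) (c := c) (A := A) (t1 := t1) hμ ht2 hU0 hU1
  obtain ⟨z, hz, hzr⟩ := ymap_surj (t1 := t1) (A := A) ht2 y
  obtain ⟨z', hz', hzr'⟩ := ymap_surj (t1 := t1) (A := A) ht2 y'
  have hzO : z ∈ O := by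
    change 0 < z.re
    rw [hzr]; exact mul_pos ht2 (by linarith)
  have hzO' : z' ∈ O := by
    change 0 < z'.re
    rw [hzr']; exact mul_pos ht2 (by linarith)
  refine U_const_of_F1 hc ht2 (Ω := Ω) (fun y hy => heq y hy) hy hy' hz hz' ?_
  set Fs := F1 b c t1 t2 A U0 U1 with hFs
  set k : ℂ := ((t2 * U0 (0, -A) : ℝ) : ℂ) * Complex.I with hk
  have hcont : Continuous Fs := holder_continuous hμ hg
  have hdc : DiffContOnCl ℂ (fun w => Fs w - k) O :=
    ⟨hd.sub_const _, (hcont.sub continuous_const).continuousOn⟩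
  have him1 : ∀ w, (Fs w - k).im = t2 * (U0 (ymap t1 t2 A w) - U0 (0, -A)) := by
    intro w; simp [hFs, F1, hk]; ring
  have hbz : ∀ x : ℝ, (Fs (x * Complex.I) - k).im = 0 := by
    intro x
    rw [him1]
    have : ymap t1 t2 A (x * Complex.I) = (-x, -A) := by simp [ymap]
    rw [this, hbd (-x) 0]; simp
  have hgr : ∀ w : ℂ, 0 ≤ w.re → |(Fs w - k).im| ≤ C * ‖w‖ ^ μ := by
    intro w _
    have e1 : (Fs w - k).im = (Fs w - Fs 0).im := by
      have := hbz 0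
      simp only [Complex.ofReal_zero, zero_mul, Complex.sub_im] at this
      simp only [Complex.sub_im]; linarith
    rw [e1]
    refine (Complex.abs_im_le_norm _).trans ?_
    simpa using hg w 0
  have hzero : ∀ w ∈ O, (Fs w - k).im = 0 := by
    intro w hw
    have h1 := pl_core hμ hμ1 hC hdc hgr hbz (z := w) (le_of_lt hw)
    have h2 := pl_core (Ψ := fun w => -(Fs w - k)) hμ hμ1 hC hdc.neg
      (fun w hw => by
        rw [Complex.neg_im, abs_neg]; exact hgr w hw)
      (fun x => by rw [Complex.neg_im, hbz, neg_zero]) (z := w) (le_of_lt hw)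
    rw [Complex.neg_im] at h2
    linarith
  have := const_of_im_zero hO hOc (hd.sub_const k) hzero hzO hzO'
  simpa using this
end

lemma ulim_exists (𝒰 : Ultrafilter ℕ) (x : ℕ → ℝ) (M : ℝ) (h : ∀ᶠ n in (𝒰 : Filter ℕ), |x n| ≤ M) :
    ∃ l, Tendsto x 𝒰 (𝓝 l) := by
  have hc : IsCompact (Icc (-M) M) := isCompact_Icc
  obtain ⟨l, -, hl⟩ := hc.ultrafilter_le_nhds (𝒰.map x) (by
    rw [le_principal_iff]
    change ∀ᶠ n in (𝒰 : Filter ℕ), x n ∈ Icc (-M) M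
    filter_upwards [h] with n hn using abs_le.1 hn)
  exact ⟨l, hl⟩

lemma eq_of_small {μ : ℝ} (hμ : 0 < μ) {x K : ℝ} (h : ∀ ε : ℝ, 0 < ε → |x| ≤ K * ε ^ μ) : x = 0 := by
  have h1 : Tendsto (fun ε : ℝ => K * ε ^ μ) (𝓝[>] 0) (𝓝 0) := by
    have : Tendsto (fun ε : ℝ => K * ε ^ μ) (𝓝 0) (𝓝 (K * 0 ^ μ)) :=
      (tendsto_id.rpow_const (Or.inr hμ.le)).const_mul K
    rw [Real.zero_rpow hμ.ne', mul_zero] at this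
    exact this.mono_left nhdsWithin_le_nhds
  have := ge_of_tendsto h1 (eventually_mem_nhdsWithin.mono fun ε hε => h ε hε)
  exact abs_nonpos_iff.1 this

section
variable {μ M a b c : ℝ} {G1 G2 : ℝ × ℝ → ℝ} {V : Fin 3 → ℝ × ℝ → ℝ}

lemma liouville_up (hμ : 0 < μ) (hμ1 : μ < 1) (hM : 0 ≤ M) (hc : 0 < c) (hell : b ^ 2 < 4 * a * c)
    (hV : ∀ i y y', |V i y - V i y'| ≤ ‖y - y'‖ ^ μ) (A : ℝ) (hA : 0 ≤ A)
    (hT1 : ∀ y y' : ℝ × ℝ, -A < y.2 → -A < y'.2 →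
      |G1 y' - G1 y - (V 0 y * (y'.1 - y.1) + V 1 y * (y'.2 - y.2))| ≤ M * ‖y' - y‖ ^ μ * ‖y' - y‖)
    (hT2 : ∀ y y' : ℝ × ℝ, -A < y.2 → -A < y'.2 →
      |G2 y' - G2 y - (V 1 y * (y'.1 - y.1) + V 2 y * (y'.2 - y.2))| ≤ M * ‖y' - y‖ ^ μ * ‖y' - y‖)
    (heq : ∀ y : ℝ × ℝ, -A < y.2 → a * V 0 y + b * V 1 y + c * V 2 y = 0)
    (hbd : ∀ x x', V 0 (x, -A) = V 0 (x', -A)) (y : ℝ × ℝ) (hy : -A ≤ y.2) (i : Fin 3) :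
    V i y = V i 0 := by
  rw [← sub_eq_zero]
  refine eq_of_small hμ (K := 2) fun ε hε => ?_
  have hn : ‖((0 : ℝ), ε)‖ = ε := by
    rw [Prod.norm_def]; simp [abs_of_pos hε, hε.le]
  have hL := liouville_half hμ hμ1 hM hc hell (hV 0) (hV 1) A hT1 hT2 heq hbd (y + (0, ε))
    (0 + (0, ε)) (by simp; linarith) (by simp; linarith)
  have hLi : V i (y + (0, ε)) = V i (0 + (0, ε)) := by
    fin_cases i
    exacts [hL.1, hL.2.1, hL.2.2]
  have e1 := hV i y (y + (0, ε))
  have e2 := hV i (0 + (0, ε)) 0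
  have n1 : ‖y - (y + (0, ε))‖ = ε := by rw [sub_add_cancel_left, norm_neg, hn]
  have n2 : ‖(0 : ℝ × ℝ) + (0, ε) - 0‖ = ε := by rw [zero_add, sub_zero, hn]
  rw [n1] at e1
  rw [n2] at e2
  calc |V i y - V i 0| = |(V i y - V i (y + (0, ε))) + (V i (0 + (0, ε)) - V i 0)| := by
        rw [hLi]; congr 1; ring
    _ ≤ _ := abs_add_le _ _
    _ ≤ 2 * ε ^ μ := by linarith

def rfl2 (y : ℝ × ℝ) : ℝ × ℝ := (y.1, -y.2)

lemma rfl2_sub (y y' : ℝ × ℝ) : ‖rfl2 y - rfl2 y'‖ = ‖y - y'‖ := by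
  rw [Prod.norm_def, Prod.norm_def]
  simp only [rfl2, Prod.fst_sub, Prod.snd_sub]
  congr 1
  rw [← norm_neg]; congr 1; ring

lemma liouville_low (hμ : 0 < μ) (hμ1 : μ < 1) (hM : 0 ≤ M) (hc : 0 < c) (hell : b ^ 2 < 4 * a * c)
    (hV : ∀ i y y', |V i y - V i y'| ≤ ‖y - y'‖ ^ μ) (A : ℝ) (hA : 0 ≤ A)
    (hT1 : ∀ y y' : ℝ × ℝ, y.2 < A → y'.2 < A →
      |G1 y' - G1 y - (V 0 y * (y'.1 - y.1) + V 1 y * (y'.2 - y.2))| ≤ M * ‖y' - y‖ ^ μ * ‖y' - y‖)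
    (hT2 : ∀ y y' : ℝ × ℝ, y.2 < A → y'.2 < A →
      |G2 y' - G2 y - (V 1 y * (y'.1 - y.1) + V 2 y * (y'.2 - y.2))| ≤ M * ‖y' - y‖ ^ μ * ‖y' - y‖)
    (heq : ∀ y : ℝ × ℝ, y.2 < A → a * V 0 y + b * V 1 y + c * V 2 y = 0)
    (hbd : ∀ x x', V 0 (x, A) = V 0 (x', A)) (y : ℝ × ℝ) (hy : y.2 ≤ A) (i : Fin 3) :
    V i y = V i 0 := by
  have key := liouville_up (μ := μ) (M := M) (a := a) (b := -b) (c := c)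
    (G1 := fun y => G1 (rfl2 y)) (G2 := fun y => -G2 (rfl2 y))
    (V := ![fun y => V 0 (rfl2 y), fun y => -V 1 (rfl2 y), fun y => V 2 (rfl2 y)])
    hμ hμ1 hM hc (by simpa using hell) ?_ A hA ?_ ?_ ?_ ?_ (rfl2 y) (by simp [rfl2]; exact hy) i
  · have h0 : rfl2 0 = 0 := by simp [rfl2]
    have h1 : rfl2 (rfl2 y) = y := by simp [rfl2]
    fin_cases i
    · simpa [h0, h1] using key
    · simpa [h0, h1] using key
    · simpa [h0, h1] using key
  · intro j y y'
    fin_cases j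
    · have := hV 0 (rfl2 y) (rfl2 y')
      rw [rfl2_sub] at this
      simpa using this
    · have := hV 1 (rfl2 y') (rfl2 y)
      rw [rfl2_sub, norm_sub_rev] at this
      simp only [Fin.mk_one, Matrix.cons_val_one, Matrix.cons_val_zero]
      rw [show -V 1 (rfl2 y) - -V 1 (rfl2 y') = V 1 (rfl2 y') - V 1 (rfl2 y) by ring]
      exact this
    · have := hV 2 (rfl2 y) (rfl2 y')
      rw [rfl2_sub] at this
      simpa using this
  · intro y y' h1 h2
    have := hT1 (rfl2 y) (rfl2 y') (by simp [rfl2]; linarith) (by simp [rfl2]; linarith)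
    rw [rfl2_sub] at this
    convert this using 2
    simp [rfl2]; ring
  · intro y y' h1 h2
    have := hT2 (rfl2 y) (rfl2 y') (by simp [rfl2]; linarith) (by simp [rfl2]; linarith)
    rw [rfl2_sub, ← abs_neg] at this
    convert this using 2
    simp [rfl2]; ring
  · intro y h1
    have := heq (rfl2 y) (by simp [rfl2]; linarith)
    simp; linarith
  · intro x x'
    simpa [rfl2] using hbd x x'
end

structure Blow (p0 μ lam Lam : ℝ) (n : ℝ) where
  a : ℝ
  b : ℝ
  c : ℝ
  A : ℝ
  B : ℝ
  e : ℝ × ℝ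
  V : Fin 3 → ℝ × ℝ → ℝ
  W1 : ℝ × ℝ → ℝ
  W2 : ℝ × ℝ → ℝ
  ha : |a| ≤ Lam
  hb : |b| ≤ Lam
  hc : |c| ≤ Lam
  hc' : lam ≤ c
  hell : lam ≤ 4 * a * c - b ^ 2
  hA : 0 ≤ A
  hB : 0 ≤ B
  hAB : -p0 * (n / 4) ^ (1 / μ) ≤ A + B
  he : ‖e‖ = 1
  heA : -A ≤ e.2
  heB : e.2 ≤ B
  hVe : 1 / 2 ≤ |V 0 e| + |V 1 e| + |V 2 e|
  hV : ∀ i y y', |V i y - V i y'| ≤ ‖y - y'‖ ^ μ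
  hV0 : ∀ i, V i 0 = 0
  hT1 : ∀ y y' : ℝ × ℝ, -A ≤ y.2 → y.2 ≤ B → -A ≤ y'.2 → y'.2 ≤ B →
      |W1 y' - W1 y - (V 0 y * (y'.1 - y.1) + V 1 y * (y'.2 - y.2))| ≤ 2 * ‖y' - y‖ ^ μ * ‖y' - y‖
  hT2 : ∀ y y' : ℝ × ℝ, -A ≤ y.2 → y.2 ≤ B → -A ≤ y'.2 → y'.2 ≤ B →
      |W2 y' - W2 y - (V 1 y * (y'.1 - y.1) + V 2 y * (y'.2 - y.2))| ≤ 2 * ‖y' - y‖ ^ μ * ‖y' - y‖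
  hW1 : W1 0 = 0
  hW2 : W2 0 = 0
  heq : ∀ y : ℝ × ℝ, -A ≤ y.2 → y.2 ≤ B → |a * V 0 y + b * V 1 y + c * V 2 y|
      ≤ (1 + 15 * Lam) / n * (‖y‖ ^ μ + ‖y‖ ^ μ * ‖y‖ ^ μ)
  hbA : ∀ x x' : ℝ, |V 0 (x, -A) - V 0 (x', -A)| ≤ 1 / n * |x - x'| ^ μ
  hbB : ∀ x x' : ℝ, |V 0 (x, B) - V 0 (x', B)| ≤ 1 / n * |x - x'| ^ μ

lemma limit_bd {μ : ℝ} (hμ : 0 < μ) (𝒰 : Ultrafilter ℕ) (h𝒰 : (𝒰 : Filter ℕ) ≤ atTop)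
    {V : ℕ → ℝ × ℝ → ℝ} {Vl : ℝ × ℝ → ℝ} (hV : ∀ n y y', |V n y - V n y'| ≤ ‖y - y'‖ ^ μ)
    (hl : ∀ y, Tendsto (fun n => V n y) 𝒰 (𝓝 (Vl y))) {A : ℕ → ℝ} {Al : ℝ}
    (hA : Tendsto A 𝒰 (𝓝 Al))
    (hb : ∀ n x x', |V n (x, A n) - V n (x', A n)| ≤ 1 / ((n : ℝ) + 1) * |x - x'| ^ μ) (x x' : ℝ) :
    Vl (x, Al) = Vl (x', Al) := by
  have h1 : ∀ n, |V n (x, Al) - V n (x', Al)| ≤ 1 / ((n : ℝ) + 1) * |x - x'| ^ μ + 2 * |A n - Al| ^ μ := by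
    intro n
    have e1 := hV n (x, Al) (x, A n)
    have e2 := hV n (x', A n) (x', Al)
    have n1 : ‖((x, Al) : ℝ × ℝ) - (x, A n)‖ = |A n - Al| := by
      rw [Prod.norm_def]; simp [abs_sub_comm]
    have n2 : ‖((x', A n) : ℝ × ℝ) - (x', Al)‖ = |A n - Al| := by
      rw [Prod.norm_def]; simp
    rw [n1] at e1
    rw [n2] at e2
    have e3 := hb n x x'
    calc |V n (x, Al) - V n (x', Al)| = |(V n (x, Al) - V n (x, A n)) + (V n (x, A n) - V n (x', A n))
          + (V n (x', A n) - V n (x', Al))| := by congr 1; ring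
      _ ≤ _ := abs_add_three _ _ _
      _ ≤ _ := by linarith
  have h2 : Tendsto (fun n : ℕ => 1 / ((n : ℝ) + 1) * |x - x'| ^ μ + 2 * |A n - Al| ^ μ) 𝒰 (𝓝 0) := by
    have t1 : Tendsto (fun n : ℕ => 1 / ((n : ℝ) + 1) * |x - x'| ^ μ) 𝒰 (𝓝 0) := by
      have := (tendsto_one_div_add_atTop_nhds_zero_nat (𝕜 := ℝ)).mul_const (|x - x'| ^ μ)
      rw [zero_mul] at this
      exact this.mono_left h𝒰
    have t2 : Tendsto (fun n => |A n - Al|) 𝒰 (𝓝 0) := by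
      have := (hA.sub_const Al).abs
      simpa using this
    have t3 := (t2.rpow_const (p := μ) (Or.inr hμ.le)).const_mul 2
    rw [Real.zero_rpow hμ.ne', mul_zero] at t3
    simpa using t1.add t3
  have h3 := le_of_tendsto_of_tendsto ((hl (x, Al)).sub (hl (x', Al))).abs h2 (Eventually.of_forall h1)
  exact sub_eq_zero.1 (abs_nonpos_iff.1 h3)

theorem no_blow {p0 μ lam Lam : ℝ} (hp0 : p0 < 0) (hμ : 0 < μ) (hμ1 : μ < 1) (hlam : 0 < lam)
    (D : ∀ n : ℕ, Blow p0 μ lam Lam ((n : ℝ) + 1)) : False := by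
  set 𝒰 : Ultrafilter ℕ := hyperfilter ℕ with h𝒰def
  have h𝒰 : (𝒰 : Filter ℕ) ≤ atTop := by
    rw [← Nat.cofinite_eq_atTop]; exact hyperfilter_le_cofinite
  obtain ⟨a, ha⟩ := ulim_exists 𝒰 (fun n => (D n).a) Lam (Eventually.of_forall fun n => (D n).ha)
  obtain ⟨b, hb⟩ := ulim_exists 𝒰 (fun n => (D n).b) Lam (Eventually.of_forall fun n => (D n).hb)
  obtain ⟨c, hc⟩ := ulim_exists 𝒰 (fun n => (D n).c) Lam (Eventually.of_forall fun n => (D n).hc)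
  have hen1 : ∀ n, |(D n).e.1| ≤ 1 := fun n => by
    have := norm_fst_le (D n).e
    rwa [(D n).he] at this
  have hen2 : ∀ n, |(D n).e.2| ≤ 1 := fun n => by
    have := norm_snd_le (D n).e
    rwa [(D n).he] at this
  obtain ⟨e1, he1⟩ := ulim_exists 𝒰 (fun n => (D n).e.1) 1 (Eventually.of_forall hen1)
  obtain ⟨e2, he2⟩ := ulim_exists 𝒰 (fun n => (D n).e.2) 1 (Eventually.of_forall hen2)
  have hVb : ∀ n i y, |(D n).V i y| ≤ ‖y‖ ^ μ := fun n i y => by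
    have := (D n).hV i y 0
    simpa [(D n).hV0] using this
  have hVl : ∀ i y, ∃ l, Tendsto (fun n => (D n).V i y) 𝒰 (𝓝 l) := fun i y =>
    ulim_exists 𝒰 _ (‖y‖ ^ μ) (Eventually.of_forall fun n => hVb n i y)
  choose V hVt using hVl
  set dom : ℝ × ℝ → Prop := fun y => ∀ᶠ n in (𝒰 : Filter ℕ), -(D n).A ≤ y.2 ∧ y.2 ≤ (D n).B with hdom
  have hW1l : ∀ y, ∃ l, dom y → Tendsto (fun n => (D n).W1 y) 𝒰 (𝓝 l) := by
    intro y
    by_cases hy : dom y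
    · obtain ⟨l, hl⟩ := ulim_exists 𝒰 (fun n => (D n).W1 y) (2 * ‖y‖ ^ μ * ‖y‖) (by
        filter_upwards [hy] with n hn
        have := (D n).hT1 0 y (by simpa using (D n).hA) (by simpa using (D n).hB) hn.1 hn.2
        simpa [(D n).hV0, (D n).hW1] using this)
      exact ⟨l, fun _ => hl⟩
    · exact ⟨0, fun h => (hy h).elim⟩
  have hW2l : ∀ y, ∃ l, dom y → Tendsto (fun n => (D n).W2 y) 𝒰 (𝓝 l) := by
    intro y
    by_cases hy : dom y
    · obtain ⟨l, hl⟩ := ulim_exists 𝒰 (fun n => (D n).W2 y) (2 * ‖y‖ ^ μ * ‖y‖) (by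
        filter_upwards [hy] with n hn
        have := (D n).hT2 0 y (by simpa using (D n).hA) (by simpa using (D n).hB) hn.1 hn.2
        simpa [(D n).hV0, (D n).hW2] using this)
      exact ⟨l, fun _ => hl⟩
    · exact ⟨0, fun h => (hy h).elim⟩
  choose W1 hW1 using hW1l
  choose W2 hW2 using hW2l
  have hVH : ∀ i y y', |V i y - V i y'| ≤ ‖y - y'‖ ^ μ := fun i y y' =>
    le_of_tendsto ((hVt i y).sub (hVt i y')).abs (Eventually.of_forall fun n => (D n).hV i y y')
  have hV0 : ∀ i, V i 0 = 0 := fun i => by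
    refine tendsto_nhds_unique (hVt i 0) ?_
    simp only [(D _).hV0]
    exact tendsto_const_nhds
  have hT1 : ∀ y y', dom y → dom y' →
      |W1 y' - W1 y - (V 0 y * (y'.1 - y.1) + V 1 y * (y'.2 - y.2))| ≤ 2 * ‖y' - y‖ ^ μ * ‖y' - y‖ := by
    intro y y' hy hy'
    refine le_of_tendsto ((((hW1 y' hy').sub (hW1 y hy)).sub
      (((hVt 0 y).mul_const _).add ((hVt 1 y).mul_const _)))).abs ?_
    filter_upwards [hy, hy'] with n h1 h2
    exact (D n).hT1 y y' h1.1 h1.2 h2.1 h2.2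
  have hT2 : ∀ y y', dom y → dom y' →
      |W2 y' - W2 y - (V 1 y * (y'.1 - y.1) + V 2 y * (y'.2 - y.2))| ≤ 2 * ‖y' - y‖ ^ μ * ‖y' - y‖ := by
    intro y y' hy hy'
    refine le_of_tendsto ((((hW2 y' hy').sub (hW2 y hy)).sub
      (((hVt 1 y).mul_const _).add ((hVt 2 y).mul_const _)))).abs ?_
    filter_upwards [hy, hy'] with n h1 h2
    exact (D n).hT2 y y' h1.1 h1.2 h2.1 h2.2
  have heq : ∀ y, dom y → a * V 0 y + b * V 1 y + c * V 2 y = 0 := by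
    intro y hy
    have t1 := (((ha.mul (hVt 0 y)).add (hb.mul (hVt 1 y))).add (hc.mul (hVt 2 y))).abs
    have t2 : Tendsto (fun n : ℕ => (1 + 15 * Lam) / ((n : ℝ) + 1) * (‖y‖ ^ μ + ‖y‖ ^ μ * ‖y‖ ^ μ)) 𝒰 (𝓝 0) := by
      have := ((tendsto_one_div_add_atTop_nhds_zero_nat (𝕜 := ℝ)).const_mul (1 + 15 * Lam)).mul_const
        (‖y‖ ^ μ + ‖y‖ ^ μ * ‖y‖ ^ μ)
      simp only [mul_zero, zero_mul] at this
      refine (this.mono_left h𝒰).congr fun n => ?_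
      ring
    have t3 := le_of_tendsto_of_tendsto t1 t2 (by
      filter_upwards [hy] with n hn
      exact (D n).heq y hn.1 hn.2)
    exact abs_nonpos_iff.1 t3
  have hcpos : 0 < c := lt_of_lt_of_le hlam (ge_of_tendsto hc (Eventually.of_forall fun n => (D n).hc'))
  have hell : b ^ 2 < 4 * a * c := by
    have := ge_of_tendsto (((ha.const_mul 4).mul hc).sub (hb.pow 2))
      (Eventually.of_forall fun n => (D n).hell)
    linarith
  have hVe : 1 / 2 ≤ |V 0 (e1, e2)| + |V 1 (e1, e2)| + |V 2 (e1, e2)| := by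
    have hte : Tendsto (fun n => ‖(D n).e - (e1, e2)‖) 𝒰 (𝓝 0) := by
      have t1 := (he1.prodMk_nhds he2)
      have := (t1.sub_const (e1, e2)).norm
      simpa using this
    have hVi : ∀ i, Tendsto (fun n => (D n).V i (D n).e) 𝒰 (𝓝 (V i (e1, e2))) := by
      intro i
      have t3 := (hte.rpow_const (p := μ) (Or.inr hμ.le))
      rw [Real.zero_rpow hμ.ne'] at t3
      have t4 : Tendsto (fun n => (D n).V i (D n).e - (D n).V i (e1, e2)) 𝒰 (𝓝 0) :=
        squeeze_zero_norm (fun n => (D n).hV i _ _) t3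
      have := t4.add (hVt i (e1, e2))
      simpa using this
    exact ge_of_tendsto (((hVi 0).abs.add (hVi 1).abs).add (hVi 2).abs)
      (Eventually.of_forall fun n => (D n).hVe)
  have fin : ¬ (∀ i, V i (e1, e2) = V i 0) := by
    intro h
    simp only [h, hV0] at hVe
    norm_num at hVe
  have unb : ∀ x : ℕ → ℝ, (¬ ∃ K, ∀ᶠ n in (𝒰 : Filter ℕ), x n ≤ K) → ∀ K, ∀ᶠ n in (𝒰 : Filter ℕ), K ≤ x n := by
    intro x hx K
    by_contra hK
    refine hx ⟨K, ?_⟩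
    rw [← Ultrafilter.eventually_not] at hK
    filter_upwards [hK] with n hn
    linarith
  have hAB : ∀ K, ∀ᶠ n in (𝒰 : Filter ℕ), K ≤ (D n).A + (D n).B := by
    intro K
    have t1 : Tendsto (fun n : ℕ => -p0 * (((n : ℝ) + 1) / 4) ^ (1 / μ)) atTop atTop := by
      refine Tendsto.const_mul_atTop (by linarith) ?_
      refine (tendsto_rpow_atTop (by positivity)).comp ?_
      exact (tendsto_atTop_add_const_right _ _ tendsto_natCast_atTop_atTop).atTop_div_const (by norm_num)
    filter_upwards [h𝒰 (t1.eventually_ge_atTop K)] with n hn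
    exact le_trans hn (D n).hAB
  by_cases hAb : ∃ K, ∀ᶠ n in (𝒰 : Filter ℕ), (D n).A ≤ K
  · obtain ⟨K, hK⟩ := hAb
    obtain ⟨Al, hAl⟩ := ulim_exists 𝒰 (fun n => (D n).A) K (by
      filter_upwards [hK] with n hn
      rwa [abs_of_nonneg (D n).hA])
    have hAl0 : 0 ≤ Al := ge_of_tendsto hAl (Eventually.of_forall fun n => (D n).hA)
    have hd : ∀ y : ℝ × ℝ, -Al < y.2 → dom y := by
      intro y hy
      have : ∀ᶠ n in (𝒰 : Filter ℕ), -y.2 < (D n).A := hAl.eventually_const_lt (by linarith)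
      filter_upwards [this, hK, hAB (y.2 + K)] with n h1 h2 h3
      constructor <;> linarith
    refine fin fun i => ?_
    refine liouville_up (M := 2) (G1 := W1) (G2 := W2) hμ hμ1 (by norm_num) hcpos hell hVH Al hAl0
      (fun y y' h1 h2 => hT1 y y' (hd y h1) (hd y' h2))
      (fun y y' h1 h2 => hT2 y y' (hd y h1) (hd y' h2)) (fun y h1 => heq y (hd y h1)) ?_ _ ?_ i
    · exact limit_bd hμ 𝒰 h𝒰 (fun n => (D n).hV 0) (hVt 0) hAl.neg (fun n => (D n).hbA)
    · have := le_of_tendsto_of_tendsto hAl.neg he2 (Eventually.of_forall fun n => (D n).heA)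
      exact this
  by_cases hBb : ∃ K, ∀ᶠ n in (𝒰 : Filter ℕ), (D n).B ≤ K
  · obtain ⟨K, hK⟩ := hBb
    obtain ⟨Bl, hBl⟩ := ulim_exists 𝒰 (fun n => (D n).B) K (by
      filter_upwards [hK] with n hn
      rwa [abs_of_nonneg (D n).hB])
    have hBl0 : 0 ≤ Bl := ge_of_tendsto hBl (Eventually.of_forall fun n => (D n).hB)
    have hd : ∀ y : ℝ × ℝ, y.2 < Bl → dom y := by
      intro y hy
      have : ∀ᶠ n in (𝒰 : Filter ℕ), y.2 < (D n).B := hBl.eventually_const_lt (by linarith)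
      filter_upwards [this, hK, hAB (-y.2 + K)] with n h1 h2 h3
      constructor <;> linarith
    refine fin fun i => ?_
    refine liouville_low (M := 2) (G1 := W1) (G2 := W2) hμ hμ1 (by norm_num) hcpos hell hVH Bl hBl0
      (fun y y' h1 h2 => hT1 y y' (hd y h1) (hd y' h2))
      (fun y y' h1 h2 => hT2 y y' (hd y h1) (hd y' h2)) (fun y h1 => heq y (hd y h1)) ?_ _ ?_ i
    · exact limit_bd hμ 𝒰 h𝒰 (fun n => (D n).hV 0) (hVt 0) hBl (fun n => (D n).hbB)
    · have := le_of_tendsto_of_tendsto he2 hBl (Eventually.of_forall fun n => (D n).heB)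
      exact this
  · have hd : ∀ y : ℝ × ℝ, dom y := by
      intro y
      filter_upwards [unb _ hAb (-y.2), unb _ hBb y.2] with n h1 h2
      constructor <;> linarith
    refine fin fun i => ?_
    have := liouville_full (M := 2) (G1 := W1) (G2 := W2) hμ hμ1 (by norm_num) hcpos hell (hVH 0) (hVH 1)
      (fun y y' => hT1 y y' (hd y) (hd y')) (fun y y' => hT2 y y' (hd y) (hd y'))
      (fun y => heq y (hd y)) (e1, e2) 0
    fin_cases i
    exacts [this.1, this.2.1, this.2.2]

structure Cof (p0 μ lam Lam : ℝ) (a b c : ℝ × ℝ → ℝ) : Prop where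
  ba : ∀ z ∈ Strip p0, |a z| ≤ Lam
  bb : ∀ z ∈ Strip p0, |b z| ≤ Lam
  bc : ∀ z ∈ Strip p0, |c z| ≤ Lam
  ha : Hol (Strip p0) μ Lam a
  hb : Hol (Strip p0) μ Lam b
  hc : Hol (Strip p0) μ Lam c
  lc : ∀ z ∈ Strip p0, lam ≤ c z
  ell : ∀ z ∈ Strip p0, lam ≤ 4 * a z * c z - b z ^ 2

lemma convex_strip (p0 : ℝ) : Convex ℝ (Strip p0) := by
  have : Strip p0 = (fun z : ℝ × ℝ => z.2) ⁻¹' Icc p0 0 := by ext z; simp [Strip]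
  rw [this]
  exact (convex_Icc p0 0).is_linear_preimage (f := fun z : ℝ × ℝ => z.2)
    ⟨fun _ _ => rfl, fun _ _ => rfl⟩

def cl (p0 : ℝ) (w : ℝ × ℝ) : ℝ × ℝ := (w.1, max p0 (min w.2 0))

lemma cl_mem {p0 : ℝ} (hp0 : p0 < 0) (w : ℝ × ℝ) : cl p0 w ∈ Strip p0 :=
  ⟨le_max_left _ _, max_le hp0.le (min_le_right _ _)⟩

lemma cl_eq {p0 : ℝ} {w : ℝ × ℝ} (h : w ∈ Strip p0) : cl p0 w = w := by
  obtain ⟨h1, h2⟩ := h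
  ext <;> simp [cl, h1, h2]

lemma cl_lip (p0 : ℝ) (w w' : ℝ × ℝ) : ‖cl p0 w - cl p0 w'‖ ≤ ‖w - w'‖ := by
  rw [Prod.norm_def, Prod.norm_def]
  refine max_le_max le_rfl ?_
  simp only [cl, Prod.snd_sub, Real.norm_eq_abs]
  calc |max p0 (min w.2 0) - max p0 (min w'.2 0)| ≤ |min w.2 0 - min w'.2 0| := by
        have := abs_max_sub_max_le_max p0 (min w.2 0) p0 (min w'.2 0)
        simpa using this
    _ ≤ |w.2 - w'.2| := by
        have := abs_min_sub_min_le_max w.2 0 w'.2 0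
        simpa using this

lemma sgrp {μ r : ℝ} (hr : 0 < r) (v : ℝ × ℝ) : ‖r • v‖ ^ μ = r ^ μ * ‖v‖ ^ μ := by
  rw [norm_smul, Real.norm_of_nonneg hr.le, Real.mul_rpow hr.le (norm_nonneg _)]

lemma mk_blow {p0 μ lam Lam : ℝ} (hp0 : p0 < 0) (hμ : 0 < μ) 
    {a b c : ℝ × ℝ → ℝ} (hcof : Cof p0 μ lam Lam a b c)
    {G1 G2 : ℝ × ℝ → ℝ} {U : Fin 3 → ℝ × ℝ → ℝ}
    (hG1 : Grad (Strip p0) G1 (U 0) (U 1)) (hG2 : Grad (Strip p0) G2 (U 1) (U 2))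
    {E T n : ℝ} (hE : 0 ≤ E) (hT : 0 < T) (hn : 0 < n) (hET : n * E ≤ T)
    (hUE : ∀ i, ∀ z ∈ Strip p0, |U i z| ≤ E) (hUT : ∀ i, Hol (Strip p0) μ T (U i))
    (hF : Hol (Strip p0) μ E (fun z => a z * U 0 z + b z * U 1 z + c z * U 2 z))
    (hbot : ∀ x x', |U 0 (x, p0) - U 0 (x', p0)| ≤ E * |x - x'| ^ μ)
    (htop : ∀ x x', |U 0 (x, 0) - U 0 (x', 0)| ≤ E * |x - x'| ^ μ)
    {z z' : ℝ × ℝ} (hz : z ∈ Strip p0) (hz' : z' ∈ Strip p0) (i : Fin 3)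
    (hzz : T / 2 * ‖z - z'‖ ^ μ < |U i z - U i z'|) : Nonempty (Blow p0 μ lam Lam n) := by
  have hLam : 0 ≤ Lam := (abs_nonneg _).trans (hcof.ba z hz)
  set r := ‖z - z'‖ with hr
  have hr0 : 0 < r := by
    rw [hr, norm_pos_iff, sub_ne_zero]
    intro h0
    have : 0 ≤ T / 2 * r ^ μ := by rw [hr]; positivity
    rw [h0, sub_self, abs_zero] at hzz
    linarith
  have hrm : 0 < r ^ μ := Real.rpow_pos_of_pos hr0 _
  have hET' : E / T ≤ 1 / n := by
    rw [div_le_div_iff₀ hT hn]; linarith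
  have hrn : r ^ μ ≤ 4 / n := by
    have h1 := hUE i z hz
    have h2 := hUE i z' hz'
    have h3 := abs_sub (U i z) (U i z')
    have h4 : T / 2 * r ^ μ ≤ 2 * E := by linarith
    rw [le_div_iff₀ hn]
    have : T * (r ^ μ * n) ≤ T * 4 := by nlinarith
    exact le_of_mul_le_mul_left this hT
  have hdom : ∀ y : ℝ × ℝ, -((z.2 - p0) / r) ≤ y.2 → y.2 ≤ -z.2 / r → z + r • y ∈ Strip p0 := by
    intro y h1 h2
    rw [neg_le, le_div_iff₀ hr0] at h1
    rw [le_div_iff₀ hr0] at h2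
    constructor
    · simp; nlinarith
    · simp; nlinarith
  have hD : 0 < T * r ^ μ := by positivity
  have hscale : ∀ y y' : ℝ × ℝ, (z + r • y) - (z + r • y') = r • (y - y') := by
    intro y y'; rw [smul_sub]; abel
  refine ⟨{
    a := a z, b := b z, c := c z, A := (z.2 - p0) / r, B := -z.2 / r, e := r⁻¹ • (z' - z),
    V := fun i y => (U i (cl p0 (z + r • y)) - U i z) / (T * r ^ μ)
    W1 := fun y => (G1 (z + r • y) - G1 z - r * (U 0 z * y.1 + U 1 z * y.2)) / (T * r ^ μ * r)
    W2 := fun y => (G2 (z + r • y) - G2 z - r * (U 1 z * y.1 + U 2 z * y.2)) / (T * r ^ μ * r)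
    ha := hcof.ba z hz, hb := hcof.bb z hz, hc := hcof.bc z hz, hc' := hcof.lc z hz
    hell := hcof.ell z hz
    hA := div_nonneg (by linarith [hz.1]) hr0.le
    hB := div_nonneg (by linarith [hz.2]) hr0.le
    hAB := ?_, he := ?_, heA := ?_, heB := ?_, hVe := ?_, hV := ?_, hV0 := ?_, hT1 := ?_, hT2 := ?_,
    hW1 := by simp
    hW2 := by simp
    heq := ?_, hbA := ?_, hbB := ?_ }⟩
  · have h1 : r ≤ (4 / n) ^ (1 / μ) := by
      have := Real.rpow_le_rpow hrm.le hrn (one_div_nonneg.2 hμ.le)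
      rwa [← Real.rpow_mul hr0.le, mul_one_div_cancel hμ.ne', Real.rpow_one] at this
    have h2 : (n / 4) ^ (1 / μ) * (4 / n) ^ (1 / μ) = 1 := by
      rw [← Real.mul_rpow (by positivity) (by positivity)]
      have : n / 4 * (4 / n) = 1 := by field_simp
      rw [this, Real.one_rpow]
    have h3 : (n / 4) ^ (1 / μ) * r ≤ 1 := by
      exact (mul_le_mul_of_nonneg_left h1 (Real.rpow_nonneg (by positivity) _)).trans h2.le
    have h4 : (z.2 - p0) / r + -z.2 / r = -p0 / r := by ring
    rw [h4, le_div_iff₀ hr0]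
    nlinarith
  · rw [norm_smul, norm_sub_rev z' z, ← hr, norm_inv, Real.norm_of_nonneg hr0.le]
    exact inv_mul_cancel₀ hr0.ne'
  · simp only [Prod.smul_snd, Prod.snd_sub, smul_eq_mul]
    rw [neg_le, inv_mul_eq_div, ← neg_div]
    gcongr; linarith [hz'.1]
  · simp only [Prod.smul_snd, Prod.snd_sub, smul_eq_mul]
    rw [inv_mul_eq_div]
    gcongr; linarith [hz'.2]
  · have h1 : z + r • (r⁻¹ • (z' - z)) = z' := by
      rw [smul_smul, mul_inv_cancel₀ hr0.ne', one_smul]; abel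
    simp only [h1, cl_eq hz']
    have h2 : 1 / 2 ≤ |(U i z' - U i z) / (T * r ^ μ)| := by
      rw [abs_div, abs_of_pos hD, le_div_iff₀ hD, abs_sub_comm]
      linarith
    fin_cases i
    · have h2' : 1 / 2 ≤ |(U 0 z' - U 0 z) / (T * r ^ μ)| := h2
      linarith [abs_nonneg ((U 1 z' - U 1 z) / (T * r ^ μ)), abs_nonneg ((U 2 z' - U 2 z) / (T * r ^ μ))]
    · have h2' : 1 / 2 ≤ |(U 1 z' - U 1 z) / (T * r ^ μ)| := h2
      linarith [abs_nonneg ((U 0 z' - U 0 z) / (T * r ^ μ)), abs_nonneg ((U 2 z' - U 2 z) / (T * r ^ μ))]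
    · have h2' : 1 / 2 ≤ |(U 2 z' - U 2 z) / (T * r ^ μ)| := h2
      linarith [abs_nonneg ((U 1 z' - U 1 z) / (T * r ^ μ)), abs_nonneg ((U 0 z' - U 0 z) / (T * r ^ μ))]
  · intro i y y'
    have h1 := hUT i _ (cl_mem hp0 (z + r • y)) _ (cl_mem hp0 (z + r • y'))
    have h2 : ‖cl p0 (z + r • y) - cl p0 (z + r • y')‖ ^ μ ≤ r ^ μ * ‖y - y'‖ ^ μ := by
      rw [← sgrp hr0, ← hscale]
      exact Real.rpow_le_rpow (norm_nonneg _) (cl_lip _ _ _) hμ.le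
    have h3 : (U i (cl p0 (z + r • y)) - U i z) / (T * r ^ μ)
        - (U i (cl p0 (z + r • y')) - U i z) / (T * r ^ μ)
        = (U i (cl p0 (z + r • y)) - U i (cl p0 (z + r • y'))) / (T * r ^ μ) := by ring
    rw [h3, abs_div, abs_of_pos hD, div_le_iff₀ hD]
    refine h1.trans ?_
    nlinarith [mul_le_mul_of_nonneg_left h2 hT.le]
  · intro i
    simp [cl_eq hz]
  · intro y y' h1 h2 h1' h2'
    have hy := hdom y h1 h2
    have hy' := hdom y' h1' h2'
    have h3 := taylor1 (convex_strip p0) hμ hT.le hG1 (hUT 0) (hUT 1) hy hy'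
    rw [hscale, sgrp hr0, norm_smul, Real.norm_of_nonneg hr0.le] at h3
    simp only [Prod.fst_add, Prod.snd_add, Prod.smul_fst, Prod.smul_snd, smul_eq_mul] at h3
    simp only [cl_eq hy]
    have h4 : (G1 (z + r • y') - G1 z - r * (U 0 z * y'.1 + U 1 z * y'.2)) / (T * r ^ μ * r) -
        (G1 (z + r • y) - G1 z - r * (U 0 z * y.1 + U 1 z * y.2)) / (T * r ^ μ * r) -
        ((U 0 (z + r • y) - U 0 z) / (T * r ^ μ) * (y'.1 - y.1) +
          (U 1 (z + r • y) - U 1 z) / (T * r ^ μ) * (y'.2 - y.2)) =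
        (G1 (z + r • y') - G1 (z + r • y) - (U 0 (z + r • y) * (z.1 + r * y'.1 - (z.1 + r * y.1))
          + U 1 (z + r • y) * (z.2 + r * y'.2 - (z.2 + r * y.2)))) / (T * r ^ μ * r) := by
      field_simp; ring
    rw [h4, abs_div, abs_of_pos (by positivity : 0 < T * r ^ μ * r), div_le_iff₀ (by positivity)]
    refine h3.trans (le_of_eq (by ring))
  · intro y y' h1 h2 h1' h2'
    have hy := hdom y h1 h2
    have hy' := hdom y' h1' h2'
    have h3 := taylor1 (convex_strip p0) hμ hT.le hG2 (hUT 1) (hUT 2) hy hy'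
    rw [hscale, sgrp hr0, norm_smul, Real.norm_of_nonneg hr0.le] at h3
    simp only [Prod.fst_add, Prod.snd_add, Prod.smul_fst, Prod.smul_snd, smul_eq_mul] at h3
    simp only [cl_eq hy]
    have h4 : (G2 (z + r • y') - G2 z - r * (U 1 z * y'.1 + U 2 z * y'.2)) / (T * r ^ μ * r) -
        (G2 (z + r • y) - G2 z - r * (U 1 z * y.1 + U 2 z * y.2)) / (T * r ^ μ * r) -
        ((U 1 (z + r • y) - U 1 z) / (T * r ^ μ) * (y'.1 - y.1) +
          (U 2 (z + r • y) - U 2 z) / (T * r ^ μ) * (y'.2 - y.2)) =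
        (G2 (z + r • y') - G2 (z + r • y) - (U 1 (z + r • y) * (z.1 + r * y'.1 - (z.1 + r * y.1))
          + U 2 (z + r • y) * (z.2 + r * y'.2 - (z.2 + r * y.2)))) / (T * r ^ μ * r) := by
      field_simp; ring
    rw [h4, abs_div, abs_of_pos (by positivity : 0 < T * r ^ μ * r), div_le_iff₀ (by positivity)]
    refine h3.trans (le_of_eq (by ring))
  · intro y h1 h2
    have hy := hdom y h1 h2
    simp only [cl_eq hy]
    set w := z + r • y with hw
    have hwz : ‖w - z‖ ^ μ = r ^ μ * ‖y‖ ^ μ := by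
      rw [hw, add_sub_cancel_left, sgrp hr0]
    have e0 := hF w hy z hz
    have e1 := hcof.ha w hy z hz
    have e2 := hcof.hb w hy z hz
    have e3 := hcof.hc w hy z hz
    rw [hwz] at e0 e1 e2 e3
    set X := r ^ μ * ‖y‖ ^ μ with hX
    have hX0 : 0 ≤ X := by positivity
    have k1 : |(a w - a z) * U 0 w| ≤ Lam * X * E := by
      rw [abs_mul]; exact mul_le_mul e1 (hUE 0 w hy) (abs_nonneg _) (by positivity)
    have k2 : |(b w - b z) * U 1 w| ≤ Lam * X * E := by
      rw [abs_mul]; exact mul_le_mul e2 (hUE 1 w hy) (abs_nonneg _) (by positivity)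
    have k3 : |(c w - c z) * U 2 w| ≤ Lam * X * E := by
      rw [abs_mul]; exact mul_le_mul e3 (hUE 2 w hy) (abs_nonneg _) (by positivity)
    have k4 : a z * ((U 0 w - U 0 z) / (T * r ^ μ)) + b z * ((U 1 w - U 1 z) / (T * r ^ μ))
        + c z * ((U 2 w - U 2 z) / (T * r ^ μ)) =
        (((a w * U 0 w + b w * U 1 w + c w * U 2 w) - (a z * U 0 z + b z * U 1 z + c z * U 2 z))
          - (a w - a z) * U 0 w - (b w - b z) * U 1 w - (c w - c z) * U 2 w) / (T * r ^ μ) := by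
      ring
    rw [k4, abs_div, abs_of_pos hD, div_le_iff₀ hD]
    have k5 : |((a w * U 0 w + b w * U 1 w + c w * U 2 w) - (a z * U 0 z + b z * U 1 z + c z * U 2 z))
          - (a w - a z) * U 0 w - (b w - b z) * U 1 w - (c w - c z) * U 2 w|
          ≤ (1 + 3 * Lam) * X * E := by
      refine (abs_sub _ _).trans ?_
      have := abs_sub ((a w * U 0 w + b w * U 1 w + c w * U 2 w) - (a z * U 0 z + b z * U 1 z + c z * U 2 z)
          - (a w - a z) * U 0 w) ((b w - b z) * U 1 w)
      have := abs_sub ((a w * U 0 w + b w * U 1 w + c w * U 2 w) - (a z * U 0 z + b z * U 1 z + c z * U 2 z))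
          ((a w - a z) * U 0 w)
      simp only at e0
      linarith
    refine k5.trans ?_
    have k6 : E ≤ T / n := by rw [le_div_iff₀ hn]; linarith
    calc (1 + 3 * Lam) * X * E ≤ (1 + 15 * Lam) * X * (T / n) := by gcongr <;> linarith
      _ = (1 + 15 * Lam) / n * (‖y‖ ^ μ + 0) * (T * r ^ μ) := by rw [hX]; field_simp; ring
      _ ≤ _ := by gcongr; positivity
  · intro x x'
    have key : ∀ x, cl p0 (z + r • (x, -((z.2 - p0) / r))) = (z.1 + r * x, p0) := by
      intro x
      have : z + r • (x, -((z.2 - p0) / r)) = (z.1 + r * x, p0) := by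
        ext <;> simp; field_simp; ring
      rw [this]; exact cl_eq ⟨le_rfl, hp0.le⟩
    simp only [key]
    have h1 := hbot (z.1 + r * x) (z.1 + r * x')
    have h2 : |z.1 + r * x - (z.1 + r * x')| ^ μ = r ^ μ * |x - x'| ^ μ := by
      rw [show z.1 + r * x - (z.1 + r * x') = r * (x - x') by ring, abs_mul, abs_of_pos hr0,
        Real.mul_rpow hr0.le (abs_nonneg _)]
    rw [h2] at h1
    rw [div_sub_div_same, sub_sub_sub_cancel_right, abs_div, abs_of_pos hD, div_le_iff₀ hD]
    refine h1.trans ?_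
    have k6 : E ≤ T / n := by rw [le_div_iff₀ hn]; linarith
    calc E * (r ^ μ * |x - x'| ^ μ) ≤ (T / n) * (r ^ μ * |x - x'| ^ μ) := by gcongr
      _ = _ := by ring
  · intro x x'
    have key : ∀ x, cl p0 (z + r • (x, -z.2 / r)) = (z.1 + r * x, 0) := by
      intro x
      have : z + r • (x, -z.2 / r) = (z.1 + r * x, 0) := by
        ext <;> simp; field_simp; ring
      rw [this]; exact cl_eq ⟨hp0.le, le_rfl⟩
    simp only [key]
    have h1 := htop (z.1 + r * x) (z.1 + r * x')
    have h2 : |z.1 + r * x - (z.1 + r * x')| ^ μ = r ^ μ * |x - x'| ^ μ := by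
      rw [show z.1 + r * x - (z.1 + r * x') = r * (x - x') by ring, abs_mul, abs_of_pos hr0,
        Real.mul_rpow hr0.le (abs_nonneg _)]
    rw [h2] at h1
    rw [div_sub_div_same, sub_sub_sub_cancel_right, abs_div, abs_of_pos hD, div_le_iff₀ hD]
    refine h1.trans ?_
    have k6 : E ≤ T / n := by rw [le_div_iff₀ hn]; linarith
    calc E * (r ^ μ * |x - x'| ^ μ) ≤ (T / n) * (r ^ μ * |x - x'| ^ μ) := by gcongr
      _ = _ := by ring

lemma Hol.mono {S : Set (ℝ × ℝ)} {μ M M' : ℝ} {f : ℝ × ℝ → ℝ} (h : Hol S μ M f) (hM : M ≤ M') :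
    Hol S μ M' f := fun z hz z' hz' => (h z hz z' hz').trans (by gcongr)

lemma min_hol {S : Set (ℝ × ℝ)} {μ : ℝ} {U : Fin 3 → ℝ × ℝ → ℝ} (h : ∃ M, ∀ i, Hol S μ M (U i)) :
    ∃ T, 0 ≤ T ∧ (∀ i, Hol S μ T (U i)) ∧ ∀ M, 0 ≤ M → (∀ i, Hol S μ M (U i)) → T ≤ M := by
  let X : Set ℝ := {M | 0 ≤ M ∧ ∀ i, Hol S μ M (U i)}
  have hne : X.Nonempty := by
    obtain ⟨M, hM⟩ := h
    exact ⟨max M 0, le_max_right _ _, fun i => (hM i).mono (le_max_left _ _)⟩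
  have hbd : BddBelow X := ⟨0, fun x hx => hx.1⟩
  refine ⟨sInf X, le_csInf hne fun x hx => hx.1, fun i z hz z' hz' => ?_,
    fun M h0 hM => csInf_le hbd ⟨h0, hM⟩⟩
  obtain ⟨u, -, hu, huX⟩ := exists_seq_tendsto_sInf hne hbd
  exact ge_of_tendsto' (hu.mul_const _) fun n => (huX n).2 i z hz z' hz'

theorem schauder1 {p0 μ lam Lam : ℝ} (hp0 : p0 < 0) (hμ : 0 < μ) (hμ1 : μ < 1) (hlam : 0 < lam) :
    ∃ C : ℝ, 1 ≤ C ∧ ∀ a b c : ℝ × ℝ → ℝ, Cof p0 μ lam Lam a b c →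
    ∀ (G1 G2 : ℝ × ℝ → ℝ) (U : Fin 3 → ℝ × ℝ → ℝ),
    Grad (Strip p0) G1 (U 0) (U 1) → Grad (Strip p0) G2 (U 1) (U 2) →
    ∀ E, 0 ≤ E → (∀ i, ∀ z ∈ Strip p0, |U i z| ≤ E) →
    Hol (Strip p0) μ E (fun z => a z * U 0 z + b z * U 1 z + c z * U 2 z) →
    (∀ x x', |U 0 (x, p0) - U 0 (x', p0)| ≤ E * |x - x'| ^ μ) →
    (∀ x x', |U 0 (x, 0) - U 0 (x', 0)| ≤ E * |x - x'| ^ μ) →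
    (∃ M, ∀ i, Hol (Strip p0) μ M (U i)) → ∀ i, Hol (Strip p0) μ (C * E) (U i) := by
  by_contra hcon
  push Not at hcon
  have key : ∀ n : ℕ, Nonempty (Blow p0 μ lam Lam ((n : ℝ) + 1)) := by
    intro n
    obtain ⟨a, b, c, hcof, G1, G2, U, hG1, hG2, E, hE, hUE, hF, hbot, htop, hM, i, hi⟩ :=
      hcon ((n : ℝ) + 1) (by linarith [Nat.cast_nonneg (α := ℝ) n])
    obtain ⟨T, hT0, hTH, hTmin⟩ := min_hol hM
    have hTE : ((n : ℝ) + 1) * E < T := by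
      by_contra hle
      exact hi ((hTH i).mono (not_lt.1 hle))
    have hTpos : 0 < T := lt_of_le_of_lt (by positivity) hTE
    have : ¬ ∀ i, Hol (Strip p0) μ (T / 2) (U i) := fun h => by
      have := hTmin _ (by positivity) h
      linarith
    unfold Hol at this
    push Not at this
    obtain ⟨j, z, hz, z', hz', hlt⟩ := this
    exact mk_blow hp0 hμ hcof hG1 hG2 hE hTpos (by positivity) hTE.le hUE hTH hF hbot htop hz hz' j hlt
  exact no_blow hp0 hμ hμ1 hlam fun n => (key n).some

lemma interp_aux {x y u v ε E T X : ℝ} (hε : 0 < ε) (hx : |x| ≤ E) (hy : |y| ≤ E)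
    (hu : |x - y - u| ≤ 2 * T * X * ε) (hue : |u| = ε * |v|) : |v| ≤ 2 * E / ε + 2 * T * X := by
  have h1 : |u| ≤ 2 * E + 2 * T * X * ε := by
    have : u = x - y - (x - y - u) := by ring
    rw [this]
    refine (abs_sub _ _).trans ?_
    have := abs_sub x y
    linarith
  rw [hue] at h1
  have : |v| ≤ (2 * E + 2 * T * X * ε) / ε := by
    rw [le_div_iff₀ hε]; linarith
  refine this.trans (le_of_eq (by field_simp))

lemma interp {p0 μ : ℝ} (hμ : 0 < μ) {G1 G2 : ℝ × ℝ → ℝ} {U : Fin 3 → ℝ × ℝ → ℝ}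
    (hG1 : Grad (Strip p0) G1 (U 0) (U 1)) (hG2 : Grad (Strip p0) G2 (U 1) (U 2))
    {E T ε : ℝ} (hT : 0 ≤ T) (hε : 0 < ε) (hεp : ε ≤ -p0 / 2)
    (hUT : ∀ i, Hol (Strip p0) μ T (U i))
    (h1 : ∀ z ∈ Strip p0, |G1 z| ≤ E) (h2 : ∀ z ∈ Strip p0, |G2 z| ≤ E) :
    ∀ i, ∀ z ∈ Strip p0, |U i z| ≤ 2 * E / ε + 2 * T * ε ^ μ := by
  have hc := convex_strip p0
  have nq : ∀ z : ℝ × ℝ, ‖(z.1 + ε, z.2) - z‖ = ε := by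
    intro z; simp [Prod.norm_def, abs_of_pos hε, hε.le]
  intro i z hz
  have hzq : (z.1 + ε, z.2) ∈ Strip p0 := hz
  fin_cases i
  · have := taylor1 hc hμ hT hG1 (hUT 0) (hUT 1) hz hzq
    rw [nq] at this
    refine interp_aux hε (h1 _ hzq) (h1 _ hz) this ?_
    simp [abs_mul, abs_of_pos hε, mul_comm]
  · have := taylor1 hc hμ hT hG2 (hUT 1) (hUT 2) hz hzq
    rw [nq] at this
    refine interp_aux hε (h2 _ hzq) (h2 _ hz) this ?_
    simp [abs_mul, abs_of_pos hε, mul_comm]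
  · by_cases hup : z.2 + ε ≤ 0
    · have hzp : (z.1, z.2 + ε) ∈ Strip p0 := ⟨by have := hz.1; simp; linarith, hup⟩
      have := taylor1 hc hμ hT hG2 (hUT 1) (hUT 2) hz hzp
      have np : ‖(z.1, z.2 + ε) - z‖ = ε := by simp [Prod.norm_def, abs_of_pos hε, hε.le]
      rw [np] at this
      refine interp_aux hε (h2 _ hzp) (h2 _ hz) this ?_
      simp [abs_mul, abs_of_pos hε, mul_comm]
    · have hzp : (z.1, z.2 - ε) ∈ Strip p0 := ⟨by simp; linarith, by have := hz.2; simp; linarith⟩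
      have := taylor1 hc hμ hT hG2 (hUT 1) (hUT 2) hz hzp
      have np : ‖(z.1, z.2 - ε) - z‖ = ε := by simp [Prod.norm_def, abs_of_pos hε, hε.le]
      rw [np] at this
      refine interp_aux hε (h2 _ hzp) (h2 _ hz) this ?_
      simp [abs_mul, abs_of_pos hε, mul_comm]

theorem schauder2 {p0 μ lam Lam : ℝ} (hp0 : p0 < 0) (hμ : 0 < μ) (hμ1 : μ < 1) (hlam : 0 < lam) :
    ∃ C : ℝ, 1 ≤ C ∧ ∀ a b c : ℝ × ℝ → ℝ, Cof p0 μ lam Lam a b c →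
    ∀ (G1 G2 : ℝ × ℝ → ℝ) (U : Fin 3 → ℝ × ℝ → ℝ),
    Grad (Strip p0) G1 (U 0) (U 1) → Grad (Strip p0) G2 (U 1) (U 2) →
    ∀ E, 0 ≤ E → (∀ z ∈ Strip p0, |G1 z| ≤ E) → (∀ z ∈ Strip p0, |G2 z| ≤ E) →
    Hol (Strip p0) μ E (fun z => a z * U 0 z + b z * U 1 z + c z * U 2 z) →
    (∀ x x', |U 0 (x, p0) - U 0 (x', p0)| ≤ E * |x - x'| ^ μ) →
    (∀ x x', |U 0 (x, 0) - U 0 (x', 0)| ≤ E * |x - x'| ^ μ) →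
    (∃ M, ∀ i, Hol (Strip p0) μ M (U i)) →
    ∀ i, (∀ z ∈ Strip p0, |U i z| ≤ C * E) ∧ Hol (Strip p0) μ (C * E) (U i) := by
  obtain ⟨C, hC, H⟩ := schauder1 (Lam := Lam) hp0 hμ hμ1 hlam
  have hC0 : 0 < C := by linarith
  obtain ⟨ε, hε, hεp, hεC⟩ : ∃ ε : ℝ, 0 < ε ∧ ε ≤ -p0 / 2 ∧ 2 * C * ε ^ μ ≤ 1 / 2 := by
    have h0 : 0 < (1 / (4 * C)) ^ (1 / μ) := Real.rpow_pos_of_pos (by positivity) _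
    refine ⟨min (-p0 / 2) ((1 / (4 * C)) ^ (1 / μ)), lt_min (by linarith) h0, min_le_left _ _, ?_⟩
    have h1 : (min (-p0 / 2) ((1 / (4 * C)) ^ (1 / μ))) ^ μ ≤ ((1 / (4 * C)) ^ (1 / μ)) ^ μ :=
      Real.rpow_le_rpow (le_min (by linarith) h0.le) (min_le_right _ _) hμ.le
    rw [← Real.rpow_mul (by positivity), one_div_mul_cancel hμ.ne', Real.rpow_one] at h1
    calc _ ≤ 2 * C * (1 / (4 * C)) := by gcongr
      _ = 1 / 2 := by field_simp; norm_num
  refine ⟨2 * C * (1 + 2 / ε), ?_, ?_⟩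
  · have : 0 < 2 / ε := by positivity
    nlinarith
  intro a b c hcof G1 G2 U hG1 hG2 E hE h1 h2 hF hbot htop hM
  obtain ⟨T, hT0, hTH, hTmin⟩ := min_hol hM
  have hI := interp hμ hG1 hG2 hT0 hε hεp hTH h1 h2
  have hεm : 0 < ε ^ μ := Real.rpow_pos_of_pos hε _
  have h2e : 0 < 2 / ε := by positivity
  set E' := E + 2 * E / ε + 2 * T * ε ^ μ with hE'
  have hp1 : 0 ≤ 2 * E / ε := by positivity
  have hp2 : 0 ≤ 2 * T * ε ^ μ := by positivity
  have hEE : E ≤ E' := by linarith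
  have hH := H a b c hcof G1 G2 U hG1 hG2 E' (by linarith)
    (fun i z hz => (hI i z hz).trans (by linarith)) (hF.mono hEE)
    (fun x x' => (hbot x x').trans (by gcongr)) (fun x x' => (htop x x').trans (by gcongr)) hM
  have hTle := hTmin _ (by nlinarith) hH
  have e1 : 2 * E / ε = 2 / ε * E := by ring
  have hTE : T ≤ 2 * C * (1 + 2 / ε) * E := by
    have h3 : C * (2 * T * ε ^ μ) ≤ T / 2 := by nlinarith
    rw [hE', e1] at hTle
    nlinarith
  refine fun i => ⟨fun z hz => (hI i z hz).trans ?_, (hTH i).mono hTE⟩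
  have h4 : 2 * T * ε ^ μ ≤ (1 + 2 / ε) * E := by
    have h5 : 2 * T * ε ^ μ ≤ (2 * C * ε ^ μ) * (2 * (1 + 2 / ε) * E) := by
      have := mul_le_mul_of_nonneg_left hTE (by positivity : 0 ≤ 2 * ε ^ μ)
      nlinarith
    have h6 : (2 * C * ε ^ μ) * (2 * (1 + 2 / ε) * E) ≤ 1 / 2 * (2 * (1 + 2 / ε) * E) := by gcongr
    linarith
  rw [e1]
  have h7 : 2 * (1 + 2 / ε) * E ≤ 2 * C * (1 + 2 / ε) * E := by gcongr; linarith
  nlinarith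

def Bd (p0 μ M : ℝ) (f : ℝ × ℝ → ℝ) : Prop := (∀ z ∈ Strip p0, |f z| ≤ M) ∧ Hol (Strip p0) μ M f

def RowD (p0 : ℝ) (f f' : ℝ × ℝ → ℝ) : Prop :=
  ∀ z ∈ Strip p0, HasDerivAt (fun q => f (q, z.2)) (f' z) z.1

def dquo (t : ℝ) (f : ℝ × ℝ → ℝ) : ℝ × ℝ → ℝ := fun z => (f (z.1 + t, z.2) - f z) / t

section
variable {p0 μ : ℝ}

lemma Bd.mono {M N : ℝ} {f : ℝ × ℝ → ℝ} (h : Bd p0 μ M f) (hMN : M ≤ N) : Bd p0 μ N f :=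
  ⟨fun z hz => (h.1 z hz).trans hMN, h.2.mono hMN⟩

lemma Bd.nonneg (hp0 : p0 < 0) {M : ℝ} {f : ℝ × ℝ → ℝ} (h : Bd p0 μ M f) : 0 ≤ M :=
  (abs_nonneg _).trans (h.1 (0, 0) ⟨hp0.le, le_rfl⟩)

lemma Bd.congr {M : ℝ} {f g : ℝ × ℝ → ℝ} (h : Bd p0 μ M f) (hfg : ∀ z ∈ Strip p0, f z = g z) :
    Bd p0 μ M g :=
  ⟨fun z hz => by rw [← hfg z hz]; exact h.1 z hz,
   fun z hz z' hz' => by rw [← hfg z hz, ← hfg z' hz']; exact h.2 z hz z' hz'⟩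

lemma Bd.add {M N : ℝ} {f g : ℝ × ℝ → ℝ} (hf : Bd p0 μ M f) (hg : Bd p0 μ N g) :
    Bd p0 μ (M + N) (fun z => f z + g z) := by
  refine ⟨fun z hz => (abs_add_le _ _).trans (add_le_add (hf.1 z hz) (hg.1 z hz)),
    fun z hz z' hz' => ?_⟩
  rw [add_sub_add_comm, add_mul]
  exact (abs_add_le _ _).trans (add_le_add (hf.2 z hz z' hz') (hg.2 z hz z' hz'))

lemma Bd.mul {M N : ℝ} {f g : ℝ × ℝ → ℝ} (hf : Bd p0 μ M f) (hg : Bd p0 μ N g) :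
    Bd p0 μ (2 * (M * N)) (fun z => f z * g z) := by
  have key : ∀ z ∈ Strip p0, 0 ≤ M ∧ 0 ≤ N := fun z hz =>
    ⟨(abs_nonneg _).trans (hf.1 z hz), (abs_nonneg _).trans (hg.1 z hz)⟩
  refine ⟨fun z hz => ?_, fun z hz z' hz' => ?_⟩
  · obtain ⟨hM, hN⟩ := key z hz
    rw [abs_mul]
    have := mul_le_mul (hf.1 z hz) (hg.1 z hz) (abs_nonneg _) hM
    nlinarith [mul_nonneg hM hN]
  · obtain ⟨hM, hN⟩ := key z hz
    have e : f z * g z - f z' * g z' = f z * (g z - g z') + (f z - f z') * g z' := by ring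
    rw [e]
    refine (abs_add_le _ _).trans ?_
    rw [abs_mul, abs_mul]
    have h1 := mul_le_mul (hf.1 z hz) (hg.2 z hz z' hz') (abs_nonneg _) hM
    have h2 := mul_le_mul (hf.2 z hz z' hz') (hg.1 z' hz') (abs_nonneg _)
      (mul_nonneg hM (Real.rpow_nonneg (norm_nonneg _) _))
    nlinarith

lemma Bd.const (c : ℝ) : Bd p0 μ |c| (fun _ => c) :=
  ⟨fun _ _ => le_rfl, fun z _ z' _ => by
    simp only [sub_self, abs_zero]; positivity⟩

lemma Bd.smul {M c : ℝ} {f : ℝ × ℝ → ℝ} (hf : Bd p0 μ M f) :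
    Bd p0 μ (|c| * M) (fun z => c * f z) := by
  refine ⟨fun z hz => ?_, fun z hz z' hz' => ?_⟩
  · rw [abs_mul]; exact mul_le_mul_of_nonneg_left (hf.1 z hz) (abs_nonneg _)
  · rw [← mul_sub, abs_mul, mul_assoc]
    exact mul_le_mul_of_nonneg_left (hf.2 z hz z' hz') (abs_nonneg _)

lemma Bd.inv {M l : ℝ} {f : ℝ × ℝ → ℝ} (hl : 0 < l) (hf : Bd p0 μ M f) (h : ∀ z ∈ Strip p0, l ≤ f z) :
    ∃ N, Bd p0 μ N (fun z => (f z)⁻¹) := by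
  refine ⟨max (1 / l) (M / (l * l)), fun z hz => ?_, fun z hz z' hz' => ?_⟩
  · have h0 : 0 < f z := hl.trans_le (h z hz)
    rw [abs_of_pos (inv_pos.2 h0)]
    refine le_trans ?_ (le_max_left _ _)
    rw [← one_div]; exact one_div_le_one_div_of_le hl (h z hz)
  · have h0 : 0 < f z := hl.trans_le (h z hz)
    have h0' : 0 < f z' := hl.trans_le (h z' hz')
    rw [inv_sub_inv h0.ne' h0'.ne', abs_div, abs_of_pos (mul_pos h0 h0'), abs_sub_comm]
    have hX : 0 ≤ M * ‖z - z'‖ ^ μ := (abs_nonneg _).trans (hf.2 z hz z' hz')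
    calc |f z - f z'| / (f z * f z') ≤ (M * ‖z - z'‖ ^ μ) / (l * l) := by
          gcongr
          · exact hf.2 z hz z' hz'
          · exact h z hz
          · exact h z' hz'
      _ = M / (l * l) * ‖z - z'‖ ^ μ := by ring
      _ ≤ _ := by gcongr; exact le_max_right _ _

lemma Bd.sqrt {M : ℝ} {f : ℝ × ℝ → ℝ} (hf : Bd p0 μ M f) (h : ∀ z ∈ Strip p0, 1 ≤ f z) :
    Bd p0 μ M (fun z => Real.sqrt (f z)) := by
  have key : ∀ z ∈ Strip p0, 1 ≤ Real.sqrt (f z) := fun z hz => Real.one_le_sqrt.2 (h z hz)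
  have sq : ∀ z ∈ Strip p0, Real.sqrt (f z) * Real.sqrt (f z) = f z := fun z hz =>
    Real.mul_self_sqrt (by linarith [h z hz])
  refine ⟨fun z hz => ?_, fun z hz z' hz' => ?_⟩
  · have := hf.1 z hz
    rw [abs_of_nonneg (by linarith [key z hz])]
    have h1 := le_abs_self (f z)
    nlinarith [key z hz, sq z hz]
  · refine le_trans ?_ (hf.2 z hz z' hz')
    have e : f z - f z' = (Real.sqrt (f z) + Real.sqrt (f z')) * (Real.sqrt (f z) - Real.sqrt (f z')) := by
      rw [← sq z hz, ← sq z' hz']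
      simp only [Real.sqrt_mul_self (Real.sqrt_nonneg _)]
      ring
    rw [e, abs_mul, abs_of_nonneg (a := Real.sqrt (f z) + Real.sqrt (f z')) (by positivity)]
    nlinarith [key z hz, key z' hz', abs_nonneg (Real.sqrt (f z) - Real.sqrt (f z'))]

lemma Bd.of_lip (hμ : 0 < μ) (hμ1 : μ < 1) {M : ℝ} {f : ℝ × ℝ → ℝ} (hb : ∀ z ∈ Strip p0, |f z| ≤ M)
    (hl : ∀ z ∈ Strip p0, ∀ z' ∈ Strip p0, |f z - f z'| ≤ 2 * M * ‖z - z'‖) : Bd p0 μ (2 * M) f := by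
  refine ⟨fun z hz => ?_, fun z hz z' hz' => ?_⟩
  · have := hb z hz; have := abs_nonneg (f z); linarith
  have hM : 0 ≤ M := (abs_nonneg _).trans (hb z hz)
  rcases le_total ‖z - z'‖ 1 with h | h
  · refine (hl z hz z' hz').trans ?_
    gcongr
    rcases (norm_nonneg (z - z')).eq_or_lt with h0 | h0
    · rw [← h0, Real.zero_rpow hμ.ne']
    · calc ‖z - z'‖ = ‖z - z'‖ ^ (1 : ℝ) := (Real.rpow_one _).symm
        _ ≤ _ := Real.rpow_le_rpow_of_exponent_ge h0 h hμ1.le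
  · have h1 : 1 ≤ ‖z - z'‖ ^ μ := Real.one_le_rpow h hμ.le
    have := abs_sub (f z) (f z')
    have := hb z hz
    have := hb z' hz'
    nlinarith

lemma Bd.of_grad (hμ : 0 < μ) (hμ1 : μ < 1) {M : ℝ} {f f1 f2 : ℝ × ℝ → ℝ} (hb : ∀ z ∈ Strip p0, |f z| ≤ M)
    (h1 : ∀ z ∈ Strip p0, |f1 z| ≤ M) (h2 : ∀ z ∈ Strip p0, |f2 z| ≤ M) (hg : Grad (Strip p0) f f1 f2) :
    Bd p0 μ (2 * M) f := by
  refine Bd.of_lip hμ hμ1 hb fun z hz z' hz' => ?_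
  have := (convex_strip p0).norm_image_sub_le_of_norm_hasFDerivWithin_le (C := 2 * M) hg
    (fun x hx => (L2_norm_le _ _).trans (by linarith [h1 x hx, h2 x hx])) hz' hz
  simpa using this

lemma Bd.cont (hμ : 0 < μ) {M : ℝ} {f : ℝ × ℝ → ℝ} (hf : Bd p0 μ M f) : ContinuousOn f (Strip p0) := by
  intro x hx
  rw [ContinuousWithinAt, tendsto_iff_norm_sub_tendsto_zero]
  have h1 : Tendsto (fun z : ℝ × ℝ => M * ‖z - x‖ ^ μ) (𝓝[Strip p0] x) (𝓝 0) := by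
    have : Continuous fun z : ℝ × ℝ => M * ‖z - x‖ ^ μ := by
      refine continuous_const.mul (Continuous.rpow_const (by fun_prop) fun _ => Or.inr hμ.le)
    have h := this.tendsto x
    simp [Real.zero_rpow hμ.ne'] at h
    exact h.mono_left nhdsWithin_le_nhds
  refine squeeze_zero' (Eventually.of_forall fun _ => norm_nonneg _) ?_ h1
  filter_upwards [self_mem_nhdsWithin] with z hz
  exact hf.2 z hz x hx

lemma Grad.rowD {f f1 f2 : ℝ × ℝ → ℝ} (hg : Grad (Strip p0) f f1 f2) : RowD p0 f f1 := by
  intro z hz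
  have h1 : HasDerivAt (fun q : ℝ => ((q, z.2) : ℝ × ℝ)) (1, 0) z.1 :=
    (hasDerivAt_id z.1).prodMk (hasDerivAt_const z.1 z.2)
  have h2 := (hg z hz).comp_hasDerivAt (f := fun q : ℝ => ((q, z.2) : ℝ × ℝ)) z.1 h1
    (Eventually.of_forall fun q => hz)
  simp only [L2_apply, mul_one, mul_zero, add_zero] at h2
  exact h2

lemma shift_mem {z : ℝ × ℝ} (hz : z ∈ Strip p0) (t : ℝ) : (z.1 + t, z.2) ∈ Strip p0 := hz

lemma dquo_bd {M t : ℝ} (ht : t ≠ 0) {f f' : ℝ × ℝ → ℝ} (hf : RowD p0 f f') (hb : Bd p0 μ M f') :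
    Bd p0 μ M (dquo t f) := by
  have hd : ∀ z ∈ Strip p0, ∀ q, HasDerivAt (fun q => f (z.1 + q, z.2)) (f' (z.1 + q, z.2)) q := by
    intro z hz q
    have := hf (z.1 + q, z.2) hz
    exact this.comp_const_add z.1 q
  refine ⟨fun z hz => ?_, fun z hz z' hz' => ?_⟩
  · have := convex_univ.norm_image_sub_le_of_norm_hasDerivWithin_le (C := M)
      (f := fun q => f (z.1 + q, z.2)) (fun q _ => (hd z hz q).hasDerivWithinAt)
      (fun q _ => hb.1 _ (shift_mem hz q)) (mem_univ 0) (mem_univ t)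
    simp only [add_zero, sub_zero, Prod.mk.eta, Real.norm_eq_abs] at this
    rw [dquo, abs_div, div_le_iff₀ (abs_pos.2 ht)]
    exact this
  · have := convex_univ.norm_image_sub_le_of_norm_hasDerivWithin_le (C := M * ‖z - z'‖ ^ μ)
      (f := fun q => f (z.1 + q, z.2) - f (z'.1 + q, z'.2))
      (fun q _ => ((hd z hz q).sub (hd z' hz' q)).hasDerivWithinAt)
      (fun q _ => ?_) (mem_univ 0) (mem_univ t)
    · simp only [add_zero, sub_zero, Prod.mk.eta, Real.norm_eq_abs] at this
      have e : dquo t f z - dquo t f z' =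
        (f (z.1 + t, z.2) - f (z'.1 + t, z'.2) - (f z - f z')) / t := by
        simp only [dquo]; ring
      rw [e, abs_div, div_le_iff₀ (abs_pos.2 ht)]
      exact this
    · have := hb.2 _ (shift_mem hz q) _ (shift_mem hz' q)
      have e : ((z.1 + q, z.2) : ℝ × ℝ) - (z'.1 + q, z'.2) = z - z' := by ext <;> simp
      rw [e] at this
      exact this

lemma dquo_grad {t : ℝ} {f f1 f2 : ℝ × ℝ → ℝ} (hg : Grad (Strip p0) f f1 f2) :
    Grad (Strip p0) (dquo t f) (dquo t f1) (dquo t f2) := by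
  intro z hz
  have h1 : HasFDerivWithinAt (fun z : ℝ × ℝ => ((z.1 + t, z.2) : ℝ × ℝ)) (ContinuousLinearMap.id ℝ (ℝ × ℝ))
      (Strip p0) z := by
    have : (fun z : ℝ × ℝ => ((z.1 + t, z.2) : ℝ × ℝ)) = fun z => z + (t, 0) := by
      ext z <;> simp
    rw [this]
    exact ((hasFDerivAt_id z).add_const _).hasFDerivWithinAt
  have h2 := (hg _ (shift_mem hz t)).comp z h1 (fun w hw => shift_mem hw t)
  have h3 := (h2.sub (hg z hz)).const_smul t⁻¹
  have e : dquo t f = t⁻¹ • ((f ∘ fun z : ℝ × ℝ => ((z.1 + t, z.2) : ℝ × ℝ)) - f) := by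
    ext w; simp [dquo]; ring
  rw [e]
  refine h3.congr_fderiv ?_
  ext <;> simp [dquo] <;> ring

lemma dquo_tendsto {f f' : ℝ × ℝ → ℝ} (hf : RowD p0 f f') {z : ℝ × ℝ} (hz : z ∈ Strip p0) :
    Tendsto (fun t => dquo t f z) (𝓝[≠] 0) (𝓝 (f' z)) := by
  have := hasDerivAt_iff_tendsto_slope_zero.1 (hf z hz)
  refine this.congr fun t => ?_
  simp [dquo]; ring

lemma grad_lim (hμ : 0 < μ) {ι : Type*} {l : Filter ι} [l.NeBot] {M : ℝ} (hM : 0 ≤ M)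
    {f f1 f2 : ι → ℝ × ℝ → ℝ} {F F1 F2 : ℝ × ℝ → ℝ}
    (hg : ∀ᶠ n in l, Grad (Strip p0) (f n) (f1 n) (f2 n))
    (h1 : ∀ᶠ n in l, Hol (Strip p0) μ M (f1 n)) (h2 : ∀ᶠ n in l, Hol (Strip p0) μ M (f2 n))
    (t : ∀ z ∈ Strip p0, Tendsto (fun n => f n z) l (𝓝 (F z)))
    (t1 : ∀ z ∈ Strip p0, Tendsto (fun n => f1 n z) l (𝓝 (F1 z)))
    (t2 : ∀ z ∈ Strip p0, Tendsto (fun n => f2 n z) l (𝓝 (F2 z))) :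
    Grad (Strip p0) F F1 F2 := by
  intro x hx
  refine hasFDerivWithinAt_of_taylor (C := 2 * M) hμ fun y hy => ?_
  refine le_of_tendsto ((((t y hy).sub (t x hx)).sub (((t1 x hx).mul_const _).add
    ((t2 x hx).mul_const _))).abs) ?_
  filter_upwards [hg, h1, h2] with n k k1 k2
  exact taylor1 (convex_strip p0) hμ hM k k1 k2 hx hy

lemma bd_lim {ι : Type*} {l : Filter ι} [l.NeBot] {M : ℝ} {f : ι → ℝ × ℝ → ℝ} {F : ℝ × ℝ → ℝ}
    (h1 : ∀ᶠ n in l, Bd p0 μ M (f n))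
    (t : ∀ z ∈ Strip p0, Tendsto (fun n => f n z) l (𝓝 (F z))) : Bd p0 μ M F := by
  refine ⟨fun z hz => le_of_tendsto (t z hz).abs (h1.mono fun n h => h.1 z hz),
    fun z hz z' hz' => le_of_tendsto ((t z hz).sub (t z' hz')).abs (h1.mono fun n h => h.2 z hz z' hz')⟩

lemma Grad.row (hp0 : p0 < 0) (hμ : 0 < μ) {M : ℝ} {f f1 f2 f1' f2' : ℝ × ℝ → ℝ} (hg : Grad (Strip p0) f f1 f2)
    (h1 : RowD p0 f1 f1') (h2 : RowD p0 f2 f2') (b1 : Bd p0 μ M f1') (b2 : Bd p0 μ M f2') :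
    Grad (Strip p0) f1 f1' f2' := by
  refine grad_lim (l := 𝓝[≠] (0 : ℝ)) (f := fun t => dquo t f) (f1 := fun t => dquo t f1)
    (f2 := fun t => dquo t f2) hμ (b1.nonneg hp0) (Eventually.of_forall fun t => dquo_grad hg) ?_ ?_ 
    (fun z hz => dquo_tendsto hg.rowD hz) (fun z hz => dquo_tendsto h1 hz)
    (fun z hz => dquo_tendsto h2 hz)
  · filter_upwards [self_mem_nhdsWithin] with t ht using (dquo_bd ht h1 b1).2
  · filter_upwards [self_mem_nhdsWithin] with t ht using (dquo_bd ht h2 b2).2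

lemma shift_bd {M t : ℝ} {f : ℝ × ℝ → ℝ} (hf : Bd p0 μ M f) :
    Bd p0 μ M (fun z => f (z.1 + t, z.2)) := by
  refine ⟨fun z hz => hf.1 _ (shift_mem hz t), fun z hz z' hz' => ?_⟩
  have := hf.2 _ (shift_mem hz t) _ (shift_mem hz' t)
  have e : ((z.1 + t, z.2) : ℝ × ℝ) - (z'.1 + t, z'.2) = z - z' := by ext <;> simp
  rwa [e] at this

lemma rownorm (x x' p : ℝ) : ‖((x, p) : ℝ × ℝ) - (x', p)‖ = |x - x'| := by
  simp [Prod.norm_def]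

theorem regR {lam Lam : ℝ} (hp0 : p0 < 0) (hμ : 0 < μ) (hμ1 : μ < 1) (hlam : 0 < lam)
    {a b c a' b' c' F F' gt gt' : ℝ × ℝ → ℝ} (hcof : Cof p0 μ lam Lam a b c)
    {G1 G2 : ℝ × ℝ → ℝ} {U : Fin 3 → ℝ × ℝ → ℝ}
    (hG1 : Grad (Strip p0) G1 (U 0) (U 1)) (hG2 : Grad (Strip p0) G2 (U 1) (U 2))
    {M : ℝ} (hU : ∀ i, Bd p0 μ M (U i))
    (hF : ∀ z ∈ Strip p0, a z * U 0 z + b z * U 1 z + c z * U 2 z = F z)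
    (da : RowD p0 a a') (db : RowD p0 b b') (dc : RowD p0 c c') (dF : RowD p0 F F') (dg : RowD p0 gt gt')
    (ba : Bd p0 μ M a') (bb : Bd p0 μ M b') (bc : Bd p0 μ M c') (bF : Bd p0 μ M F') (bg : Bd p0 μ M gt')
    (hbot : ∀ x, U 0 (x, p0) = 0) (htop : ∀ x, U 0 (x, 0) = gt (x, 0)) :
    ∃ (V : Fin 3 → ℝ × ℝ → ℝ) (N : ℝ), (∀ i, Bd p0 μ N (V i)) ∧ Grad (Strip p0) (U 0) (V 0) (V 1) ∧
      Grad (Strip p0) (U 1) (V 1) (V 2) ∧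
      ∀ z ∈ Strip p0, a z * V 0 z + b z * V 1 z + c z * V 2 z =
        F' z - a' z * U 0 z - b' z * U 1 z - c' z * U 2 z := by
  obtain ⟨C, hC, H⟩ := schauder2 (Lam := Lam) hp0 hμ hμ1 hlam
  have hM : 0 ≤ M := ba.nonneg hp0
  set E := M + 3 * (2 * (M * M)) with hE
  have hME : M ≤ E := by nlinarith
  have hE0 : 0 ≤ E := by nlinarith
  have hid : ∀ t : ℝ, ∀ z ∈ Strip p0, a z * dquo t (U 0) z + b z * dquo t (U 1) z + c z * dquo t (U 2) z
      = dquo t F z + (-1 * (dquo t a z * U 0 (z.1 + t, z.2))) + (-1 * (dquo t b z * U 1 (z.1 + t, z.2)))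
        + (-1 * (dquo t c z * U 2 (z.1 + t, z.2))) := by
    intro t z hz
    have h1 := hF z hz
    have h2 := hF _ (shift_mem hz t)
    simp only [dquo]
    rw [← h1, ← h2]; ring
  have hq : ∀ t : ℝ, t ≠ 0 → ∀ i, Bd p0 μ (C * E) (dquo t (U i)) := by
    intro t ht
    have dfa := dquo_bd ht da ba
    have dfb := dquo_bd ht db bb
    have dfc := dquo_bd ht dc bc
    have dfF := dquo_bd ht dF bF
    have dfg := dquo_bd ht dg bg
    refine H a b c hcof (dquo t G1) (dquo t G2) (fun i => dquo t (U i)) (dquo_grad hG1) (dquo_grad hG2) E hE0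
      (fun z hz => ((dquo_bd ht hG1.rowD (hU 0)).1 z hz).trans hME)
      (fun z hz => ((dquo_bd ht hG2.rowD (hU 1)).1 z hz).trans hME) ?_ ?_ ?_ ?_
    · have k := ((dfF.add ((dfa.mul (shift_bd (t := t) (hU 0))).smul (c := -1))).add
        ((dfb.mul (shift_bd (t := t) (hU 1))).smul (c := -1))).add
        ((dfc.mul (shift_bd (t := t) (hU 2))).smul (c := -1))
      have k2 := k.congr fun z hz => (hid t z hz).symm
      refine k2.2.mono ?_
      simp only [abs_neg, abs_one]; rw [hE]; linarith
    · intro x x'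
      simp only [dquo, hbot]
      simp; positivity
    · intro x x'
      have e : ∀ x, dquo t (U 0) (x, 0) = dquo t gt (x, 0) := by
        intro x; simp only [dquo, htop]
      simp only [e]
      have := dfg.2 (x, 0) ⟨hp0.le, le_rfl⟩ (x', 0) ⟨hp0.le, le_rfl⟩
      rw [rownorm] at this
      exact this.trans (by gcongr)
    · refine ⟨|t⁻¹| * (M + |(-1 : ℝ)| * M), fun i => ?_⟩
      have k := ((shift_bd (t := t) (hU i)).add ((hU i).smul (c := -1))).smul (c := t⁻¹)
      exact (k.congr fun z hz => by simp only [dquo]; ring).2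
  let t : ℕ → ℝ := fun n => 1 / ((n : ℝ) + 1)
  have ht : ∀ n, t n ≠ 0 := fun n => (one_div_pos.2 (by positivity)).ne'
  let 𝒰 : Ultrafilter ℕ := hyperfilter ℕ
  have htl : Tendsto t 𝒰 (𝓝[≠] 0) := by
    refine tendsto_nhdsWithin_iff.2 ⟨?_, Eventually.of_forall ht⟩
    exact tendsto_one_div_add_atTop_nhds_zero_nat.mono_left
      ((hyperfilter_le_cofinite).trans Nat.cofinite_eq_atTop.le)
  have hex : ∀ (i : Fin 3) (z : ℝ × ℝ), ∃ l, z ∈ Strip p0 → Tendsto (fun n => dquo (t n) (U i) z) 𝒰 (𝓝 l) := by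
    intro i z
    by_cases hz : z ∈ Strip p0
    · obtain ⟨l, hl⟩ := ulim_exists 𝒰 (fun n => dquo (t n) (U i) z) (C * E)
        (Eventually.of_forall fun n => (hq _ (ht n) i).1 z hz)
      exact ⟨l, fun _ => hl⟩
    · exact ⟨0, fun h => absurd h hz⟩
  choose V hV using hex
  have hol : ∀ i, ∀ᶠ n in (𝒰 : Filter ℕ), Hol (Strip p0) μ (C * E) (dquo (t n) (U i)) := fun i =>
    Eventually.of_forall fun n => (hq _ (ht n) i).2
  refine ⟨V, C * E, fun i => bd_lim (Eventually.of_forall fun n => hq _ (ht n) i) (fun z hz => hV i z hz),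
    grad_lim hμ (by nlinarith) (Eventually.of_forall fun n => dquo_grad hG1) (hol 0) (hol 1)
      (fun z hz => (dquo_tendsto hG1.rowD hz).comp htl) (fun z hz => hV 0 z hz) (fun z hz => hV 1 z hz),
    grad_lim hμ (by nlinarith) (Eventually.of_forall fun n => dquo_grad hG2) (hol 1) (hol 2)
      (fun z hz => (dquo_tendsto hG2.rowD hz).comp htl) (fun z hz => hV 1 z hz) (fun z hz => hV 2 z hz), ?_⟩
  intro z hz
  have sh : ∀ i, Tendsto (fun n => U i (z.1 + t n, z.2)) 𝒰 (𝓝 (U i z)) := by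
    intro i
    have hc := (hU i).cont hμ z hz
    refine hc.tendsto.comp (tendsto_nhdsWithin_iff.2 ⟨?_, Eventually.of_forall fun n => shift_mem hz _⟩)
    have : Tendsto (fun n => (z.1 + t n, z.2)) 𝒰 (𝓝 (z.1 + 0, z.2)) :=
      ((tendsto_nhdsWithin_iff.1 htl).1.const_add z.1).prodMk_nhds tendsto_const_nhds
    simpa using this
  have l1 := (((hV 0 z hz).const_mul (a z)).add ((hV 1 z hz).const_mul (b z))).add
    ((hV 2 z hz).const_mul (c z))
  have l2 := ((((dquo_tendsto dF hz).comp htl).add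
    ((((dquo_tendsto da hz).comp htl).mul (sh 0)).const_mul (-1))).add
    ((((dquo_tendsto db hz).comp htl).mul (sh 1)).const_mul (-1))).add
    ((((dquo_tendsto dc hz).comp htl).mul (sh 2)).const_mul (-1))
  have := tendsto_nhds_unique (l1.congr fun n => hid (t n) z hz) l2
  rw [this]; ring

def Cq (p0 : ℝ) (Pr : (ℝ × ℝ → ℝ) → Prop) : ℕ → (ℝ × ℝ → ℝ) → Prop
  | 0, f => Pr f
  | k + 1, f => Pr f ∧ ∃ f', RowD p0 f f' ∧ Cq p0 Pr k f'

structure Alg (p0 : ℝ) (Pr : (ℝ × ℝ → ℝ) → Prop) : Prop where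
  const : ∀ c : ℝ, Pr fun _ => c
  add : ∀ f g, Pr f → Pr g → Pr fun z => f z + g z
  mul : ∀ f g, Pr f → Pr g → Pr fun z => f z * g z
  congr : ∀ f g, Pr f → (∀ z ∈ Strip p0, f z = g z) → Pr g

lemma RowD.congr {f g f' : ℝ × ℝ → ℝ} (h : RowD p0 f f') (hfg : ∀ z ∈ Strip p0, f z = g z) :
    RowD p0 g f' := by
  intro z hz
  have : (fun q => g (q, z.2)) = fun q => f (q, z.2) := by
    ext q; exact (hfg (q, z.2) hz).symm
  rw [this]; exact h z hz

lemma RowD.unique {f f' f'' : ℝ × ℝ → ℝ} (h : RowD p0 f f') (h' : RowD p0 f f'') :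
    ∀ z ∈ Strip p0, f' z = f'' z := fun z hz => (h z hz).unique (h' z hz)

lemma RowD.add {f g f' g' : ℝ × ℝ → ℝ} (h : RowD p0 f f') (h' : RowD p0 g g') :
    RowD p0 (fun z => f z + g z) (fun z => f' z + g' z) := fun z hz => (h z hz).add (h' z hz)

lemma RowD.mul {f g f' g' : ℝ × ℝ → ℝ} (h : RowD p0 f f') (h' : RowD p0 g g') :
    RowD p0 (fun z => f z * g z) (fun z => f' z * g z + f z * g' z) := fun z hz => (h z hz).mul (h' z hz)

lemma RowD.indep (β : ℝ → ℝ) : RowD p0 (fun z => β z.2) (fun _ => 0) :=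
  fun z _ => hasDerivAt_const z.1 (β z.2)

lemma RowD.inv {f f' : ℝ × ℝ → ℝ} (h : RowD p0 f f') (h0 : ∀ z ∈ Strip p0, f z ≠ 0) :
    RowD p0 (fun z => (f z)⁻¹) (fun z => -1 * f' z * ((f z)⁻¹ * (f z)⁻¹)) := by
  intro z hz
  have := (h z hz).fun_inv (h0 z hz)
  refine this.congr_deriv ?_
  simp only [Prod.mk.eta]
  ring

lemma RowD.sqrt {f f' : ℝ × ℝ → ℝ} (h : RowD p0 f f') (h0 : ∀ z ∈ Strip p0, 0 < f z) :
    RowD p0 (fun z => Real.sqrt (f z)) (fun z => 1 / 2 * f' z * (Real.sqrt (f z))⁻¹) := by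
  intro z hz
  have := (h z hz).sqrt (h0 z hz).ne'
  refine this.congr_deriv ?_
  have := (Real.sqrt_pos.2 (h0 z hz)).ne'
  field_simp

section
variable {Pr : (ℝ × ℝ → ℝ) → Prop}

lemma Cq.base {k : ℕ} {f : ℝ × ℝ → ℝ} (h : Cq p0 Pr k f) : Pr f := by
  cases k with
  | zero => exact h
  | succ k => exact h.1

lemma Cq.down {k : ℕ} : ∀ {f : ℝ × ℝ → ℝ}, Cq p0 Pr (k + 1) f → Cq p0 Pr k f := by
  induction k with
  | zero => exact fun h => h.1
  | succ k ih => exact fun ⟨h1, f', h2, h3⟩ => ⟨h1, f', h2, ih h3⟩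

lemma Cq.congr (A : Alg p0 Pr) {k : ℕ} {f g : ℝ × ℝ → ℝ} (h : Cq p0 Pr k f)
    (hfg : ∀ z ∈ Strip p0, f z = g z) : Cq p0 Pr k g := by
  cases k with
  | zero => exact A.congr _ _ h hfg
  | succ k => exact ⟨A.congr _ _ h.1 hfg, h.2.imp fun f' h => ⟨h.1.congr hfg, h.2⟩⟩

lemma Cq.row (A : Alg p0 Pr) {k : ℕ} {f f' : ℝ × ℝ → ℝ} (h : Cq p0 Pr (k + 1) f) (hr : RowD p0 f f') :
    Cq p0 Pr k f' := by
  obtain ⟨-, g, h1, h2⟩ := h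
  exact h2.congr A (h1.unique hr)

lemma Cq.add (A : Alg p0 Pr) {k : ℕ} : ∀ {f g : ℝ × ℝ → ℝ}, Cq p0 Pr k f → Cq p0 Pr k g →
    Cq p0 Pr k (fun z => f z + g z) := by
  induction k with
  | zero => exact fun hf hg => A.add _ _ hf hg
  | succ k ih =>
    rintro f g ⟨h1, f', h2, h3⟩ ⟨k1, g', k2, k3⟩
    exact ⟨A.add _ _ h1 k1, _, h2.add k2, ih h3 k3⟩

lemma Cq.mul (A : Alg p0 Pr) {k : ℕ} : ∀ {f g : ℝ × ℝ → ℝ}, Cq p0 Pr k f → Cq p0 Pr k g →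
    Cq p0 Pr k (fun z => f z * g z) := by
  induction k with
  | zero => exact fun hf hg => A.mul _ _ hf hg
  | succ k ih =>
    intro f g hf hg
    have hfd := hf.down
    have hgd := hg.down
    obtain ⟨h1, f', h2, h3⟩ := hf
    obtain ⟨k1, g', k2, k3⟩ := hg
    exact ⟨A.mul _ _ h1 k1, _, h2.mul k2, (ih h3 hgd).add A (ih hfd k3)⟩

lemma Cq.const (A : Alg p0 Pr) {k : ℕ} : ∀ (c : ℝ), Cq p0 Pr k (fun _ => c) := by
  induction k with
  | zero => exact fun c => A.const c
  | succ k ih => exact fun c => ⟨A.const c, fun _ => 0, RowD.indep (fun _ => c), ih 0⟩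

lemma Cq.indep (A : Alg p0 Pr) {k : ℕ} {β : ℝ → ℝ} (h : Pr fun z => β z.2) : Cq p0 Pr k (fun z => β z.2) := by
  cases k with
  | zero => exact h
  | succ k => exact ⟨h, fun _ => 0, RowD.indep β, Cq.const A 0⟩

lemma Cq.inv (A : Alg p0 Pr) {k : ℕ} {f : ℝ × ℝ → ℝ} (hf : Cq p0 Pr k f) (h0 : ∀ z ∈ Strip p0, f z ≠ 0)
    (hi : Pr fun z => (f z)⁻¹) : Cq p0 Pr k (fun z => (f z)⁻¹) := by
  induction k with
  | zero => exact hi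
  | succ k ih =>
    have hk := ih hf.down
    obtain ⟨h1, f', h2, h3⟩ := hf
    exact ⟨hi, _, h2.inv h0, ((Cq.const A (-1)).mul A h3).mul A (hk.mul A hk)⟩

lemma Cq.sqrt (A : Alg p0 Pr) {k : ℕ} {f : ℝ × ℝ → ℝ} (hf : Cq p0 Pr k f) (h0 : ∀ z ∈ Strip p0, 0 < f z)
    (hs : Pr fun z => Real.sqrt (f z))
    (hi : Pr fun z => (Real.sqrt (f z))⁻¹) : Cq p0 Pr k (fun z => Real.sqrt (f z)) := by
  induction k with
  | zero => exact hs
  | succ k ih =>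
    have hk := ih hf.down
    have hki := hk.inv A (fun z hz => (Real.sqrt_pos.2 (h0 z hz)).ne') hi
    obtain ⟨h1, f', h2, h3⟩ := hf
    exact ⟨hs, _, h2.sqrt h0, ((Cq.const A (1 / 2)).mul A h3).mul A hki⟩
end

lemma algB : Alg p0 (fun f => ∃ M, Bd p0 μ M f) where
  const c := ⟨_, Bd.const c⟩
  add := fun _ _ ⟨_, hM⟩ ⟨_, hN⟩ => ⟨_, hM.add hN⟩
  mul := fun _ _ ⟨_, hM⟩ ⟨_, hN⟩ => ⟨_, hM.mul hN⟩
  congr := fun _ _ ⟨_, hM⟩ h => ⟨_, hM.congr h⟩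

theorem linCq {lam Lam : ℝ} (hp0 : p0 < 0) (hμ : 0 < μ) (hμ1 : μ < 1) (hlam : 0 < lam)
    {a b c : ℝ × ℝ → ℝ} (hcof : Cof p0 μ lam Lam a b c) (k : ℕ)
    (ha : Cq p0 (fun f => ∃ M, Bd p0 μ M f) k a) (hb : Cq p0 (fun f => ∃ M, Bd p0 μ M f) k b)
    (hc : Cq p0 (fun f => ∃ M, Bd p0 μ M f) k c) : ∀ {F gt G1 G2 : ℝ × ℝ → ℝ} {U : Fin 3 → ℝ × ℝ → ℝ},
    Cq p0 (fun f => ∃ M, Bd p0 μ M f) k F → Cq p0 (fun f => ∃ M, Bd p0 μ M f) k gt →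
    Grad (Strip p0) G1 (U 0) (U 1) → Grad (Strip p0) G2 (U 1) (U 2) → (∀ i, ∃ M, Bd p0 μ M (U i)) →
    (∀ z ∈ Strip p0, a z * U 0 z + b z * U 1 z + c z * U 2 z = F z) →
    (∀ x, U 0 (x, p0) = 0) → (∀ x, U 0 (x, 0) = gt (x, 0)) →
    ∀ i, Cq p0 (fun f => ∃ M, Bd p0 μ M f) k (U i) := by
  have A := algB (p0 := p0) (μ := μ)
  induction k with
  | zero => intro F gt G1 G2 U _ _ _ _ hU _ _ _ i; exact hU i
  | succ k ih =>
    intro F gt G1 G2 U hF hgt hG1 hG2 hU heq hbot htop i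
    have IH := ih ha.down hb.down hc.down hF.down hgt.down hG1 hG2 hU heq hbot htop
    have had := ha.down
    have hbd := hb.down
    have hcd := hc.down
    obtain ⟨-, a', da, qa⟩ := ha
    obtain ⟨-, b', db, qb⟩ := hb
    obtain ⟨-, c', dc, qc⟩ := hc
    obtain ⟨-, F', dF, qF⟩ := hF
    obtain ⟨-, g', dg, qg⟩ := hgt
    obtain ⟨Ma, hMa⟩ := qa.base
    obtain ⟨Mb, hMb⟩ := qb.base
    obtain ⟨Mc, hMc⟩ := qc.base
    obtain ⟨MF, hMF⟩ := qF.base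
    obtain ⟨Mg, hMg⟩ := qg.base
    choose MU hMU using hU
    let M := Ma + Mb + Mc + MF + Mg + (MU 0 + MU 1 + MU 2)
    have p1 := hMa.nonneg hp0
    have p2 := hMb.nonneg hp0
    have p3 := hMc.nonneg hp0
    have p4 := hMF.nonneg hp0
    have p5 := hMg.nonneg hp0
    have p6 := fun i => (hMU i).nonneg hp0
    obtain ⟨V, N, hV, gV1, gV2, eV⟩ := regR (M := M) hp0 hμ hμ1 hlam hcof hG1 hG2
      (fun i => (hMU i).mono (by
        have := p6 0; have := p6 1; have := p6 2
        have : MU i ≤ MU 0 + MU 1 + MU 2 := by fin_cases i <;> simp <;> linarith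
        linarith)) heq da db dc dF dg
      (hMa.mono (by linarith [p6 0, p6 1, p6 2])) (hMb.mono (by linarith [p6 0, p6 1, p6 2]))
      (hMc.mono (by linarith [p6 0, p6 1, p6 2])) (hMF.mono (by linarith [p6 0, p6 1, p6 2]))
      (hMg.mono (by linarith [p6 0, p6 1, p6 2])) hbot htop
    have m1 := Cq.const (p0 := p0) A (k := k) (-1)
    have hF1 := ((qF.add A (m1.mul A (qa.mul A (IH 0)))).add A (m1.mul A (qb.mul A (IH 1)))).add A
      (m1.mul A (qc.mul A (IH 2)))
    have hVk := ih had hbd hcd hF1 qg gV1 gV2 (fun i => ⟨N, hV i⟩)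
      (fun z hz => by rw [eV z hz]; ring)
      (fun x => by
        have h1 := gV1.rowD (x, p0) ⟨le_rfl, hp0.le⟩
        have h2 : HasDerivAt (fun q => U 0 (q, p0)) 0 x := by
          simp only [hbot]; exact hasDerivAt_const _ _
        exact h1.unique h2)
      (fun x => by
        have h1 := gV1.rowD (x, 0) ⟨hp0.le, le_rfl⟩
        have h2 := dg (x, 0) ⟨hp0.le, le_rfl⟩
        simp only [htop] at h1
        exact h1.unique h2)
    have row2 : RowD p0 (U 2) (V 2) := by
      have hc0 : ∀ z ∈ Strip p0, c z ≠ 0 := fun z hz => (hlam.trans_le (hcof.lc z hz)).ne'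
      intro z hz
      have e : (fun q => U 2 (q, z.2)) =
          fun q => (F (q, z.2) - a (q, z.2) * U 0 (q, z.2) - b (q, z.2) * U 1 (q, z.2)) / c (q, z.2) := by
        ext q
        have := heq (q, z.2) hz
        rw [eq_div_iff (hc0 (q, z.2) hz), ← this]; ring
      rw [e]
      have := (((dF z hz).sub ((da z hz).mul (gV1.rowD z hz))).sub ((db z hz).mul (gV2.rowD z hz))).div
        (dc z hz) (hc0 z hz)
      refine this.congr_deriv ?_
      rw [div_eq_iff (pow_ne_zero 2 (hc0 z hz))]
      have h1 := eV z hz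
      have h2 := heq z hz
      simp only [Prod.mk.eta, Pi.sub_apply, Pi.mul_apply]
      rw [← h2]
      have h3 : F' z = a z * V 0 z + b z * V 1 z + c z * V 2 z + a' z * U 0 z + b' z * U 1 z + c' z * U 2 z := by
        linarith
      rw [h3]; ring
    fin_cases i
    · exact ⟨⟨_, hMU 0⟩, V 0, gV1.rowD, hVk 0⟩
    · exact ⟨⟨_, hMU 1⟩, V 1, gV2.rowD, hVk 1⟩
    · exact ⟨⟨_, hMU 2⟩, V 2, row2, hVk 2⟩

lemma strip_eq (p0 : ℝ) : Strip p0 = (univ : Set ℝ) ×ˢ Icc p0 0 := by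
  ext z; simp [Strip]

lemma strip_ud (hp0 : p0 < 0) : UniqueDiffOn ℝ (Strip p0) := by
  rw [strip_eq]; exact uniqueDiffOn_univ.prod (uniqueDiffOn_Icc hp0)

lemma strip_cl (hp0 : p0 < 0) : Strip p0 ⊆ closure {z : ℝ × ℝ | p0 < z.2 ∧ z.2 < 0} := by
  have : {z : ℝ × ℝ | p0 < z.2 ∧ z.2 < 0} = (univ : Set ℝ) ×ˢ Ioo p0 0 := by ext z; simp
  rw [this, closure_prod_eq, closure_univ, closure_Ioo hp0.ne, strip_eq]

lemma strip_int (hp0 : p0 < 0) : Strip p0 ⊆ closure (interior (Strip p0)) := by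
  rw [strip_eq, interior_prod_eq, interior_univ, interior_Icc, closure_prod_eq, closure_univ,
    closure_Ioo hp0.ne]

def dv (p0 : ℝ) (v : ℝ × ℝ) (f : ℝ × ℝ → ℝ) : ℝ × ℝ → ℝ := fun z => fderivWithin ℝ f (Strip p0) z v

abbrev dq (p0 : ℝ) := dv p0 (1, 0)
abbrev dp (p0 : ℝ) := dv p0 (0, 1)

lemma dv_congr {v : ℝ × ℝ} {f g : ℝ × ℝ → ℝ} (h : ∀ z ∈ Strip p0, f z = g z) :
    ∀ z ∈ Strip p0, dv p0 v f z = dv p0 v g z := by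
  intro z hz
  rw [dv, dv, fderivWithin_congr h (h z hz)]

lemma dv_cd (hp0 : p0 < 0) {v : ℝ × ℝ} {f : ℝ × ℝ → ℝ} {m : WithTop ℕ∞} (h : ContDiffOn ℝ (m + 1) f (Strip p0)) :
    ContDiffOn ℝ m (dv p0 v f) (Strip p0) :=
  (h.fderivWithin (strip_ud hp0) le_rfl).clm_apply contDiffOn_const

lemma grad_of_diff {f : ℝ × ℝ → ℝ} (h : DifferentiableOn ℝ f (Strip p0)) :
    Grad (Strip p0) f (dq p0 f) (dp p0 f) := by
  intro z hz
  refine (h z hz).hasFDerivWithinAt.congr_fderiv ?_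
  ext <;> simp [dv]

lemma Grad.eq (hp0 : p0 < 0) {f f1 f2 : ℝ × ℝ → ℝ} (h : Grad (Strip p0) f f1 f2) :
    ∀ z ∈ Strip p0, dq p0 f z = f1 z ∧ dp p0 f z = f2 z := by
  intro z hz
  have := (h z hz).fderivWithin (strip_ud hp0 z hz)
  simp [dv, this]

lemma dv_comm2 (hp0 : p0 < 0) (u v : ℝ × ℝ) {f : ℝ × ℝ → ℝ} (h : ContDiffOn ℝ 2 f (Strip p0)) :
    ∀ z ∈ Strip p0, dv p0 u (dv p0 v f) z = dv p0 v (dv p0 u f) z := by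
  intro z hz
  have hs : IsSymmSndFDerivWithinAt ℝ f (Strip p0) z :=
    (h z hz).isSymmSndFDerivWithinAt (by simp) (strip_ud hp0) (strip_int hp0 hz) hz
  have hd : DifferentiableWithinAt ℝ (fderivWithin ℝ f (Strip p0)) (Strip p0) z :=
    ((h.fderivWithin (m := 1) (strip_ud hp0) (by norm_num)).differentiableOn (by simp)) z hz
  have key : ∀ v w : ℝ × ℝ, dv p0 v (dv p0 w f) z = fderivWithin ℝ (fderivWithin ℝ f (Strip p0)) (Strip p0) z v w := by
    intro v w
    have h1 := (hd.hasFDerivWithinAt.clm_apply (hasFDerivWithinAt_const w z (Strip p0))).fderivWithin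
      (strip_ud hp0 z hz)
    unfold dv
    rw [h1]; simp
  rw [key, key]
  exact hs _ _

lemma dv_comm (hp0 : p0 < 0) {f : ℝ × ℝ → ℝ} (h : ContDiffOn ℝ 2 f (Strip p0)) :
    ∀ z ∈ Strip p0, dq p0 (dp p0 f) z = dp p0 (dq p0 f) z := dv_comm2 hp0 _ _ h

lemma itd_cast {n n' : ℕ} (hn : n = n') (f : ℝ × ℝ → ℝ) (S : Set (ℝ × ℝ)) (z : ℝ × ℝ) (v : ℕ → ℝ × ℝ) :
    iteratedFDerivWithin ℝ n f S z (fun i => v i) = iteratedFDerivWithin ℝ n' f S z (fun i => v i) := by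
  subst hn; rfl

lemma itd_succ (hp0 : p0 < 0) {n : ℕ} {f : ℝ × ℝ → ℝ} (h : ContDiffOn ℝ (n + 1 : ℕ) f (Strip p0)) (v : ℕ → ℝ × ℝ)
    {z : ℝ × ℝ} (hz : z ∈ Strip p0) :
    iteratedFDerivWithin ℝ (n + 1) f (Strip p0) z (fun i => v i) =
      dv p0 (v 0) (fun w => iteratedFDerivWithin ℝ n f (Strip p0) w (fun i => v (i + 1))) z := by
  rw [iteratedFDerivWithin_succ_apply_left]
  have hd := (h.differentiableOn_iteratedFDerivWithin (m := n) (by exact_mod_cast Nat.lt_succ_self n)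
    (strip_ud hp0)) z hz
  have h1 : fderivWithin ℝ (fun w => iteratedFDerivWithin ℝ n f (Strip p0) w (fun i => v (i + 1)))
      (Strip p0) z (v 0) = fderivWithin ℝ (iteratedFDerivWithin ℝ n f (Strip p0)) (Strip p0) z (v 0)
        (fun i => v (i + 1)) := by
    rw [fderivWithin_continuousMultilinear_apply_const_apply (strip_ud hp0 z hz) hd]
  rw [dv, h1]
  rfl

lemma pd_zero (f : ℝ × ℝ → ℝ) (z : ℝ × ℝ) : pd p0 0 0 f z = f z := by
  simp [pd, mpw]

lemma pd_succ_q (hp0 : p0 < 0) {a b : ℕ} {f : ℝ × ℝ → ℝ} (h : ContDiffOn ℝ (a + b + 1 : ℕ) f (Strip p0)) :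
    ∀ z ∈ Strip p0, pd p0 (a + 1) b f z = dq p0 (pd p0 a b f) z := by
  intro z hz
  have h1 := itd_succ hp0 h (fun i => if i < a + 1 then ((1 : ℝ), (0 : ℝ)) else (0, 1)) hz
  rw [itd_cast (show a + b + 1 = (a + 1) + b by ring) f (Strip p0) z
    (fun i => if i < a + 1 then ((1 : ℝ), (0 : ℝ)) else (0, 1))] at h1
  simp only [Nat.add_lt_add_iff_right, Nat.zero_lt_succ, if_true] at h1
  exact h1

lemma pd_succ_p0 (hp0 : p0 < 0) {b : ℕ} {f : ℝ × ℝ → ℝ} (h : ContDiffOn ℝ (b + 1 : ℕ) f (Strip p0)) :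
    ∀ z ∈ Strip p0, pd p0 0 (b + 1) f z = dp p0 (pd p0 0 b f) z := by
  intro z hz
  have h1 := itd_succ hp0 h (fun _ => ((0 : ℝ), (1 : ℝ))) hz
  have e : ∀ b : ℕ, pd p0 0 b f = fun w => iteratedFDerivWithin ℝ b f (Strip p0) w (fun _ => ((0 : ℝ), (1 : ℝ))) := by
    intro b
    ext w
    have := itd_cast (zero_add b) f (Strip p0) w (fun _ => ((0 : ℝ), (1 : ℝ)))
    simpa [pd, mpw] using this
  rw [e, e]
  exact h1

lemma pd_cd (hp0 : p0 < 0) {f : ℝ × ℝ → ℝ} (a b m : ℕ) (h : ContDiffOn ℝ (a + b + m : ℕ) f (Strip p0)) :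
    ContDiffOn ℝ m (pd p0 a b f) (Strip p0) := by
  induction a generalizing m with
  | zero =>
    induction b generalizing m with
    | zero =>
      have : pd p0 0 0 f = f := by ext z; exact pd_zero f z
      rw [this]; simpa using h
    | succ b ih =>
      have h1 := ih (m + 1) (h.of_le (by norm_cast; omega))
      have h2 := dv_cd hp0 (v := (0, 1)) (m := m) (by exact_mod_cast h1)
      exact h2.congr (pd_succ_p0 hp0 (h.of_le (by norm_cast; omega)))
  | succ a ih =>
    have h1 := ih (m + 1) (h.of_le (by norm_cast; omega))
    have h2 := dv_cd hp0 (v := (1, 0)) (m := m) (by exact_mod_cast h1)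
    exact h2.congr (pd_succ_q hp0 (h.of_le (by norm_cast; omega)))

lemma pd_succ_p (hp0 : p0 < 0) {f : ℝ × ℝ → ℝ} (a b : ℕ) (h : ContDiffOn ℝ (a + b + 1 : ℕ) f (Strip p0)) :
    ∀ z ∈ Strip p0, pd p0 a (b + 1) f z = dp p0 (pd p0 a b f) z := by
  induction a with
  | zero => exact pd_succ_p0 hp0 (by simpa using h)
  | succ a ih =>
    intro z hz
    refine (pd_succ_q hp0 (h.of_le (by norm_cast; omega)) z hz).trans
      ((dv_congr (ih (h.of_le (by norm_cast; omega))) z hz).trans ?_)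
    have h2 := pd_cd hp0 a b 2 (h.of_le (by norm_cast; omega))
    have := dv_comm hp0 (f := pd p0 a b f) (by exact_mod_cast h2) z hz
    refine this.trans ?_
    exact dv_congr (fun w hw => (pd_succ_q hp0 (h.of_le (by norm_cast; omega)) w hw).symm) z hz

lemma pd_grad (hp0 : p0 < 0) {f : ℝ × ℝ → ℝ} (a b : ℕ) (h : ContDiffOn ℝ (a + b + 1 : ℕ) f (Strip p0)) :
    Grad (Strip p0) (pd p0 a b f) (pd p0 (a + 1) b f) (pd p0 a (b + 1) f) := by
  intro z hz
  have h1 := grad_of_diff ((pd_cd hp0 a b 1 h).differentiableOn (by simp)) z hz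
  rwa [← pd_succ_q hp0 h z hz, ← pd_succ_p hp0 a b h z hz] at h1

abbrev FB (p0 μ : ℝ) : (ℝ × ℝ → ℝ) → Prop := fun f => ∃ M, Bd p0 μ M f

structure Sol (p0 μ g d σ Q δ₁ ρ0 : ℝ) (β ρ' : ℝ → ℝ) (h h1 h2 h11 h12 h22 : ℝ × ℝ → ℝ) : Prop where
  hp : p0 < 0
  hμ : 0 < μ
  hμ1 : μ < 1
  hσ : 0 < σ
  hδ : 0 < δ₁
  g0 : Grad (Strip p0) h h1 h2
  g1 : Grad (Strip p0) h1 h11 h12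
  g2 : Grad (Strip p0) h2 h12 h22
  b0 : FB p0 μ h
  b1 : FB p0 μ h1
  b2 : FB p0 μ h2
  b11 : FB p0 μ h11
  b12 : FB p0 μ h12
  b22 : FB p0 μ h22
  bβ : FB p0 μ (fun z => β z.2)
  bρ : FB p0 μ (fun z => ρ' z.2)
  sβ : ContDiffOn ℝ (⊤ : ℕ∞) (fun z : ℝ × ℝ => β z.2) (Strip p0)
  sρ : ContDiffOn ℝ (⊤ : ℕ∞) (fun z : ℝ × ℝ => ρ' z.2) (Strip p0)
  pde : ∀ z ∈ Strip p0, h2 z * h2 z * h11 z + -2 * (h2 z * h1 z) * h12 z + (1 + h1 z * h1 z) * h22 z =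
    ((g * ρ' z.2) * (h z + -d) + -1 * β z.2) * (h2 z * h2 z * h2 z)
  top : ∀ x, 2 * σ * (h11 (x, 0) * (h2 (x, 0) * h2 (x, 0))) =
    (1 + h1 (x, 0) * h1 (x, 0) + (2 * g * ρ0 * h (x, 0) + -Q) * (h2 (x, 0) * h2 (x, 0))) *
      (Real.sqrt (1 + h1 (x, 0) * h1 (x, 0)) * (1 + h1 (x, 0) * h1 (x, 0)))
  bot : ∀ x, h (x, p0) = 0
  lo : ∀ z ∈ Strip p0, δ₁ ≤ h2 z

section
variable {g d σ Q δ₁ ρ0 : ℝ} {β ρ' : ℝ → ℝ} {h h1 h2 h11 h12 h22 : ℝ × ℝ → ℝ}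
variable (X : Sol p0 μ g d σ Q δ₁ ρ0 β ρ' h h1 h2 h11 h12 h22)
include X

lemma Sol.bot1 : ∀ x, h1 (x, p0) = 0 := by
  intro x
  have k1 := X.g0.rowD (x, p0) ⟨le_rfl, X.hp.le⟩
  have k2 : HasDerivAt (fun q => h (q, p0)) 0 x := by
    simp only [X.bot]; exact hasDerivAt_const _ _
  exact k1.unique k2

lemma Sol.bot11 : ∀ x, h11 (x, p0) = 0 := by
  intro x
  have k1 := X.g1.rowD (x, p0) ⟨le_rfl, X.hp.le⟩
  have k2 : HasDerivAt (fun q => h1 (q, p0)) 0 x := by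
    simp only [X.bot1]; exact hasDerivAt_const _ _
  exact k1.unique k2

lemma Sol.cof : ∃ lam Lam, 0 < lam ∧ Cof p0 μ lam Lam (fun z => h2 z * h2 z) (fun z => -2 * (h2 z * h1 z))
    (fun z => 1 + h1 z * h1 z) := by
  have A := algB (p0 := p0) (μ := μ)
  obtain ⟨Ma, hMa⟩ := A.mul _ _ X.b2 X.b2
  obtain ⟨Mb, hMb⟩ := A.mul _ _ (A.const (-2)) (A.mul _ _ X.b2 X.b1)
  obtain ⟨Mc, hMc⟩ := A.add _ _ (A.const 1) (A.mul _ _ X.b1 X.b1)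
  have p1 := hMa.nonneg X.hp
  have p2 := hMb.nonneg X.hp
  have p3 := hMc.nonneg X.hp
  have hMa := hMa.mono (show Ma ≤ Ma + Mb + Mc by linarith)
  have hMb := hMb.mono (show Mb ≤ Ma + Mb + Mc by linarith)
  have hMc := hMc.mono (show Mc ≤ Ma + Mb + Mc by linarith)
  have hδ := X.hδ
  refine ⟨min 1 (4 * δ₁ * δ₁), Ma + Mb + Mc, lt_min one_pos (by positivity), hMa.1, hMb.1, hMc.1, hMa.2, hMb.2, hMc.2,
    fun z hz => (min_le_left _ _).trans (by nlinarith [mul_self_nonneg (h1 z)]), fun z hz => (min_le_right _ _).trans ?_⟩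
  have := X.lo z hz
  nlinarith

lemma Sol.invc {Pr : (ℝ × ℝ → ℝ) → Prop} (A : Alg p0 Pr) {k : ℕ} (hh : Cq p0 Pr k h1)
    (hi : Pr fun z => (1 + h1 z * h1 z)⁻¹) : Cq p0 Pr k (fun z => (1 + h1 z * h1 z)⁻¹) :=
  ((Cq.const A 1).add A (hh.mul A hh)).inv A (fun z _ => by nlinarith [mul_self_nonneg (h1 z)]) hi

lemma Sol.cqF {Pr : (ℝ × ℝ → ℝ) → Prop} (A : Alg p0 Pr) {k : ℕ} (c0 : Cq p0 Pr k h) (c2 : Cq p0 Pr k h2)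
    (hβ : Pr fun z => β z.2) (hρ : Pr fun z => ρ' z.2) :
    Cq p0 Pr k (fun z => ((g * ρ' z.2) * (h z + -d) + -1 * β z.2) * (h2 z * h2 z * h2 z)) :=
  ((((Cq.const A g).mul A (Cq.indep A hρ)).mul A (c0.add A (Cq.const A (-d)))).add A
    ((Cq.const A (-1)).mul A (Cq.indep A hβ))).mul A ((c2.mul A c2).mul A c2)

theorem Sol.cqB : ∀ k, Cq p0 (FB p0 μ) k h11 ∧ Cq p0 (FB p0 μ) k h12 ∧ Cq p0 (FB p0 μ) k h22 := by
  have A := algB (p0 := p0) (μ := μ)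
  intro k
  induction k with
  | zero => exact ⟨X.b11, X.b12, X.b22⟩
  | succ k ih =>
    have c1 : Cq p0 (FB p0 μ) (k + 1) h1 := ⟨X.b1, h11, X.g1.rowD, ih.1⟩
    have c2 : Cq p0 (FB p0 μ) (k + 1) h2 := ⟨X.b2, h12, X.g2.rowD, ih.2.1⟩
    have c0 : Cq p0 (FB p0 μ) (k + 1) h := ⟨X.b0, h1, X.g0.rowD, c1.down⟩
    obtain ⟨lam, Lam, hlam, hcof⟩ := X.cof
    have cc : Cq p0 (FB p0 μ) (k + 1) (fun z => 1 + h1 z * h1 z) := (Cq.const A 1).add A (c1.mul A c1)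
    have ge1 : ∀ z ∈ Strip p0, (1:ℝ) ≤ 1 + h1 z * h1 z := fun z _ => by nlinarith [mul_self_nonneg (h1 z)]
    have cs : Cq p0 (FB p0 μ) (k + 1) (fun z => Real.sqrt (1 + h1 z * h1 z)) := by
      obtain ⟨M, hM⟩ := cc.base
      have hs := hM.sqrt ge1
      refine cc.sqrt A (fun z hz => by linarith [ge1 z hz]) ⟨_, hs⟩ ?_
      exact hs.inv one_pos fun z hz => Real.one_le_sqrt.2 (ge1 z hz)
    have ci : Cq p0 (FB p0 μ) (k + 1) (fun z => (h2 z * h2 z)⁻¹) := by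
      have hδ := X.hδ
      have c22 := c2.mul A c2
      obtain ⟨M, hM⟩ := c22.base
      refine c22.inv A (fun z hz => ?_) (hM.inv (mul_pos hδ hδ) fun z hz => ?_)
      · have := X.lo z hz; have : 0 < h2 z := by linarith
        positivity
      · exact mul_self_le_mul_self hδ.le (X.lo z hz)
    have cg := (((cc.add A ((((Cq.const A (2 * g * ρ0)).mul A c0).add A (Cq.const A (-Q))).mul A (c2.mul A c2))).mul A
      (cs.mul A cc)).mul A ci).mul A (Cq.const A (1 / (2 * σ)))
    have key := linCq X.hp X.hμ X.hμ1 hlam hcof (k + 1) (c2.mul A c2) ((Cq.const A (-2)).mul A (c2.mul A c1)) cc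
      (U := ![h11, h12, h22]) (X.cqF A c0 c2 X.bβ X.bρ) cg X.g1 X.g2
      (fun i => by fin_cases i; exacts [X.b11, X.b12, X.b22]) X.pde X.bot11
      (fun x => by
        have t1 := X.top x
        have t2 := X.lo (x, 0) ⟨X.hp.le, le_rfl⟩
        have h3 := X.hδ
        have h4 := X.hσ
        rw [← t1]
        have : h2 (x, 0) ≠ 0 := by intro h; rw [h] at t2; linarith
        simp only [Matrix.cons_val_zero]
        field_simp)
    exact ⟨key 0, key 1, key 2⟩
end

lemma Cq.imp {Pr Pr' : (ℝ × ℝ → ℝ) → Prop} (hi : ∀ f, Pr f → Pr' f) {k : ℕ} :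
    ∀ {f : ℝ × ℝ → ℝ}, Cq p0 Pr k f → Cq p0 Pr' k f := by
  induction k with
  | zero => exact fun h => hi _ h
  | succ k ih => exact fun ⟨h, f', h1, h2⟩ => ⟨hi _ h, f', h1, ih h2⟩

abbrev FC (p0 : ℝ) (n : ℕ) : (ℝ × ℝ → ℝ) → Prop := fun f => ContDiffOn ℝ n f (Strip p0)

lemma algC (n : ℕ) : Alg p0 (FC p0 n) where
  const _ := contDiffOn_const
  add := fun _ _ hf hg => hf.add hg
  mul := fun _ _ hf hg => hf.mul hg
  congr := fun _ _ hf h => hf.congr fun z hz => (h z hz).symm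

lemma grad_cd (hp0 : p0 < 0) {n : ℕ} {f f1 f2 : ℝ × ℝ → ℝ} (hg : Grad (Strip p0) f f1 f2)
    (h1 : ContDiffOn ℝ n f1 (Strip p0)) (h2 : ContDiffOn ℝ n f2 (Strip p0)) :
    ContDiffOn ℝ (n + 1 : ℕ) f (Strip p0) := by
  push_cast
  rw [contDiffOn_succ_iff_fderivWithin (strip_ud hp0)]
  refine ⟨fun z hz => (hg z hz).differentiableWithinAt, by simp, ?_⟩
  have : ContDiffOn ℝ n (fun z => L2 (f1 z) (f2 z)) (Strip p0) := by
    unfold L2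
    exact (h1.smul contDiffOn_const).add (h2.smul contDiffOn_const)
  exact this.congr fun z hz => (hg z hz).fderivWithin (strip_ud hp0 z hz)

lemma grad_cq (hp0 : p0 < 0) (hμ : 0 < μ) {n : ℕ} (k : ℕ) : ∀ {f f1 f2 : ℝ × ℝ → ℝ}, Grad (Strip p0) f f1 f2 →
    (∀ k, Cq p0 (FB p0 μ) k f1) → (∀ k, Cq p0 (FB p0 μ) k f2) →
    (∀ k, Cq p0 (FC p0 n) k f1) → (∀ k, Cq p0 (FC p0 n) k f2) → Cq p0 (FC p0 (n + 1)) k f := by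
  have A := algB (p0 := p0) (μ := μ)
  have AC := algC (p0 := p0) n
  induction k with
  | zero => exact fun hg _ _ c1 c2 => grad_cd hp0 hg (c1 0) (c2 0)
  | succ k ih =>
    intro f f1 f2 hg b1 b2 c1 c2
    refine ⟨grad_cd hp0 hg (c1 0) (c2 0), f1, hg.rowD, ?_⟩
    obtain ⟨-, f1', r1, e1⟩ := b1 1
    obtain ⟨-, f2', r2, e2⟩ := b2 1
    obtain ⟨M1, hM1⟩ := e1
    obtain ⟨M2, hM2⟩ := e2
    have g' := hg.row hp0 hμ (M := max M1 M2) r1 r2 (hM1.mono (le_max_left _ _)) (hM2.mono (le_max_right _ _))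
    exact ih g' (fun k => (b1 (k + 1)).row A r1) (fun k => (b2 (k + 1)).row A r2)
      (fun k => (c1 (k + 1)).row AC r1) (fun k => (c2 (k + 1)).row AC r2)

lemma Cq.iter (hp0 : p0 < 0) {Pr : (ℝ × ℝ → ℝ) → Prop} (A : Alg p0 Pr) (k : ℕ) : ∀ {f : ℝ × ℝ → ℝ},
    Cq p0 Pr k f → ContDiffOn ℝ (⊤ : ℕ∞) f (Strip p0) → Pr ((dq p0)^[k] f) := by
  induction k with
  | zero => exact fun h _ => h
  | succ k ih =>
    intro f h hs
    rw [Function.iterate_succ_apply]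
    refine ih (h.row A (grad_of_diff (hs.differentiableOn (by simp))).rowD) (dv_cd hp0 (m := (⊤ : ℕ∞)) ?_)
    simpa using hs

section
variable {g d σ Q δ₁ ρ0 : ℝ} {β ρ' : ℝ → ℝ} {h h1 h2 h11 h12 h22 : ℝ × ℝ → ℝ}
variable (X : Sol p0 μ g d σ Q δ₁ ρ0 β ρ' h h1 h2 h11 h12 h22)
include X

lemma Sol.cqC (n : ℕ) : (∀ k, Cq p0 (FC p0 n) k h) ∧ (∀ k, Cq p0 (FC p0 n) k h1) ∧ (∀ k, Cq p0 (FC p0 n) k h2) ∧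
    (∀ k, Cq p0 (FC p0 n) k h11) ∧ (∀ k, Cq p0 (FC p0 n) k h12) ∧ (∀ k, Cq p0 (FC p0 n) k h22) := by
  have c11 := fun k => (X.cqB k).1
  have c12 := fun k => (X.cqB k).2.1
  have c22 := fun k => (X.cqB k).2.2
  have c1 : ∀ k, Cq p0 (FB p0 μ) k h1 := fun k => Cq.down ⟨X.b1, h11, X.g1.rowD, c11 k⟩
  have c2 : ∀ k, Cq p0 (FB p0 μ) k h2 := fun k => Cq.down ⟨X.b2, h12, X.g2.rowD, c12 k⟩
  have c0 : ∀ k, Cq p0 (FB p0 μ) k h := fun k => Cq.down ⟨X.b0, h1, X.g0.rowD, c1 k⟩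
  induction n with
  | zero =>
    have hi : ∀ f, FB p0 μ f → FC p0 0 f := fun f ⟨M, hM⟩ => contDiffOn_zero.2 (hM.cont X.hμ)
    exact ⟨fun k => (c0 k).imp hi, fun k => (c1 k).imp hi, fun k => (c2 k).imp hi, fun k => (c11 k).imp hi,
      fun k => (c12 k).imp hi, fun k => (c22 k).imp hi⟩
  | succ n ih =>
    obtain ⟨e0, e1, e2, e11, e12, e22⟩ := ih
    have A := algC (p0 := p0) (n + 1)
    have f0 : ∀ k, Cq p0 (FC p0 (n + 1)) k h := fun k => grad_cq X.hp X.hμ k X.g0 c1 c2 e1 e2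
    have f1 : ∀ k, Cq p0 (FC p0 (n + 1)) k h1 := fun k => grad_cq X.hp X.hμ k X.g1 c11 c12 e11 e12
    have f2 : ∀ k, Cq p0 (FC p0 (n + 1)) k h2 := fun k => grad_cq X.hp X.hμ k X.g2 c12 c22 e12 e22
    have f11 : ∀ k, Cq p0 (FC p0 (n + 1)) k h11 := fun k => (f1 (k + 1)).row A X.g1.rowD
    have f12 : ∀ k, Cq p0 (FC p0 (n + 1)) k h12 := fun k => (f2 (k + 1)).row A X.g2.rowD
    refine ⟨f0, f1, f2, f11, f12, fun k => ?_⟩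
    have pos : ∀ z : ℝ × ℝ, 1 + h1 z * h1 z ≠ 0 := fun z => by nlinarith [mul_self_nonneg (h1 z)]
    have ci := X.invc A (f1 k) ((A.add _ _ (A.const 1) (A.mul _ _ (f1 0) (f1 0))).inv fun z _ => pos z)
    have cF := X.cqF A (f0 k) (f2 k) (X.sβ.of_le (by exact_mod_cast le_top)) (X.sρ.of_le (by exact_mod_cast le_top))
    refine ((ci.mul A (cF.add A ((Cq.const A (-1)).mul A ((((f2 k).mul A (f2 k)).mul A (f11 k)).add A
      (((Cq.const A (-2)).mul A ((f2 k).mul A (f1 k))).mul A (f12 k))))))).congr A fun z hz => ?_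
    rw [← X.pde z hz]
    have := pos z
    field_simp; ring

lemma Sol.smooth : ContDiffOn ℝ (⊤ : ℕ∞) h (Strip p0) ∧ ContDiffOn ℝ (⊤ : ℕ∞) h1 (Strip p0) ∧
    ContDiffOn ℝ (⊤ : ℕ∞) h2 (Strip p0) ∧ ContDiffOn ℝ (⊤ : ℕ∞) h11 (Strip p0) ∧
    ContDiffOn ℝ (⊤ : ℕ∞) h12 (Strip p0) ∧ ContDiffOn ℝ (⊤ : ℕ∞) h22 (Strip p0) :=
  ⟨contDiffOn_infty.2 fun n => (X.cqC n).1 0, contDiffOn_infty.2 fun n => (X.cqC n).2.1 0,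
   contDiffOn_infty.2 fun n => (X.cqC n).2.2.1 0, contDiffOn_infty.2 fun n => (X.cqC n).2.2.2.1 0,
   contDiffOn_infty.2 fun n => (X.cqC n).2.2.2.2.1 0, contDiffOn_infty.2 fun n => (X.cqC n).2.2.2.2.2 0⟩

lemma Sol.bdq (k : ℕ) : FB p0 μ ((dq p0)^[k] h11) ∧ FB p0 μ ((dq p0)^[k] h12) ∧ FB p0 μ ((dq p0)^[k] h22) := by
  obtain ⟨-, -, -, s11, s12, s22⟩ := X.smooth
  exact ⟨(X.cqB k).1.iter X.hp algB k s11, (X.cqB k).2.1.iter X.hp algB k s12, (X.cqB k).2.2.iter X.hp algB k s22⟩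
end

lemma snd_cd {f : ℝ → ℝ} (hf : ContDiffOn ℝ (⊤ : ℕ∞) f (Icc p0 0)) :
    ContDiffOn ℝ (⊤ : ℕ∞) (fun z : ℝ × ℝ => f z.2) (Strip p0) :=
  hf.comp contDiff_snd.contDiffOn fun z hz => hz

lemma snd_grad {f : ℝ → ℝ} (hf : ContDiffOn ℝ (⊤ : ℕ∞) f (Icc p0 0)) :
    Grad (Strip p0) (fun z : ℝ × ℝ => f z.2) (fun _ => 0) (fun z => derivWithin f (Icc p0 0) z.2) := by
  intro z hz
  have h1 : HasDerivWithinAt f (derivWithin f (Icc p0 0) z.2) (Icc p0 0) z.2 :=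
    (hf.differentiableOn (by simp) z.2 hz).hasDerivWithinAt
  have h2 := h1.hasFDerivWithinAt.comp z (hasFDerivWithinAt_snd (s := Strip p0)) (fun w hw => hw)
  refine h2.congr_fderiv ?_
  ext <;> simp

lemma dw_cd (hp0 : p0 < 0) {f : ℝ → ℝ} (hf : ContDiffOn ℝ (⊤ : ℕ∞) f (Icc p0 0)) :
    ContDiffOn ℝ (⊤ : ℕ∞) (derivWithin f (Icc p0 0)) (Icc p0 0) :=
  hf.derivWithin (uniqueDiffOn_Icc hp0) (by simp)

lemma snd_bd (hp0 : p0 < 0) (hμ : 0 < μ) (hμ1 : μ < 1) {f : ℝ → ℝ} (hf : ContDiffOn ℝ (⊤ : ℕ∞) f (Icc p0 0)) :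
    FB p0 μ (fun z => f z.2) := by
  obtain ⟨M1, h1⟩ := isCompact_Icc.exists_bound_of_continuousOn hf.continuousOn
  obtain ⟨M2, h2⟩ := isCompact_Icc.exists_bound_of_continuousOn (dw_cd hp0 hf).continuousOn
  have h0 : 0 ≤ M1 := (norm_nonneg _).trans (h1 0 ⟨hp0.le, le_rfl⟩)
  refine ⟨_, Bd.of_grad hμ hμ1 (M := max M1 M2) (fun z hz => (h1 z.2 hz).trans (le_max_left _ _)) (fun z hz => ?_)
    (fun z hz => (h2 z.2 hz).trans (le_max_right _ _)) (snd_grad hf)⟩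
  simp [h0]

lemma edist2_le (z z' : ℝ × ℝ) : edist2 z z' ≤ 2 * ‖z - z'‖ := by
  have h1 : |z.1 - z'.1| ≤ ‖z - z'‖ := by simpa using norm_fst_le (z - z')
  have h2 : |z.2 - z'.2| ≤ ‖z - z'‖ := by simpa using norm_snd_le (z - z')
  have h0 := norm_nonneg (z - z')
  refine Real.sqrt_le_iff.2 ⟨by positivity, ?_⟩
  rw [← sq_abs (z.1 - z'.1), ← sq_abs (z.2 - z'.2)]
  nlinarith [abs_nonneg (z.1 - z'.1), abs_nonneg (z.2 - z'.2)]

lemma edist2_pos {z z' : ℝ × ℝ} (h : z ≠ z') : 0 < edist2 z z' := by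
  apply Real.sqrt_pos.2
  by_contra hc
  apply h
  ext <;> nlinarith [sq_nonneg (z.1 - z'.1), sq_nonneg (z.2 - z'.2)]

lemma bddS.ex {f : ℝ × ℝ → ℝ} (h : bddS p0 f) : ∃ M, ∀ z ∈ Strip p0, |f z| ≤ M := by
  obtain ⟨M, hM⟩ := h
  exact ⟨M, fun z hz => hM ⟨z, hz, rfl⟩⟩

lemma fb_of (hp0 : p0 < 0) (hμ : 0 < μ) (hμ1 : μ < 1) {f : ℝ × ℝ → ℝ} (hs : bddS p0 f) (hh : bddH p0 μ f) : FB p0 μ f := by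
  obtain ⟨M, hM⟩ := hs.ex
  obtain ⟨H, hH⟩ := hh
  have hM0 : 0 ≤ M := (abs_nonneg _).trans (hM (0, 0) ⟨hp0.le, le_rfl⟩)
  refine ⟨M + 2 * |H|, fun z hz => (hM z hz).trans (by linarith [abs_nonneg H]), fun z hz z' hz' => ?_⟩
  by_cases e : z = z'
  · subst e; rw [sub_self, abs_zero]; positivity
  have h1 := hH ⟨z, hz, z', hz', e, rfl⟩
  rw [div_le_iff₀ (Real.rpow_pos_of_pos (edist2_pos e) _)] at h1
  have h2 : edist2 z z' ^ μ ≤ 2 * ‖z - z'‖ ^ μ := by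
    refine (Real.rpow_le_rpow (edist2_pos e).le (edist2_le z z') hμ.le).trans ?_
    rw [Real.mul_rpow (by norm_num) (norm_nonneg _)]
    refine mul_le_mul_of_nonneg_right ?_ (by positivity)
    exact (Real.rpow_le_rpow_of_exponent_le (by norm_num) hμ1.le).trans (by norm_num)
  have h3 : 0 < edist2 z z' ^ μ := Real.rpow_pos_of_pos (edist2_pos e) _
  have h4 : 0 ≤ ‖z - z'‖ ^ μ := by positivity
  calc _ ≤ H * edist2 z z' ^ μ := h1
    _ ≤ |H| * edist2 z z' ^ μ := mul_le_mul_of_nonneg_right (le_abs_self H) h3.le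
    _ ≤ |H| * (2 * ‖z - z'‖ ^ μ) := mul_le_mul_of_nonneg_left h2 (abs_nonneg H)
    _ ≤ _ := by nlinarith

lemma fb_grad (hμ : 0 < μ) (hμ1 : μ < 1) {f f1 f2 : ℝ × ℝ → ℝ} (h0 : bddS p0 f) (h1 : bddS p0 f1) (h2 : bddS p0 f2)
    (hg : Grad (Strip p0) f f1 f2) : FB p0 μ f := by
  obtain ⟨M0, h0⟩ := h0.ex
  obtain ⟨M1, h1⟩ := h1.ex
  obtain ⟨M2, h2⟩ := h2.ex
  exact ⟨_, Bd.of_grad hμ hμ1 (M := max M0 (max M1 M2)) (fun z hz => (h0 z hz).trans (by simp))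
    (fun z hz => (h1 z hz).trans (by simp)) (fun z hz => (h2 z hz).trans (by simp)) hg⟩

theorem sol_of (d g σ Q δ₁ : ℝ)
    (hp0 : p0 < 0) (hσ : 0 < σ) (hμ : 0 < μ) (hμ1 : μ < 1) (hδ₁ : 0 < δ₁) (β ρ : ℝ → ℝ)
    (hβ : ContDiffOn ℝ (⊤ : ℕ∞) β (Icc p0 0)) (hρ : ContDiffOn ℝ (⊤ : ℕ∞) ρ (Icc p0 0))
    (h : ℝ × ℝ → ℝ) (hreg : MemCk p0 μ 2 h)
    (hpde : ∀ z : ℝ × ℝ, p0 < z.2 → z.2 < 0 →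
      (1 + (pd p0 1 0 h z) ^ 2) * pd p0 0 2 h z
        - 2 * pd p0 0 1 h z * pd p0 1 0 h z * pd p0 1 1 h z
        + (pd p0 0 1 h z) ^ 2 * pd p0 2 0 h z
        - g * (h z - d) * derivWithin ρ (Set.Icc p0 0) z.2 * (pd p0 0 1 h z) ^ 3
        + β z.2 * (pd p0 0 1 h z) ^ 3 = 0)
    (hbc : ∀ q : ℝ,
      1 + (pd p0 1 0 h (q, 0)) ^ 2
        + (2 * g * ρ 0 * h (q, 0)
            - 2 * σ * pd p0 2 0 h (q, 0) / (1 + (pd p0 1 0 h (q, 0)) ^ 2) ^ ((3 : ℝ) / 2)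
            - Q) * (pd p0 0 1 h (q, 0)) ^ 2 = 0)
    (hbed : ∀ q : ℝ, h (q, p0) = 0)
    (hstag : ∀ z ∈ Strip p0, δ₁ ≤ pd p0 0 1 h z) :
    Sol p0 μ g d σ Q δ₁ (ρ 0) β (derivWithin ρ (Icc p0 0)) h (pd p0 1 0 h) (pd p0 0 1 h) (pd p0 2 0 h)
      (pd p0 1 1 h) (pd p0 0 2 h) := by
  obtain ⟨hc, hb, hH⟩ := hreg
  have e00 : pd p0 0 0 h = h := funext (pd_zero h)
  have g0 : Grad (Strip p0) h (pd p0 1 0 h) (pd p0 0 1 h) := by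
    have := pd_grad hp0 0 0 (hc.of_le (by norm_num)); rwa [e00] at this
  have g1 := pd_grad hp0 1 0 hc
  have g2 := pd_grad hp0 0 1 hc
  have bb00 : bddS p0 h := by have := hb 0 0 (by norm_num); rwa [e00] at this
  have c0 := hc.continuousOn
  have c1 := (pd_cd hp0 1 0 0 (hc.of_le (by norm_num))).continuousOn
  have c2 := (pd_cd hp0 0 1 0 (hc.of_le (by norm_num))).continuousOn
  have c11 := (pd_cd hp0 2 0 0 (hc.of_le (by norm_num))).continuousOn
  have c12 := (pd_cd hp0 1 1 0 (hc.of_le (by norm_num))).continuousOn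
  have c22 := (pd_cd hp0 0 2 0 (hc.of_le (by norm_num))).continuousOn
  have cβ := (snd_cd hβ).continuousOn
  have cρ := (snd_cd (dw_cd hp0 hρ)).continuousOn
  refine ⟨hp0, hμ, hμ1, hσ, hδ₁, g0, g1, g2, fb_grad hμ hμ1 bb00 (hb 1 0 (by norm_num)) (hb 0 1 (by norm_num)) g0,
    fb_grad hμ hμ1 (hb 1 0 (by norm_num)) (hb 2 0 (by norm_num)) (hb 1 1 (by norm_num)) g1,
    fb_grad hμ hμ1 (hb 0 1 (by norm_num)) (hb 1 1 (by norm_num)) (hb 0 2 (by norm_num)) g2,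
    fb_of hp0 hμ hμ1 (hb 2 0 (by norm_num)) (hH 2 0 (by norm_num)),
    fb_of hp0 hμ hμ1 (hb 1 1 (by norm_num)) (hH 1 1 (by norm_num)),
    fb_of hp0 hμ hμ1 (hb 0 2 (by norm_num)) (hH 0 2 (by norm_num)), snd_bd hp0 hμ hμ1 hβ,
    snd_bd hp0 hμ hμ1 (dw_cd hp0 hρ), snd_cd hβ, snd_cd (dw_cd hp0 hρ), ?_, fun x => ?_, hbed, hstag⟩
  · have key := Set.EqOn.of_subset_closure (s := {z : ℝ × ℝ | p0 < z.2 ∧ z.2 < 0}) (t := Strip p0)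
      (f := fun z => pd p0 0 1 h z * pd p0 0 1 h z * pd p0 2 0 h z + -2 * (pd p0 0 1 h z * pd p0 1 0 h z) * pd p0 1 1 h z
        + (1 + pd p0 1 0 h z * pd p0 1 0 h z) * pd p0 0 2 h z)
      (g := fun z => ((g * derivWithin ρ (Icc p0 0) z.2) * (h z + -d) + -1 * β z.2) * (pd p0 0 1 h z * pd p0 0 1 h z * pd p0 0 1 h z))
      (fun z hz => by have := hpde z hz.1 hz.2; simp only; linear_combination this)
      (((c2.mul c2).mul c11).add ((continuousOn_const.mul (c2.mul c1)).mul c12) |>.add ((continuousOn_const.add (c1.mul c1)).mul c22))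
      ((((continuousOn_const.mul cρ).mul (c0.add continuousOn_const)).add (continuousOn_const.mul cβ)).mul ((c2.mul c2).mul c2))
      (fun z hz => ⟨hz.1.le, hz.2.le⟩) (strip_cl hp0)
    exact fun z hz => key hz
  · have k := hbc x
    set a := pd p0 1 0 h (x, 0)
    have hw : 0 < 1 + a * a := by nlinarith [mul_self_nonneg a]
    have e : (1 + a ^ 2) ^ ((3 : ℝ) / 2) = √(1 + a * a) * (1 + a * a) := by
      rw [show (3:ℝ)/2 = 1/2 + 1 by norm_num, show 1 + a ^ 2 = 1 + a * a by ring, Real.rpow_add hw, Real.rpow_one, Real.sqrt_eq_rpow]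
    rw [e] at k
    have hs : 0 < √(1 + a * a) := Real.sqrt_pos.2 hw
    field_simp at k
    rw [show 1 + a * a = 1 + a ^ 2 by ring]
    linear_combination (-1) * k

abbrev Sm (p0 : ℝ) (f : ℝ × ℝ → ℝ) : Prop := ContDiffOn ℝ (⊤ : ℕ∞) f (Strip p0)

lemma Sm.dv (hp0 : p0 < 0) {f : ℝ × ℝ → ℝ} (h : Sm p0 f) (v : ℝ × ℝ) : Sm p0 (dv p0 v f) :=
  dv_cd hp0 (m := (⊤ : ℕ∞)) (by simpa using h)

lemma Sm.diff {f : ℝ × ℝ → ℝ} (h : Sm p0 f) : DifferentiableOn ℝ f (Strip p0) :=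
  ContDiffOn.differentiableOn h (by simp)

lemma Sm.two {f : ℝ × ℝ → ℝ} (h : Sm p0 f) : ContDiffOn ℝ 2 f (Strip p0) :=
  ContDiffOn.of_le h (by rw [show (2 : WithTop ℕ∞) = ((2 : ℕ∞) : WithTop ℕ∞) from rfl]; exact WithTop.coe_le_coe.2 le_top)

lemma dv_add (hp0 : p0 < 0) {f g : ℝ × ℝ → ℝ} (hf : Sm p0 f) (hg : Sm p0 g) (v : ℝ × ℝ) :
    ∀ z ∈ Strip p0, dv p0 v (fun z => f z + g z) z = dv p0 v f z + dv p0 v g z := by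
  intro z hz
  rw [dv, fderivWithin_fun_add (strip_ud hp0 z hz) (hf.diff z hz) (hg.diff z hz)]; rfl

lemma dv_mul (hp0 : p0 < 0) {f g : ℝ × ℝ → ℝ} (hf : Sm p0 f) (hg : Sm p0 g) (v : ℝ × ℝ) :
    ∀ z ∈ Strip p0, dv p0 v (fun z => f z * g z) z = dv p0 v f z * g z + f z * dv p0 v g z := by
  intro z hz
  rw [dv, fderivWithin_fun_mul (strip_ud hp0 z hz) (hf.diff z hz) (hg.diff z hz)]
  simp [dv]; ring

section words
variable {V : Type} (e : V → ℝ × ℝ)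

def Dw (p0 : ℝ) : List V → (ℝ × ℝ → ℝ) → ℝ × ℝ → ℝ
  | [], f => f
  | v :: w, f => Dw p0 w (dv p0 (e v) f)

variable {e}

lemma Dw_congr (w : List V) : ∀ {f g : ℝ × ℝ → ℝ}, (∀ z ∈ Strip p0, f z = g z) →
    ∀ z ∈ Strip p0, Dw e p0 w f z = Dw e p0 w g z := by
  induction w with
  | nil => exact fun h => h
  | cons v w ih => exact fun h => ih (dv_congr h)

lemma Dw_sm (hp0 : p0 < 0) (w : List V) : ∀ {f : ℝ × ℝ → ℝ}, Sm p0 f → Sm p0 (Dw e p0 w f) := by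
  induction w with
  | nil => exact fun h => h
  | cons v w ih => exact fun h => ih (h.dv hp0 _)

lemma Dw_add (hp0 : p0 < 0) (w : List V) : ∀ {f g : ℝ × ℝ → ℝ}, Sm p0 f → Sm p0 g →
    ∀ z ∈ Strip p0, Dw e p0 w (fun z => f z + g z) z = Dw e p0 w f z + Dw e p0 w g z := by
  induction w with
  | nil => exact fun _ _ z _ => rfl
  | cons v w ih =>
    exact fun hf hg z hz => (Dw_congr w (dv_add hp0 hf hg _) z hz).trans (ih (hf.dv hp0 _) (hg.dv hp0 _) z hz)

lemma Dw_zero (w : List V) : ∀ z, Dw e p0 w (fun _ => 0) z = 0 := by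
  induction w with
  | nil => exact fun z => rfl
  | cons v w ih =>
    intro z
    have : dv p0 (e v) (fun _ => (0:ℝ)) = fun _ => 0 := by funext z; simp [dv]
    rw [Dw, this]; exact ih z

lemma Dw_dv (hp0 : p0 < 0) (u : ℝ × ℝ) (w : List V) : ∀ {f : ℝ × ℝ → ℝ}, Sm p0 f →
    ∀ z ∈ Strip p0, dv p0 u (Dw e p0 w f) z = Dw e p0 w (dv p0 u f) z := by
  induction w with
  | nil => exact fun _ z _ => rfl
  | cons v w ih =>
    intro f hf z hz
    exact (ih (hf.dv hp0 _) z hz).trans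
      (Dw_congr w (dv_comm2 hp0 _ _ hf.two) z hz)

lemma Dw_perm (hp0 : p0 < 0) {w w' : List V} (hw : w.Perm w') : ∀ {f : ℝ × ℝ → ℝ}, Sm p0 f →
    ∀ z ∈ Strip p0, Dw e p0 w f z = Dw e p0 w' f z := by
  induction hw with
  | nil => exact fun _ z _ => rfl
  | cons v _ ih => exact fun hf => ih (hf.dv hp0 _)
  | swap u v w =>
    exact fun hf => Dw_congr w (dv_comm2 hp0 _ _ hf.two)
  | trans _ _ h1 h2 => exact fun hf z hz => (h1 hf z hz).trans (h2 hf z hz)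

def wt (ω : V → ℝ) (w : List V) : ℝ := (w.map ω).prod

lemma wt_nil (ω : V → ℝ) : wt ω [] = 1 := rfl
lemma wt_cons (ω : V → ℝ) (v : V) (w : List V) : wt ω (v :: w) = ω v * wt ω w := by simp [wt]

lemma wt_nonneg {ω : V → ℝ} (h : ∀ v, 0 ≤ ω v) (w : List V) : 0 ≤ wt ω w := by
  induction w with
  | nil => simp [wt]
  | cons v w ih => rw [wt_cons]; exact mul_nonneg (h v) ih

structure Nm (p0 : ℝ) (B : ℝ → (ℝ × ℝ → ℝ) → Prop) : Prop where
  mono : ∀ {M N f}, B M f → M ≤ N → B N f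
  congr : ∀ {M f g}, B M f → (∀ z ∈ Strip p0, f z = g z) → B M g
  add : ∀ {M N f g}, B M f → B N g → B (M + N) (fun z => f z + g z)
  mul : ∀ {M N f g}, B M f → B N g → B (2 * (M * N)) (fun z => f z * g z)
  const : ∀ c : ℝ, B |c| (fun _ => c)
  nonneg : ∀ {M f}, B M f → 0 ≤ M

lemma Nm.sub {B : ℝ → (ℝ × ℝ → ℝ) → Prop} (A : Nm p0 B) {M N : ℝ} {f g : ℝ × ℝ → ℝ} (hf : B M f) (hg : B N g) :
    B (M + 2 * N) (fun z => f z - g z) := by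
  have h1 := A.add hf (A.mul (A.const (-1)) hg)
  refine A.congr (A.mono h1 (by simp)) fun z _ => by ring

def T (p0 : ℝ) (B : ℝ → (ℝ × ℝ → ℝ) → Prop) (e : V → ℝ × ℝ) (ω : V → ℝ) (N : ℕ) (φ : ℕ → ℝ) (f : ℝ × ℝ → ℝ) : Prop :=
  ∀ w : List V, w.length < N → B (wt ω w * φ w.length) (Dw e p0 w f)

def conv (φ ψ : ℕ → ℝ) (n : ℕ) : ℝ :=
  2 * ∑ ij ∈ Finset.HasAntidiagonal.antidiagonal n, (n.choose ij.1 : ℝ) * (φ ij.1 * ψ ij.2)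

lemma conv_succ (φ ψ : ℕ → ℝ) (n : ℕ) (t : ℝ) :
    conv (fun k => t * φ (k + 1)) ψ n + conv φ (fun k => t * ψ (k + 1)) n = t * conv φ ψ (n + 1) := by
  unfold conv
  have h1 : ∑ ij ∈ Finset.HasAntidiagonal.antidiagonal n, (n.choose ij.1 : ℝ) * (t * φ (ij.1 + 1) * ψ ij.2) =
      t * ∑ ij ∈ Finset.HasAntidiagonal.antidiagonal n, (n.choose ij.2 : ℝ) * (φ (ij.1 + 1) * ψ ij.2) := by
    rw [Finset.mul_sum]
    refine Finset.sum_congr rfl fun ij h => ?_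
    rw [Nat.choose_symm_of_eq_add (Finset.HasAntidiagonal.mem_antidiagonal.1 h).symm]; ring
  have h2 : ∑ ij ∈ Finset.HasAntidiagonal.antidiagonal n, (n.choose ij.1 : ℝ) * (φ ij.1 * (t * ψ (ij.2 + 1))) =
      t * ∑ ij ∈ Finset.HasAntidiagonal.antidiagonal n, (n.choose ij.1 : ℝ) * (φ ij.1 * ψ (ij.2 + 1)) := by
    rw [Finset.mul_sum]
    refine Finset.sum_congr rfl fun ij h => by ring
  rw [Finset.sum_antidiagonal_choose_succ_mul (fun i j => φ i * ψ j), h1, h2]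
  ring

variable {B : ℝ → (ℝ × ℝ → ℝ) → Prop} {ω : V → ℝ}

lemma T.step {N : ℕ} {φ : ℕ → ℝ} {f : ℝ × ℝ → ℝ} (h : T p0 B e ω (N + 1) φ f) (v : V) :
    T p0 B e ω N (fun k => ω v * φ (k + 1)) (dv p0 (e v) f) := by
  intro w hw
  have := h (v :: w) (by simpa using hw)
  rw [wt_cons] at this
  rw [show wt ω w * (ω v * φ (w.length + 1)) = ω v * wt ω w * φ (w.length + 1) by ring]
  exact this

lemma T.le {N N' : ℕ} {φ : ℕ → ℝ} {f : ℝ × ℝ → ℝ} (h : T p0 B e ω N φ f) (hN : N' ≤ N) :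
    T p0 B e ω N' φ f := fun w hw => h w (hw.trans_le hN)

lemma T.mono (A : Nm p0 B) (hω : ∀ v, 0 ≤ ω v) {N : ℕ} {φ ψ : ℕ → ℝ} {f : ℝ × ℝ → ℝ} (h : T p0 B e ω N φ f)
    (hN : ∀ k < N, φ k ≤ ψ k) : T p0 B e ω N ψ f :=
  fun w hw => A.mono (h w hw) (mul_le_mul_of_nonneg_left (hN _ hw) (wt_nonneg hω w))

lemma T.congr (A : Nm p0 B) {N : ℕ} {φ : ℕ → ℝ} {f g : ℝ × ℝ → ℝ} (h : T p0 B e ω N φ f)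
    (hfg : ∀ z ∈ Strip p0, f z = g z) : T p0 B e ω N φ g :=
  fun w hw => A.congr (h w hw) (Dw_congr w hfg)

lemma T.add (A : Nm p0 B) (hp0 : p0 < 0) {N : ℕ} {φ ψ : ℕ → ℝ} {f g : ℝ × ℝ → ℝ} (hf : T p0 B e ω N φ f)
    (hg : T p0 B e ω N ψ g) (sf : Sm p0 f) (sg : Sm p0 g) :
    T p0 B e ω N (fun k => φ k + ψ k) (fun z => f z + g z) := by
  intro w hw
  rw [mul_add]
  exact A.congr (A.add (hf w hw) (hg w hw)) fun z hz => (Dw_add hp0 w sf sg z hz).symm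

lemma Dw_mul_bd (A : Nm p0 B) (hp0 : p0 < 0) (w : List V) : ∀ {φ ψ : ℕ → ℝ} {f g : ℝ × ℝ → ℝ},
    T p0 B e ω (w.length + 1) φ f → T p0 B e ω (w.length + 1) ψ g → Sm p0 f → Sm p0 g →
    B (wt ω w * conv φ ψ w.length) (Dw e p0 w (fun z => f z * g z)) := by
  induction w with
  | nil =>
    intro φ ψ f g hf hg _ _
    refine A.mono (A.mul (hf [] (by simp)) (hg [] (by simp))) (by simp [wt, conv])
  | cons v w ih =>
    intro φ ψ f g hf hg sf sg
    have h1 := A.add (ih (hf.step v) (hg.le (by simp)) (sf.dv hp0 (e v)) sg)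
      (ih (hf.le (by simp)) (hg.step v) sf (sg.dv hp0 (e v)))
    rw [← mul_add, conv_succ, ← mul_assoc, mul_comm (wt ω w), ← wt_cons] at h1
    refine A.congr h1 fun z hz => ?_
    rw [← Dw_add hp0 w ((sf.dv hp0 _).mul sg) (sf.mul (sg.dv hp0 _)) z hz]
    exact (Dw_congr w (dv_mul hp0 sf sg (e v)) z hz).symm

lemma T.mul (A : Nm p0 B) (hp0 : p0 < 0) {N : ℕ} {φ ψ : ℕ → ℝ} {f g : ℝ × ℝ → ℝ} (hf : T p0 B e ω N φ f)
    (hg : T p0 B e ω N ψ g) (sf : Sm p0 f) (sg : Sm p0 g) :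
    T p0 B e ω N (conv φ ψ) (fun z => f z * g z) :=
  fun w hw => Dw_mul_bd A hp0 w (hf.le hw) (hg.le hw) sf sg

def cut (φ : ℕ → ℝ) (k : ℕ) : ℝ := if k = 0 then 0 else φ k

lemma Dw_comm_bd (A : Nm p0 B) (hp0 : p0 < 0) (w : List V) : ∀ {φ ψ : ℕ → ℝ} {f g : ℝ × ℝ → ℝ},
    T p0 B e ω (w.length + 1) φ f → T p0 B e ω w.length ψ g → Sm p0 f → Sm p0 g →
    B (wt ω w * conv (cut φ) ψ w.length) (fun z => Dw e p0 w (fun z => f z * g z) z - f z * Dw e p0 w g z) := by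
  induction w with
  | nil =>
    intro φ ψ f g hf hg _ _
    refine A.mono (A.congr (A.const 0) fun z _ => ?_) (by simp [wt, conv, cut])
    simp [Dw]
  | cons v w ih =>
    intro φ ψ f g hf hg sf sg
    have h1 := A.add (Dw_mul_bd A hp0 w (hf.step v) hg (sf.dv hp0 (e v)) sg)
      (ih (hf.le (by simp)) (hg.step v) sf (sg.dv hp0 (e v)))
    have e1 : (fun k => ω v * φ (k + 1)) = fun k => ω v * cut φ (k + 1) := by funext k; simp [cut]
    rw [e1, ← mul_add, conv_succ, ← mul_assoc, mul_comm (wt ω w), ← wt_cons] at h1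
    refine A.congr h1 fun z hz => ?_
    have h2 := Dw_add (e := e) hp0 w ((sf.dv hp0 (e v)).mul sg) (sf.mul (sg.dv hp0 (e v))) z hz
    have h3 := Dw_congr (e := e) w (dv_mul hp0 sf sg (e v)) z hz
    simp only [Dw]
    rw [h3, h2]; ring

end words

/-! numeric weights -/

def mm (s : ℝ) (n : ℕ) : ℝ := (n.factorial : ℝ) ^ s / ((n : ℝ) + 1) ^ 2

lemma mm_pos (s : ℝ) (n : ℕ) : 0 < mm s n := by
  have : (0:ℝ) < n.factorial := by exact_mod_cast n.factorial_pos
  unfold mm; positivity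

lemma mm_zero (s : ℝ) : mm s 0 = 1 := by simp [mm]

lemma mm_succ {s : ℝ} (hs : 1 ≤ s) (n : ℕ) : mm s n ≤ 4 * mm s (n + 1) := by
  have h1 : (n.factorial : ℝ) ^ s ≤ ((n + 1).factorial : ℝ) ^ s :=
    Real.rpow_le_rpow (by positivity) (by exact_mod_cast Nat.factorial_le (by omega)) (by linarith)
  have h0 : (0:ℝ) ≤ (n.factorial : ℝ) ^ s := by positivity
  unfold mm
  rw [← mul_div_assoc, div_le_div_iff₀ (by positivity) (by positivity)]
  push_cast
  have hn : (0:ℝ) ≤ n := by positivity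
  have h2 : ((n:ℝ) + 1 + 1) ^ 2 ≤ 4 * ((n:ℝ) + 1) ^ 2 := by nlinarith
  calc _ ≤ (n.factorial : ℝ) ^ s * (4 * ((n:ℝ) + 1) ^ 2) := mul_le_mul_of_nonneg_left h2 h0
    _ ≤ ((n + 1).factorial : ℝ) ^ s * (4 * ((n:ℝ) + 1) ^ 2) := mul_le_mul_of_nonneg_right h1 (by positivity)
    _ = _ := by ring

lemma sum_sq (n : ℕ) : ∑ i ∈ Finset.range (n + 1), 1 / ((i : ℝ) + 1) ^ 2 ≤ 2 - 1 / ((n : ℝ) + 1) := by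
  induction n with
  | zero => norm_num
  | succ n ih =>
    rw [Finset.sum_range_succ]
    have : 1 / (((n + 1 : ℕ) : ℝ) + 1) ^ 2 ≤ 1 / ((n:ℝ) + 1) - 1 / (((n + 1 : ℕ) : ℝ) + 1) := by
      push_cast
      rw [div_sub_div _ _ (by positivity) (by positivity), div_le_div_iff₀ (by positivity) (by positivity)]
      nlinarith [(by positivity : (0:ℝ) ≤ n)]
    linarith

lemma mm_mul {s : ℝ} (hs : 1 ≤ s) {i j n : ℕ} (h : i + j = n) : (n.choose i : ℝ) * (mm s i * mm s j) ≤
    mm s n * (4 * (1 / ((i : ℝ) + 1) ^ 2 + 1 / ((j : ℝ) + 1) ^ 2)) := by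
  have hc : ((n.choose i : ℝ)) * (i.factorial * j.factorial) = n.factorial := by
    have := Nat.choose_mul_factorial_mul_factorial (show i ≤ n by omega)
    rw [show n - i = j by omega] at this
    rw [← mul_assoc]; exact_mod_cast this
  have c1 : (1:ℝ) ≤ n.choose i := by exact_mod_cast Nat.choose_pos (show i ≤ n by omega)
  have h1 : (n.choose i : ℝ) * ((i.factorial : ℝ) ^ s * (j.factorial : ℝ) ^ s) ≤ (n.factorial : ℝ) ^ s := by
    rw [← hc, Real.mul_rpow (by positivity) (by positivity), Real.mul_rpow (by positivity) (by positivity)]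
    refine mul_le_mul_of_nonneg_right ?_ (by positivity)
    simpa using Real.rpow_le_rpow_of_exponent_le c1 hs
  have hn : (n : ℝ) = i + j := by rw [← h]; push_cast; ring
  have h2 : 1 / (((i:ℝ) + 1) ^ 2 * ((j:ℝ) + 1) ^ 2) ≤ (1 / ((n:ℝ) + 1) ^ 2) * (4 * (1 / ((i : ℝ) + 1) ^ 2 + 1 / ((j : ℝ) + 1) ^ 2)) := by
    have : (1 / ((n:ℝ) + 1) ^ 2) * (4 * (1 / ((i : ℝ) + 1) ^ 2 + 1 / ((j : ℝ) + 1) ^ 2)) =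
      (4 * (((i : ℝ) + 1) ^ 2 + ((j : ℝ) + 1) ^ 2) / ((n:ℝ) + 1) ^ 2) * (1 / (((i:ℝ) + 1) ^ 2 * ((j:ℝ) + 1) ^ 2)) := by
      field_simp; ring
    rw [this]
    refine le_mul_of_one_le_left (by positivity) ?_
    rw [le_div_iff₀ (by positivity), hn]
    nlinarith [sq_nonneg ((i:ℝ) - j), (by positivity : (0:ℝ) ≤ i), (by positivity : (0:ℝ) ≤ j)]
  unfold mm
  calc _ = ((n.choose i : ℝ) * ((i.factorial : ℝ) ^ s * (j.factorial : ℝ) ^ s)) * (1 / (((i:ℝ) + 1) ^ 2 * ((j:ℝ) + 1) ^ 2)) := by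
        field_simp
    _ ≤ (n.factorial : ℝ) ^ s * ((1 / ((n:ℝ) + 1) ^ 2) * (4 * (1 / ((i : ℝ) + 1) ^ 2 + 1 / ((j : ℝ) + 1) ^ 2))) :=
        mul_le_mul h1 h2 (by positivity) (by positivity)
    _ = _ := by ring

lemma mm_conv {s : ℝ} (hs : 1 ≤ s) (n : ℕ) :
    ∑ ij ∈ Finset.HasAntidiagonal.antidiagonal n, (n.choose ij.1 : ℝ) * (mm s ij.1 * mm s ij.2) ≤ 16 * mm s n := by
  refine (Finset.sum_le_sum fun ij h => mm_mul hs (Finset.HasAntidiagonal.mem_antidiagonal.1 h)).trans ?_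
  rw [← Finset.mul_sum, ← Finset.mul_sum, Finset.sum_add_distrib]
  have e1 : ∑ ij ∈ Finset.HasAntidiagonal.antidiagonal n, 1 / ((ij.1 : ℝ) + 1) ^ 2 ≤ 2 := by
    rw [Finset.Nat.sum_antidiagonal_eq_sum_range_succ (fun i _ => 1 / ((i : ℝ) + 1) ^ 2)]
    exact (sum_sq n).trans (by have : (0:ℝ) ≤ 1 / ((n:ℝ) + 1) := by positivity
                               linarith)
  have e2 : ∑ ij ∈ Finset.HasAntidiagonal.antidiagonal n, 1 / ((ij.2 : ℝ) + 1) ^ 2 ≤ 2 := by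
    rw [← Finset.Nat.sum_antidiagonal_swap]; exact e1
  nlinarith [mm_pos s n]

lemma conv_le {s c : ℝ} (hs : 1 ≤ s) {φ ψ : ℕ → ℝ} {n : ℕ} (hc : 0 ≤ c)
    (h : ∀ i j, i + j = n → φ i * ψ j ≤ c * (mm s i * mm s j)) : conv φ ψ n ≤ 32 * c * mm s n := by
  unfold conv
  have h1 : ∑ ij ∈ Finset.HasAntidiagonal.antidiagonal n, (n.choose ij.1 : ℝ) * (φ ij.1 * ψ ij.2) ≤
      c * ∑ ij ∈ Finset.HasAntidiagonal.antidiagonal n, (n.choose ij.1 : ℝ) * (mm s ij.1 * mm s ij.2) := by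
    rw [Finset.mul_sum]
    refine Finset.sum_le_sum fun ij hij => ?_
    rw [mul_left_comm c]
    exact mul_le_mul_of_nonneg_left (h _ _ (Finset.HasAntidiagonal.mem_antidiagonal.1 hij)) (by positivity)
  have h2 := mul_le_mul_of_nonneg_left (mm_conv hs n) hc
  linarith

def pe (s ε : ℝ) (k : ℕ) : ℝ := (if k = 0 then 1 else ε) * mm s k

lemma pe_zero (s ε : ℝ) : pe s ε 0 = 1 := by simp [pe, mm_zero]
lemma pe_pos (s ε : ℝ) {k : ℕ} (hk : k ≠ 0) : pe s ε k = ε * mm s k := by simp [pe, hk]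
lemma pe_nonneg (s : ℝ) {ε : ℝ} (h : 0 < ε) (k : ℕ) : 0 ≤ pe s ε k := by
  unfold pe; have := (mm_pos s k).le; split_ifs <;> positivity
lemma pe_le (s : ℝ) {ε : ℝ} (h : ε ≤ 1) (k : ℕ) : pe s ε k ≤ mm s k := by
  unfold pe; have := (mm_pos s k).le; split_ifs <;> nlinarith

lemma pe_conv {s ε : ℝ} (hs : 1 ≤ s) (h0 : 0 < ε) (h1 : ε ≤ 1) {a b : ℝ} (ha : 0 ≤ a) (hb : 0 ≤ b) (n : ℕ) :
    conv (fun k => a * pe s ε k) (fun k => b * pe s ε k) n ≤ 32 * (a * b) * pe s ε n := by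
  have hab : 0 ≤ a * b := mul_nonneg ha hb
  rcases Nat.eq_zero_or_pos n with rfl | hn
  · rw [pe_zero, ← mm_zero s]
    refine conv_le hs hab fun i j h => ?_
    obtain ⟨rfl, rfl⟩ : i = 0 ∧ j = 0 := by omega
    simp [pe_zero, mm_zero]
  · rw [pe_pos s ε hn.ne', ← mul_assoc, show 32 * (a * b) * ε = 32 * (a * b * ε) by ring]
    refine conv_le hs (mul_nonneg hab h0.le) fun i j h => ?_
    rw [show a * pe s ε i * (b * pe s ε j) = a * b * (pe s ε i * pe s ε j) by ring,
      show a * b * ε * (mm s i * mm s j) = a * b * (ε * (mm s i * mm s j)) by ring]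
    refine mul_le_mul_of_nonneg_left ?_ hab
    have p1 := mm_pos s i
    have p2 := mm_pos s j
    by_cases hi : i = 0
    · rw [pe_pos s ε (show j ≠ 0 by omega)]
      have := mul_le_mul_of_nonneg_right (pe_le s h1 i) (mul_nonneg h0.le p2.le)
      linarith
    · rw [pe_pos s ε hi]
      have := mul_le_mul_of_nonneg_left (pe_le s h1 j) (mul_nonneg h0.le p1.le)
      linarith

section
variable {V : Type} {e : V → ℝ × ℝ} {B : ℝ → (ℝ × ℝ → ℝ) → Prop} {ω : V → ℝ} {s : ℝ}

lemma om_nonneg {ε : ℝ} (h0 : 0 < ε) (hω : ∀ v, 1 ≤ ε * ω v) (v : V) : 0 ≤ ω v := by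
  have := hω v
  by_contra hc
  push Not at hc
  nlinarith

lemma T.int (A : Nm p0 B) (hs : 1 ≤ s) {ε : ℝ} (h0 : 0 < ε) (hω : ∀ v, 1 ≤ ε * ω v) {a b : ℝ} {N : ℕ} {f : ℝ × ℝ → ℝ}
    (hb : 0 ≤ b) (hf : B a f) (hv : ∀ v, T p0 B e ω N (fun k => b * mm s k) (dv p0 (e v) f)) :
    T p0 B e ω (N + 1) (fun k => max a (4 * b) * pe s ε k) f := by
  intro w hw
  cases w with
  | nil => exact A.mono hf (by simp [wt, pe_zero])
  | cons v w =>
    refine A.mono (hv v w (by simpa using hw)) ?_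
    beta_reduce
    rw [wt_cons, List.length_cons, pe_pos s ε (Nat.succ_ne_zero _)]
    have h1 := mm_succ hs w.length
    have h2 := wt_nonneg (om_nonneg h0 hω) w
    have h3 := mm_pos s (w.length + 1)
    calc wt ω w * (b * mm s w.length) ≤ wt ω w * (b * (4 * mm s (w.length + 1))) := by gcongr
      _ = 1 * (wt ω w * (4 * b * mm s (w.length + 1))) := by ring
      _ ≤ (ε * ω v) * (wt ω w * (max a (4 * b) * mm s (w.length + 1))) := by
        gcongr
        · linarith [hω v]
        · exact hω v
        · exact le_max_right _ _
      _ = _ := by ring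

def UT (p0 s : ℝ) (B : ℝ → (ℝ × ℝ → ℝ) → Prop) (e : V → ℝ × ℝ) (Pm : ℕ → ℝ → (V → ℝ) → Prop) (f : ℝ × ℝ → ℝ) : Prop :=
  Sm p0 f ∧ ∃ C, 0 ≤ C ∧ ∀ N ε ω, Pm N ε ω → T p0 B e ω (N + 1) (fun k => C * pe s ε k) f

def Adm (Pm : ℕ → ℝ → (V → ℝ) → Prop) : Prop := ∀ N ε ω, Pm N ε ω → 0 < ε ∧ ε ≤ 1 ∧ ∀ v, 1 ≤ ε * ω v

variable {Pm : ℕ → ℝ → (V → ℝ) → Prop}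

lemma UT.add (A : Nm p0 B) (hp0 : p0 < 0) {f g : ℝ × ℝ → ℝ} (hf : UT p0 s B e Pm f) (hg : UT p0 s B e Pm g) :
    UT p0 s B e Pm (fun z => f z + g z) := by
  obtain ⟨sf, C, hC, hf⟩ := hf
  obtain ⟨sg, D, hD, hg⟩ := hg
  refine ⟨sf.add sg, C + D, add_nonneg hC hD, fun N ε ω hP => ?_⟩
  simp only [add_mul]
  exact (hf N ε ω hP).add A hp0 (hg N ε ω hP) sf sg

lemma UT.mul (A : Nm p0 B) (hp0 : p0 < 0) (hs : 1 ≤ s) (hA : Adm Pm) {f g : ℝ × ℝ → ℝ} (hf : UT p0 s B e Pm f) (hg : UT p0 s B e Pm g) :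
    UT p0 s B e Pm (fun z => f z * g z) := by
  obtain ⟨sf, C, hC, hf⟩ := hf
  obtain ⟨sg, D, hD, hg⟩ := hg
  refine ⟨ContDiffOn.mul sf sg, 32 * (C * D), by positivity, fun N ε ω hP => ?_⟩
  obtain ⟨h0, h1, h2⟩ := hA N ε ω hP
  exact ((hf N ε ω hP).mul A hp0 (hg N ε ω hP) sf sg).mono A (om_nonneg h0 h2) fun k _ => pe_conv hs h0 h1 hC hD k

lemma UT.const (A : Nm p0 B) (hA : Adm Pm) (c : ℝ) : UT p0 s B e Pm (fun _ => c) := by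
  refine ⟨contDiffOn_const, |c|, abs_nonneg c, fun N ε ω hP w hw => ?_⟩
  obtain ⟨h0, h1, h2⟩ := hA N ε ω hP
  cases w with
  | nil => exact A.mono (A.const c) (by simp [wt, pe_zero])
  | cons v w =>
    have : dv p0 (e v) (fun _ => c) = fun _ => 0 := by funext z; simp [dv]
    simp only [Dw]
    rw [this]
    refine A.mono (A.congr (A.const 0) fun z _ => (Dw_zero w z).symm) ?_
    rw [abs_zero]
    have := wt_nonneg (om_nonneg h0 h2) (v :: w)
    have := pe_nonneg s h0 (v :: w).length
    positivity

lemma UT.imp {Pm' : ℕ → ℝ → (V → ℝ) → Prop} (hi : ∀ N ε ω, Pm' N ε ω → Pm N ε ω) {f : ℝ × ℝ → ℝ} (hf : UT p0 s B e Pm f) :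
    UT p0 s B e Pm' f := by
  obtain ⟨sf, C, hC, hf⟩ := hf
  exact ⟨sf, C, hC, fun N ε ω hP => hf N ε ω (hi _ _ _ hP)⟩

lemma UT.top (hA : Adm Pm) {f : ℝ × ℝ → ℝ} (hf : UT p0 s B e Pm f) :
    ∃ C, 0 ≤ C ∧ ∀ N ε ω, Pm N ε ω → 1 ≤ N → ∀ w : List V, w.length = N →
      B (C * (ε * (wt ω w * mm s N))) (Dw e p0 w f) := by
  obtain ⟨sf, C, hC, hf⟩ := hf
  refine ⟨C, hC, fun N ε ω hP hN w hw => ?_⟩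
  have := hf N ε ω hP w (by omega)
  beta_reduce at this
  rw [hw, pe_pos s ε (by omega)] at this
  convert this using 1; ring

lemma cut_conv {s ε : ℝ} (hs : 1 ≤ s) (h0 : 0 < ε) {a b : ℝ} (ha : 0 ≤ a) (hb : 0 ≤ b) (n : ℕ) :
    conv (cut fun k => a * pe s ε k) (fun k => b * mm s k) n ≤ 32 * (a * b * ε) * mm s n := by
  refine conv_le hs (by positivity) fun i j h => ?_
  have p1 := mm_pos s i
  have p2 := mm_pos s j
  unfold cut
  split_ifs with hi
  · rw [zero_mul]; positivity
  · beta_reduce; rw [pe_pos s ε hi]; exact le_of_eq (by ring)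

lemma UT.comm (A : Nm p0 B) (hp0 : p0 < 0) (hs : 1 ≤ s) (hA : Adm Pm) {b : ℝ} (hb : 0 ≤ b) {f g : ℝ × ℝ → ℝ} (hf : UT p0 s B e Pm f)
    (sg : Sm p0 g) (hg : ∀ N ε ω, Pm N ε ω → T p0 B e ω N (fun k => b * mm s k) g) :
    ∃ C, 0 ≤ C ∧ ∀ N ε ω, Pm N ε ω → ∀ w : List V, w.length = N →
      B (C * (ε * (wt ω w * mm s N))) (fun z => Dw e p0 w (fun z => f z * g z) z - f z * Dw e p0 w g z) := by
  obtain ⟨sf, C, hC, hf⟩ := hf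
  refine ⟨32 * (C * b), by positivity, fun N ε ω hP w hw => ?_⟩
  subst hw
  obtain ⟨h0, h1, h2⟩ := hA _ ε ω hP
  refine A.mono (Dw_comm_bd A hp0 w (hf _ ε ω hP) (hg _ ε ω hP) sf sg) ?_
  have := mul_le_mul_of_nonneg_left (cut_conv hs h0 hC hb w.length) (wt_nonneg (om_nonneg h0 h2) w)
  linarith

structure Par (p0 s : ℝ) (B : ℝ → (ℝ × ℝ → ℝ) → Prop) (e : V → ℝ × ℝ) (β ρ' : ℝ → ℝ) (h11 h12 h22 : ℝ × ℝ → ℝ)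
    (A0 : ℝ) (N : ℕ) (ε : ℝ) (ω : V → ℝ) : Prop where
  e0 : 0 < ε
  e1 : ε ≤ 1
  hω : ∀ v, 1 ≤ ε * ω v
  t11 : T p0 B e ω N (fun k => A0 * mm s k) h11
  t12 : T p0 B e ω N (fun k => A0 * mm s k) h12
  t22 : T p0 B e ω N (fun k => A0 * mm s k) h22
  tβ : T p0 B e ω (N + 1) (fun k => A0 * pe s ε k) (fun z => β z.2)
  tρ : T p0 B e ω (N + 1) (fun k => A0 * pe s ε k) (fun z => ρ' z.2)

structure Dat (p0 A0 : ℝ) (B : ℝ → (ℝ × ℝ → ℝ) → Prop) (e : V → ℝ × ℝ) (h h1 h2 : ℝ × ℝ → ℝ) : Prop where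
  A : Nm p0 B
  hA0 : 0 ≤ A0
  he : ∀ v, e v = (1, 0) ∨ e v = (0, 1)
  b0 : B A0 h
  b1 : B A0 h1
  b2 : B A0 h2

variable {g d σ Q δ₁ ρ0 A0 : ℝ} {β ρ' : ℝ → ℝ} {h h1 h2 h11 h12 h22 : ℝ × ℝ → ℝ}
variable (X : Sol p0 μ g d σ Q δ₁ ρ0 β ρ' h h1 h2 h11 h12 h22) (Y : Dat p0 A0 B e h h1 h2) (hs : 1 ≤ s)

lemma par_adm : Adm (Par p0 s B e β ρ' h11 h12 h22 A0) := fun _ _ _ h => ⟨h.e0, h.e1, h.hω⟩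

include X Y hs

lemma Sol.ut : UT p0 s B e (Par p0 s B e β ρ' h11 h12 h22 A0) h ∧ UT p0 s B e (Par p0 s B e β ρ' h11 h12 h22 A0) h1 ∧
    UT p0 s B e (Par p0 s B e β ρ' h11 h12 h22 A0) h2 := by
  obtain ⟨s0, s1, s2, s11, s12, s22⟩ := X.smooth
  have A := Y.A
  have k1 : ∀ N ε ω, Par p0 s B e β ρ' h11 h12 h22 A0 N ε ω →
      T p0 B e ω (N + 1) (fun k => max A0 (4 * A0) * pe s ε k) h1 := fun N ε ω hP => by
    refine T.int A hs hP.e0 hP.hω Y.hA0 Y.b1 fun v => ?_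
    rcases Y.he v with hv | hv <;> rw [hv]
    · exact hP.t11.congr A fun z hz => ((X.g1.eq X.hp z hz).1).symm
    · exact hP.t12.congr A fun z hz => ((X.g1.eq X.hp z hz).2).symm
  have k2 : ∀ N ε ω, Par p0 s B e β ρ' h11 h12 h22 A0 N ε ω →
      T p0 B e ω (N + 1) (fun k => max A0 (4 * A0) * pe s ε k) h2 := fun N ε ω hP => by
    refine T.int A hs hP.e0 hP.hω Y.hA0 Y.b2 fun v => ?_
    rcases Y.he v with hv | hv <;> rw [hv]
    · exact hP.t12.congr A fun z hz => ((X.g2.eq X.hp z hz).1).symm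
    · exact hP.t22.congr A fun z hz => ((X.g2.eq X.hp z hz).2).symm
  have hm : 0 ≤ max A0 (4 * A0) := le_max_of_le_left Y.hA0
  refine ⟨⟨s0, max A0 (4 * max A0 (4 * A0)), le_max_of_le_left Y.hA0, fun N ε ω hP => ?_⟩, ⟨s1, _, hm, k1⟩, ⟨s2, _, hm, k2⟩⟩
  refine T.int (b := max A0 (4 * A0)) A hs hP.e0 hP.hω hm Y.b0 fun v => ?_
  have q := om_nonneg hP.e0 hP.hω
  rcases Y.he v with hv | hv <;> rw [hv]
  · exact (((k1 N ε ω hP).le (Nat.le_succ N)).mono A q fun k _ => mul_le_mul_of_nonneg_left (pe_le s hP.e1 k) hm).congr A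
      fun z hz => ((X.g0.eq X.hp z hz).1).symm
  · exact (((k2 N ε ω hP).le (Nat.le_succ N)).mono A q fun k _ => mul_le_mul_of_nonneg_left (pe_le s hP.e1 k) hm).congr A
      fun z hz => ((X.g0.eq X.hp z hz).2).symm

theorem Sol.key : ∃ C, 0 ≤ C ∧ ∀ N ε ω, Par p0 s B e β ρ' h11 h12 h22 A0 N ε ω → 1 ≤ N → ∀ w : List V, w.length = N →
      B (C * (ε * (wt ω w * mm s N))) (fun z => h2 z * h2 z * Dw e p0 w h11 z + -2 * (h2 z * h1 z) * Dw e p0 w h12 z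
        + (1 + h1 z * h1 z) * Dw e p0 w h22 z) := by
  obtain ⟨s0, s1, s2, s11, s12, s22⟩ := X.smooth
  have A := Y.A
  have hp := X.hp
  have hA := par_adm (p0 := p0) (s := s) (B := B) (e := e) (β := β) (ρ' := ρ') (h11 := h11) (h12 := h12) (h22 := h22) (A0 := A0)
  obtain ⟨u0, u1, u2⟩ := X.ut Y hs
  have uβ : UT p0 s B e (Par p0 s B e β ρ' h11 h12 h22 A0) (fun z => β z.2) := ⟨X.sβ, A0, Y.hA0, fun N ε ω hP => hP.tβ⟩
  have uρ : UT p0 s B e (Par p0 s B e β ρ' h11 h12 h22 A0) (fun z => ρ' z.2) := ⟨X.sρ, A0, Y.hA0, fun N ε ω hP => hP.tρ⟩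
  have m {f g} := fun (x : UT p0 s B e (Par p0 s B e β ρ' h11 h12 h22 A0) f) (y : UT p0 s B e (Par p0 s B e β ρ' h11 h12 h22 A0) g) =>
    UT.mul A hp hs hA x y
  have c := fun c => UT.const (p0 := p0) (s := s) (e := e) A hA c
  have uF := m (((m (m (c g) uρ) (u0.add A hp (c (-d)))).add A hp (m (c (-1)) uβ))) (m (m u2 u2) u2)
  have ua := m u2 u2
  have ub := m (c (-2)) (m u2 u1)
  have uc := (c 1).add A hp (m u1 u1)
  obtain ⟨CF, hCF, kF⟩ := uF.top hA
  obtain ⟨Ca, hCa, ka⟩ := ua.comm A hp hs hA Y.hA0 s11 (fun N ε ω hP => hP.t11)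
  obtain ⟨Cb, hCb, kb⟩ := ub.comm A hp hs hA Y.hA0 s12 (fun N ε ω hP => hP.t12)
  obtain ⟨Cc, hCc, kc⟩ := uc.comm A hp hs hA Y.hA0 s22 (fun N ε ω hP => hP.t22)
  refine ⟨CF + 2 * Ca + 2 * Cb + 2 * Cc, by positivity, fun N ε ω hP hN w hw => ?_⟩
  have r := A.sub (A.sub (A.sub (kF N ε ω hP hN w hw) (ka N ε ω hP w hw)) (kb N ε ω hP w hw)) (kc N ε ω hP w hw)
  refine A.congr (A.mono r (le_of_eq (by ring))) fun z hz => ?_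
  have e1 := Dw_congr (e := e) w (fun z hz => (X.pde z hz).symm) z hz
  have e2 := Dw_add (e := e) hp w (((ua.1.mul s11)).add (ub.1.mul s12)) (uc.1.mul s22) z hz
  have e3 := Dw_add (e := e) hp w (ua.1.mul s11) (ub.1.mul s12) z hz
  rw [e1, e2, e3]; ring

end

lemma nmB (hp0 : p0 < 0) : Nm p0 (Bd p0 μ) where
  mono := Bd.mono
  congr := Bd.congr
  add := Bd.add
  mul := Bd.mul
  const := Bd.const
  nonneg := Bd.nonneg hp0

abbrev eU : Unit → ℝ × ℝ := fun _ => (1, 0)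

lemma Dw_unit (w : List Unit) : ∀ f, Dw eU p0 w f = (dq p0)^[w.length] f := by
  induction w with
  | nil => exact fun f => rfl
  | cons v w ih => intro f; rw [List.length_cons, Function.iterate_succ_apply, ← ih]; rfl

lemma Dw_row (hp0 : p0 < 0) {p : ℝ} (hp : p0 ≤ p ∧ p ≤ 0) (w : List Unit) : ∀ {f g : ℝ × ℝ → ℝ}, Sm p0 f → Sm p0 g →
    (∀ x, f (x, p) = g (x, p)) → ∀ x, Dw eU p0 w f (x, p) = Dw eU p0 w g (x, p) := by
  induction w with
  | nil => exact fun _ _ h => h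
  | cons v w ih =>
    intro f g sf sg h
    refine ih (sf.dv hp0 _) (sg.dv hp0 _) fun x => ?_
    have h1 := (grad_of_diff sf.diff).rowD (x, p) hp
    have h2 := (grad_of_diff sg.diff).rowD (x, p) hp
    have : (fun q => f (q, (x, p).2)) = fun q => g (q, (x, p).2) := funext fun q => h q
    rw [this] at h1
    exact h1.unique h2

lemma Dw_grad (hp0 : p0 < 0) {V : Type} {e : V → ℝ × ℝ} (w : List V) {f f1 f2 : ℝ × ℝ → ℝ} (sf : Sm p0 f) (hg : Grad (Strip p0) f f1 f2) :
    Grad (Strip p0) (Dw e p0 w f) (Dw e p0 w f1) (Dw e p0 w f2) := by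
  intro z hz
  have h1 := grad_of_diff (Dw_sm (e := e) hp0 w sf).diff z hz
  have e1 : dq p0 (Dw e p0 w f) z = Dw e p0 w f1 z :=
    (Dw_dv hp0 _ w sf z hz).trans (Dw_congr w (fun z hz => (hg.eq hp0 z hz).1) z hz)
  have e2 : dp p0 (Dw e p0 w f) z = Dw e p0 w f2 z :=
    (Dw_dv hp0 _ w sf z hz).trans (Dw_congr w (fun z hz => (hg.eq hp0 z hz).2) z hz)
  rwa [e1, e2] at h1

section
variable {s : ℝ} {g d σ Q δ₁ ρ0 A0 : ℝ} {β ρ' : ℝ → ℝ} {h h1 h2 h11 h12 h22 : ℝ × ℝ → ℝ}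
variable (X : Sol p0 μ g d σ Q δ₁ ρ0 β ρ' h h1 h2 h11 h12 h22) (Y : Dat p0 A0 (Bd p0 μ) eU h h1 h2) (hs : 1 ≤ s)
include X Y hs

lemma Sol.r_ut : ∃ ε1 > 0, UT p0 s (Bd p0 μ) eU
    (fun N ε ω => Par p0 s (Bd p0 μ) eU β ρ' h11 h12 h22 A0 N ε ω ∧ ε ≤ ε1) (fun z => Real.sqrt (1 + h1 z * h1 z)) := by
  obtain ⟨s0, s1, s2, s11, s12, s22⟩ := X.smooth
  have A := Y.A
  have hp := X.hp
  obtain ⟨-, ⟨-, C1, hC1, u1⟩, -⟩ := X.ut Y hs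
  set r : ℝ × ℝ → ℝ := fun z => Real.sqrt (1 + h1 z * h1 z) with hr
  have ge1 : ∀ z, (1:ℝ) ≤ 1 + h1 z * h1 z := fun z => by nlinarith [mul_self_nonneg (h1 z)]
  have r1 : ∀ z, 1 ≤ r z := fun z => Real.one_le_sqrt.2 (ge1 z)
  have rr : ∀ z, r z * r z = 1 + h1 z * h1 z := fun z => Real.mul_self_sqrt (by linarith [ge1 z])
  have sc : Sm p0 (fun z => 1 + h1 z * h1 z) := contDiffOn_const.add (s1.mul s1)
  have sr : Sm p0 r := ContDiffOn.sqrt sc fun z _ => by linarith [ge1 z]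
  have bc := (Bd.const (p0 := p0) (μ := μ) 1).add (Y.b1.mul Y.b1)
  have br := bc.sqrt fun z _ => ge1 z
  obtain ⟨W, bi⟩ := br.inv one_pos fun z _ => r1 z
  set Mr := |1| + 2 * (A0 * A0)
  have hW := bi.nonneg hp
  have hMr : 0 ≤ Mr := br.nonneg hp
  have hA0 := Y.hA0
  have eq : ∀ z ∈ Strip p0, r z * dq p0 r z = h1 z * h11 z := by
    intro z hz
    have a1 := dv_mul hp sr sr (1, 0) z hz
    have a2 := dv_mul hp s1 s1 (1, 0) z hz
    have a3 := dv_add hp (contDiffOn_const (c := (1:ℝ))) (s1.mul s1) (1, 0) z hz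
    have a4 : dv p0 (1, 0) (fun _ => (1:ℝ)) z = 0 := by simp [dv]
    have a5 := dv_congr (p0 := p0) (v := (1, 0)) (fun z _ => rr z) z hz
    have a6 : dv p0 (1, 0) h1 z = h11 z := (X.g1.eq hp z hz).1
    simp only [a6, a4] at a2 a3
    have : dq p0 r z = dv p0 (1, 0) r z := rfl
    rw [this]
    linarith
  set D := 32 * (C1 * A0) with hD
  have hD0 : 0 ≤ D := by positivity
  set b := 4 * W * D + 1 with hb
  have hb0 : 0 < b := by positivity
  set B' := max Mr (4 * b) with hB'
  have hB'0 : 0 ≤ B' := le_max_of_le_left hMr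
  refine ⟨1 / (256 * W * B' + 1), by positivity, sr, B', hB'0, fun N ε ω hP => ?_⟩
  obtain ⟨hP, hε⟩ := hP
  have e0 := hP.e0
  have om := om_nonneg e0 hP.hω
  have tD : T p0 (Bd p0 μ) eU ω N (fun k => D * mm s k) (fun z => h1 z * h11 z) := by
    refine (((u1 N ε ω hP).le (Nat.le_succ N)).mul A hp hP.t11 s1 s11).mono A om fun k _ => ?_
    refine conv_le hs (by positivity) fun i j _ => ?_
    have := mm_pos s j
    have := mul_le_mul_of_nonneg_right (pe_le s hP.e1 i) this.le
    nlinarith [mul_nonneg hC1 hA0]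
  have main : ∀ n ≤ N, T p0 (Bd p0 μ) eU ω n (fun k => b * mm s k) (dq p0 r) := by
    intro n
    induction n with
    | zero => exact fun _ w hw => by omega
    | succ n ih =>
      intro hn w hw
      have ih := ih (by omega)
      by_cases hwn : w.length < n
      · exact ih w hwn
      obtain rfl : n = w.length := by omega
      have tr : T p0 (Bd p0 μ) eU ω (w.length + 1) (fun k => B' * pe s ε k) r :=
        T.int A hs e0 hP.hω hb0.le br fun _ => ih
      have c1 := Dw_comm_bd A hp w tr ih sr (sr.dv hp _)
      have c2 := A.mul bi (A.sub (tD w (by omega)) c1)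
      refine A.congr (A.mono c2 ?_) fun z hz => ?_
      · have wn := wt_nonneg om w
        have mp := mm_pos s w.length
        have cc := mul_le_mul_of_nonneg_left (cut_conv hs e0 hB'0 hb0.le w.length) wn
        have k1 : ε * (256 * W * B' + 1) ≤ 1 := by
          rwa [le_div_iff₀ (by positivity)] at hε
        have k2 : W * (wt ω w * (D * mm s w.length) + 2 * (wt ω w * conv (cut fun k => B' * pe s ε k) (fun k => b * mm s k) w.length))
            ≤ W * (wt ω w * (D * mm s w.length) + 2 * (wt ω w * (32 * (B' * b * ε) * mm s w.length))) := by gcongr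
        have k3 : 2 * (W * (D + 64 * (B' * b * ε))) ≤ b := by
          have : b * (256 * W * B' * ε) ≤ b * 1 := mul_le_mul_of_nonneg_left (by nlinarith) hb0.le
          nlinarith
        have k4 := mul_le_mul_of_nonneg_left k3 (mul_nonneg wn mp.le)
        linarith
      · have e1 := Dw_congr (e := eU) w eq z hz
        have : r z ≠ 0 := by linarith [r1 z]
        rw [← e1]
        change (r z)⁻¹ * _ = _
        field_simp
        ring
  exact T.int A hs e0 hP.hω hb0.le br fun _ => main N le_rfl

theorem Sol.qtop : ∃ ε1 > 0, ∃ C, 0 ≤ C ∧ ∀ N ε ω, Par p0 s (Bd p0 μ) eU β ρ' h11 h12 h22 A0 N ε ω → ε ≤ ε1 → 1 ≤ N →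
    ∀ w : List Unit, w.length = N → ∃ f, Bd p0 μ (C * (ε * (wt ω w * mm s N))) f ∧ ∀ x, Dw eU p0 w h11 (x, 0) = f (x, 0) := by
  obtain ⟨s0, s1, s2, s11, s12, s22⟩ := X.smooth
  have A := Y.A
  have hp := X.hp
  have hδ := X.hδ
  have hσ := X.hσ
  obtain ⟨ε1, hε1, ur⟩ := X.r_ut Y hs
  set Pm := (fun N ε ω => Par p0 s (Bd p0 μ) eU β ρ' h11 h12 h22 A0 N ε ω ∧ ε ≤ ε1) with hPm
  have hA : Adm Pm := fun N ε ω h => par_adm N ε ω h.1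
  obtain ⟨u0, u1, u2⟩ := X.ut Y hs
  have u0 := u0.imp (Pm' := Pm) fun N ε ω h => h.1
  have u1 := u1.imp (Pm' := Pm) fun N ε ω h => h.1
  have u2 := u2.imp (Pm' := Pm) fun N ε ω h => h.1
  have m {f g} := fun (x : UT p0 s (Bd p0 μ) eU Pm f) (y : UT p0 s (Bd p0 μ) eU Pm g) => UT.mul A hp hs hA x y
  have c := fun c => UT.const (p0 := p0) (s := s) (e := eU) A hA c
  have uc := (c 1).add A hp (m u1 u1)
  have uH := m (c (1 / (2 * σ))) (m (uc.add A hp (m ((m (c (2 * g * ρ0)) u0).add A hp (c (-Q))) (m u2 u2))) (m ur uc))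
  obtain ⟨CH, hCH, kH⟩ := uH.top hA
  have ua := m u2 u2
  obtain ⟨Ca, hCa, ka⟩ := ua.comm A hp hs hA Y.hA0 s11 (fun N ε ω hP => hP.1.t11)
  obtain ⟨W, bi⟩ := (Y.b2.mul Y.b2).inv (mul_pos hδ hδ) fun z hz => mul_self_le_mul_self hδ.le (X.lo z hz)
  have hW := bi.nonneg hp
  refine ⟨ε1, hε1, 2 * (W * (CH + 2 * Ca)), by positivity, fun N ε ω hP hε hN w hw => ?_⟩
  have r := A.mul bi (A.sub (kH N ε ω ⟨hP, hε⟩ hN w hw) (ka N ε ω ⟨hP, hε⟩ w hw))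
  refine ⟨_, A.mono r (le_of_eq (by ring)), fun x => ?_⟩
  have e1 := Dw_row hp ⟨hp.le, le_rfl⟩ w uH.1 (ua.1.mul s11) (fun x => by
    have := X.top x
    rw [← this]; field_simp) x
  rw [e1]
  have : h2 (x, 0) ≠ 0 := by have := X.lo (x, 0) ⟨hp.le, le_rfl⟩; linarith
  field_simp
  ring

theorem Sol.qone : ∃ ε1 > 0, ∃ C, 0 ≤ C ∧ ∀ N ε ω, Par p0 s (Bd p0 μ) eU β ρ' h11 h12 h22 A0 N ε ω → ε ≤ ε1 → 1 ≤ N →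
    ∀ w : List Unit, w.length = N → Bd p0 μ (C * (ε * (wt ω w * mm s N))) (Dw eU p0 w h11) ∧
      Bd p0 μ (C * (ε * (wt ω w * mm s N))) (Dw eU p0 w h12) ∧ Bd p0 μ (C * (ε * (wt ω w * mm s N))) (Dw eU p0 w h22) := by
  obtain ⟨s0, s1, s2, s11, s12, s22⟩ := X.smooth
  have A := Y.A
  have hp := X.hp
  obtain ⟨lam, Lam, hlam, cof⟩ := X.cof
  obtain ⟨Cs, hCs, sch⟩ := schauder2 (Lam := Lam) hp X.hμ X.hμ1 hlam
  obtain ⟨ε1, hε1, Ct, hCt, kt⟩ := X.qtop Y hs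
  obtain ⟨u0, u1, u2⟩ := X.ut Y hs
  obtain ⟨C1, hC1, k1⟩ := u1.top par_adm
  obtain ⟨C2, hC2, k2⟩ := u2.top par_adm
  obtain ⟨Ck, hCk, kk⟩ := X.key Y hs
  refine ⟨ε1, hε1, Cs * (C1 + C2 + Ck + Ct), by positivity, fun N ε ω hP hε hN w hw => ?_⟩
  have tn : 0 ≤ ε * (wt ω w * mm s N) :=
    mul_nonneg hP.e0.le (mul_nonneg (wt_nonneg (om_nonneg hP.e0 hP.hω) w) (mm_pos s N).le)
  set t := ε * (wt ω w * mm s N) with ht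
  have l1 : C1 * t ≤ (C1 + C2 + Ck + Ct) * t := mul_le_mul_of_nonneg_right (by linarith) tn
  have l2 : C2 * t ≤ (C1 + C2 + Ck + Ct) * t := mul_le_mul_of_nonneg_right (by linarith) tn
  have l3 : Ck * t ≤ (C1 + C2 + Ck + Ct) * t := mul_le_mul_of_nonneg_right (by linarith) tn
  have l4 : Ct * t ≤ (C1 + C2 + Ck + Ct) * t := mul_le_mul_of_nonneg_right (by linarith) tn
  have b1 := ((k1 N ε ω hP hN w hw).mono l1).1
  have b2 := ((k2 N ε ω hP hN w hw).mono l2).1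
  have b3 := ((kk N ε ω hP hN w hw).mono l3).2
  obtain ⟨f, bf, ef⟩ := kt N ε ω hP hε hN w hw
  have bf := bf.mono l4
  have zt : (0:ℝ) ≤ (C1 + C2 + Ck + Ct) * t := by positivity
  have fin := X.bdq w.length
  rw [← Dw_unit, ← Dw_unit, ← Dw_unit] at fin
  obtain ⟨⟨M1, f1⟩, ⟨M2, f2⟩, ⟨M3, f3⟩⟩ := fin
  have bot : ∀ x, Dw eU p0 w h11 (x, p0) = 0 := fun x =>
    (Dw_row hp ⟨le_rfl, hp.le⟩ w s11 (contDiffOn_const (c := (0:ℝ))) X.bot11 x).trans (Dw_zero w _)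
  have key := sch _ _ _ cof (Dw eU p0 w h1) (Dw eU p0 w h2) ![Dw eU p0 w h11, Dw eU p0 w h12, Dw eU p0 w h22]
    (Dw_grad hp w s1 X.g1) (Dw_grad hp w s2 X.g2) _ zt b1 b2 b3
    (fun x x' => by
      simp only [Matrix.cons_val_zero, bot, sub_self, abs_zero]; positivity)
    (fun x x' => by
      simp only [Matrix.cons_val_zero, ef]
      have := bf.2 (x, 0) ⟨hp.le, le_rfl⟩ (x', 0) ⟨hp.le, le_rfl⟩
      rwa [rownorm] at this)
    ⟨max M1 (max M2 M3), fun i => by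
      fin_cases i
      · exact f1.2.mono (le_max_left _ _)
      · exact f2.2.mono ((le_max_left _ _).trans (le_max_right _ _))
      · exact f3.2.mono ((le_max_right _ _).trans (le_max_right _ _))⟩
  rw [mul_assoc]
  exact ⟨key 0, key 1, key 2⟩

theorem Sol.qstep (hA0 : 0 < A0) (b11 : Bd p0 μ A0 h11) (b12 : Bd p0 μ A0 h12) (b22 : Bd p0 μ A0 h22)
    (bβ : Bd p0 μ A0 (fun z => β z.2)) (bρ : Bd p0 μ A0 (fun z => ρ' z.2)) :
    ∃ ε0 > 0, ∀ ε > 0, ε ≤ ε0 → ∀ N, T p0 (Bd p0 μ) eU (fun _ => 1 / ε) N (fun k => A0 * mm s k) h11 ∧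
      T p0 (Bd p0 μ) eU (fun _ => 1 / ε) N (fun k => A0 * mm s k) h12 ∧
      T p0 (Bd p0 μ) eU (fun _ => 1 / ε) N (fun k => A0 * mm s k) h22 := by
  have A := Y.A
  have hp := X.hp
  obtain ⟨ε1, hε1, C, hC, kq⟩ := X.qone Y hs
  refine ⟨min 1 (min ε1 (A0 / (C + 1))), by positivity, fun ε e0 hε N => ?_⟩
  have el1 : ε ≤ 1 := hε.trans (min_le_left _ _)
  have el2 : ε ≤ ε1 := hε.trans ((min_le_right _ _).trans (min_le_left _ _))
  have el3 : ε ≤ A0 / (C + 1) := hε.trans ((min_le_right _ _).trans (min_le_right _ _))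
  have hω : ∀ v : Unit, (1:ℝ) ≤ ε * (1 / ε) := fun _ => by rw [mul_one_div_cancel e0.ne']
  have sn : ∀ b : ℝ → ℝ, Sm p0 (fun z => b z.2) → Bd p0 μ A0 (fun z => b z.2) →
      ∀ N, T p0 (Bd p0 μ) eU (fun _ => 1 / ε) N (fun k => A0 * pe s ε k) (fun z => b z.2) := by
    intro b sb bb N w hw
    cases w with
    | nil => exact A.mono bb (by simp [wt, pe_zero])
    | cons v w =>
      have : ∀ z ∈ Strip p0, dv p0 (eU v) (fun z => b z.2) z = 0 := fun z hz =>
        ((grad_of_diff sb.diff).rowD z hz).unique (hasDerivAt_const z.1 (b z.2))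
      refine A.mono (A.congr (A.const 0) fun z hz => ((Dw_congr w this z hz).trans (Dw_zero w z)).symm) ?_
      rw [abs_zero]
      have := wt_nonneg (om_nonneg e0 hω) (v :: w)
      have := pe_nonneg s e0 (v :: w).length
      positivity
  induction N with
  | zero => exact ⟨fun w hw => by omega, fun w hw => by omega, fun w hw => by omega⟩
  | succ N ih =>
    obtain ⟨t11, t12, t22⟩ := ih
    have hP : Par p0 s (Bd p0 μ) eU β ρ' h11 h12 h22 A0 N ε (fun _ => 1 / ε) :=
      ⟨e0, el1, hω, t11, t12, t22, sn β X.sβ bβ _, sn ρ' X.sρ bρ _⟩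
    have key : ∀ w : List Unit, w.length = N → Bd p0 μ (wt (fun _ => 1 / ε) w * (A0 * mm s w.length)) (Dw eU p0 w h11) ∧
        Bd p0 μ (wt (fun _ => 1 / ε) w * (A0 * mm s w.length)) (Dw eU p0 w h12) ∧
        Bd p0 μ (wt (fun _ => 1 / ε) w * (A0 * mm s w.length)) (Dw eU p0 w h22) := by
      intro w hw
      rcases Nat.eq_zero_or_pos N with rfl | hN
      · obtain rfl : w = [] := List.length_eq_zero_iff.1 hw
        simpa [wt, mm_zero, Dw] using ⟨b11, b12, b22⟩
      · have k := kq N ε _ hP el2 hN w hw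
        have le : C * (ε * (wt (fun _ => 1 / ε) w * mm s N)) ≤ wt (fun _ => 1 / ε) w * (A0 * mm s w.length) := by
          rw [hw]
          rw [le_div_iff₀ (by positivity)] at el3
          have n1 := mul_nonneg (wt_nonneg (om_nonneg e0 hω) w) (mm_pos s N).le
          nlinarith
        exact ⟨k.1.mono le, k.2.1.mono le, k.2.2.mono le⟩
    refine ⟨fun w hw => ?_, fun w hw => ?_, fun w hw => ?_⟩
    · rcases Nat.lt_succ_iff_lt_or_eq.1 hw with h | h
      exacts [t11 w h, (key w h).1]
    · rcases Nat.lt_succ_iff_lt_or_eq.1 hw with h | h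
      exacts [t12 w h, (key w h).2.1]
    · rcases Nat.lt_succ_iff_lt_or_eq.1 hw with h | h
      exacts [t22 w h, (key w h).2.2]
end

abbrev Sb (p0 : ℝ) : ℝ → (ℝ × ℝ → ℝ) → Prop := fun M f => ∀ z ∈ Strip p0, |f z| ≤ M

lemma nmS (hp0 : p0 < 0) : Nm p0 (Sb p0) where
  mono h l z hz := (h z hz).trans l
  congr h e z hz := by rw [← e z hz]; exact h z hz
  add h k z hz := (abs_add_le _ _).trans (add_le_add (h z hz) (k z hz))
  mul h k z hz := by
    rw [abs_mul]
    have := mul_le_mul (h z hz) (k z hz) (abs_nonneg _) ((abs_nonneg _).trans (h z hz))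
    nlinarith [mul_nonneg (abs_nonneg _) (abs_nonneg _) |>.trans this]
  const c z _ := le_rfl
  nonneg h := (abs_nonneg _).trans (h (0, 0) ⟨hp0.le, le_rfl⟩)

abbrev eB : Bool → ℝ × ℝ := fun b => if b then (1, 0) else (0, 1)

def GB (s p0 M : ℝ) (f : ℝ → ℝ) : Prop := ∀ k : ℕ, ∀ p ∈ Icc p0 0,
    |iteratedDerivWithin k f (Icc p0 0) p| ≤ M ^ (k + 1) * (Nat.factorial k : ℝ) ^ s

lemma GB.mono {s M N : ℝ} {f : ℝ → ℝ} (h : GB s p0 M f) (h0 : 0 ≤ M) (hMN : M ≤ N) : GB s p0 N f := fun k p hp =>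
  (h k p hp).trans (by gcongr)

lemma GB.deriv {s M : ℝ} {f : ℝ → ℝ} (hs : 1 ≤ s) (hM : 1 ≤ M) (h : GB s p0 M f) :
    GB s p0 (M ^ 2 * 2 ^ s) (derivWithin f (Icc p0 0)) := fun k p hp => by
  rw [← iteratedDerivWithin_succ']
  refine (h (k + 1) p hp).trans ?_
  have h1 : M ^ (k + 1 + 1) ≤ (M ^ 2) ^ (k + 1) := by
    rw [← pow_mul]; exact pow_le_pow_right₀ hM (by omega)
  have h2 : ((Nat.factorial (k + 1) : ℕ) : ℝ) ^ s ≤ (2 ^ s) ^ (k + 1) * (Nat.factorial k : ℝ) ^ s := by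
    rw [Nat.factorial_succ, Nat.cast_mul, Real.mul_rpow (by positivity) (by positivity), ← Real.rpow_natCast, ← Real.rpow_mul (by positivity), mul_comm s,
      Real.rpow_mul (by positivity), Real.rpow_natCast]
    gcongr
    exact_mod_cast (Nat.lt_two_pow_self (n := k + 1)).le
  rw [mul_pow, mul_assoc]
  exact mul_le_mul h1 h2 (by positivity) (by positivity)

lemma Dw_snd (hp0 : p0 < 0) (w : List Bool) : ∀ {f : ℝ → ℝ}, ContDiffOn ℝ (⊤ : ℕ∞) f (Icc p0 0) →
    ∀ z ∈ Strip p0, |Dw eB p0 w (fun z => f z.2) z| ≤ |iteratedDerivWithin w.length f (Icc p0 0) z.2| := by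
  induction w with
  | nil => intro f _ z _; simp [Dw]
  | cons v w ih =>
    intro f hf z hz
    have e := (snd_grad hf).eq hp0
    rw [Dw]
    cases v with
    | true =>
      rw [Dw_congr w (f := dv p0 (eB true) _) (fun z hz => (e z hz).1) z hz, Dw_zero]; simp
    | false =>
      rw [Dw_congr w (f := dv p0 (eB false) _) (fun z hz => (e z hz).2) z hz, List.length_cons, iteratedDerivWithin_succ']
      exact ih (dw_cd hp0 hf) z hz

lemma sq_le_four (k : ℕ) : ((k : ℝ) + 1) ^ 2 ≤ 4 ^ k := by
  have : ((k : ℝ) + 1) ≤ 2 ^ k := by exact_mod_cast Nat.lt_two_pow_self (n := k)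
  calc ((k : ℝ) + 1) ^ 2 ≤ (2 ^ k) ^ 2 := by gcongr
    _ = 4 ^ k := by rw [← pow_mul, mul_comm, pow_mul]; norm_num

abbrev om (ε P : ℝ) : Bool → ℝ := fun b => if b then 1 / ε else P

lemma T_snd {s A0 M ε P : ℝ} (hp0 : p0 < 0) (e0 : 0 < ε) (e1 : ε ≤ 1) (hM : 1 ≤ M) (hMA : M ≤ A0) (hP : 4 * M / ε ≤ P)
    {f : ℝ → ℝ} (hf : ContDiffOn ℝ (⊤ : ℕ∞) f (Icc p0 0)) (hg : GB s p0 M f) (N : ℕ) :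
    T p0 (Sb p0) eB (om ε P) N (fun k => A0 * pe s ε k) (fun z => f z.2) := by
  have P0 : 0 ≤ P := le_trans (by positivity) hP
  have o0 : ∀ b, 0 ≤ om ε P b := fun b => by cases b <;> simp [om] <;> positivity
  intro w _ z hz
  have hz' : z.2 ∈ Icc p0 0 := hz
  beta_reduce
  by_cases hw : w = []
  · subst hw
    have := hg 0 _ hz'
    simp [wt, Dw, pe_zero] at this ⊢
    linarith
  have hl : w.length ≠ 0 := by simpa using hw
  have rhs : 0 ≤ wt (om ε P) w * (A0 * pe s ε w.length) := by
    have := wt_nonneg o0 w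
    have := pe_nonneg s e0 w.length
    have : 0 ≤ A0 := by linarith
    positivity
  by_cases ht : true ∈ w
  · have e := (snd_grad hf).eq hp0
    rw [Dw_perm hp0 (List.perm_cons_erase ht) (snd_cd hf) z hz, Dw, Dw_congr _ (f := dv p0 (eB true) _) (fun z hz => (e z hz).1) z hz, Dw_zero]
    simpa using rhs
  have hr : w = List.replicate w.length false := List.eq_replicate_of_mem fun b hb => by
    cases b
    · rfl
    · exact absurd hb ht
  have hwt : wt (om ε P) w = P ^ w.length := by
    rw [hr]; simp [wt, om]
  rw [hwt, pe_pos s ε hl]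
  refine (Dw_snd hp0 w hf z hz).trans ((hg _ _ hz').trans ?_)
  generalize w.length = k at hl
  have k1 : (4 * M) ^ k ≤ ε * P ^ k := by
    have : (4 * M) ≤ ε * P := by rw [div_le_iff₀ e0] at hP; linarith
    calc (4 * M) ^ k ≤ (ε * P) ^ k := by gcongr
      _ = ε ^ k * P ^ k := mul_pow _ _ _
      _ ≤ ε * P ^ k := by gcongr; exact pow_le_of_le_one e0.le e1 hl
  have k2 : M ^ k * ((k : ℝ) + 1) ^ 2 ≤ ε * P ^ k := by
    refine le_trans ?_ k1
    rw [mul_pow, mul_comm]; gcongr; exact sq_le_four k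
  unfold mm
  rw [show P ^ k * (A0 * (ε * ((Nat.factorial k : ℝ) ^ s / ((k : ℝ) + 1) ^ 2))) = (A0 * (ε * P ^ k)) * (Nat.factorial k : ℝ) ^ s / ((k : ℝ) + 1) ^ 2 by ring,
    le_div_iff₀ (by positivity)]
  calc M ^ (k + 1) * (Nat.factorial k : ℝ) ^ s * ((k : ℝ) + 1) ^ 2 = M * (M ^ k * ((k : ℝ) + 1) ^ 2) * (Nat.factorial k : ℝ) ^ s := by ring
    _ ≤ A0 * (ε * P ^ k) * (Nat.factorial k : ℝ) ^ s := by gcongr; linarith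

lemma Dw_true (n : ℕ) : ∀ f, Dw eB p0 (List.replicate n true) f = Dw eU p0 (List.replicate n ()) f := by
  induction n with
  | zero => exact fun f => rfl
  | succ n ih => exact fun f => ih _

theorem Sol.pstep {s g d σ Q δ₁ ρ0 M : ℝ} {β ρ' : ℝ → ℝ} {h h1 h2 h11 h12 h22 : ℝ × ℝ → ℝ}
    (X : Sol p0 μ g d σ Q δ₁ ρ0 β ρ' h h1 h2 h11 h12 h22) (hs : 1 ≤ s) (hM : 1 ≤ M)
    (cβ : ContDiffOn ℝ (⊤ : ℕ∞) β (Icc p0 0)) (cρ : ContDiffOn ℝ (⊤ : ℕ∞) ρ' (Icc p0 0)) (gβ : GB s p0 M β) (gρ : GB s p0 M ρ') :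
    ∃ A0 ≥ 1, ∃ ω : Bool → ℝ, ∀ N, T p0 (Sb p0) eB ω N (fun k => A0 * mm s k) h11 ∧
      T p0 (Sb p0) eB ω N (fun k => A0 * mm s k) h12 ∧ T p0 (Sb p0) eB ω N (fun k => A0 * mm s k) h22 := by
  obtain ⟨s0, s1, s2, s11, s12, s22⟩ := X.smooth
  have hp := X.hp
  obtain ⟨m0, b0⟩ := X.b0
  obtain ⟨m1, b1⟩ := X.b1
  obtain ⟨m2, b2⟩ := X.b2
  obtain ⟨m11, b11⟩ := X.b11
  obtain ⟨m12, b12⟩ := X.b12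
  obtain ⟨m22, b22⟩ := X.b22
  obtain ⟨mβ, bβ⟩ := X.bβ
  obtain ⟨mρ, bρ⟩ := X.bρ
  have A := nmB (μ := μ) hp
  obtain ⟨A0, l⟩ : ∃ A0, m0 ≤ A0 ∧ m1 ≤ A0 ∧ m2 ≤ A0 ∧ m11 ≤ A0 ∧ m12 ≤ A0 ∧ m22 ≤ A0 ∧ mβ ≤ A0 ∧ mρ ≤ A0 ∧ M ≤ A0 := by
    have := A.nonneg b0
    have := A.nonneg b1
    have := A.nonneg b2
    have := A.nonneg b11
    have := A.nonneg b12
    have := A.nonneg b22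
    have := A.nonneg bβ
    have := A.nonneg bρ
    refine ⟨m0 + m1 + m2 + m11 + m12 + m22 + mβ + mρ + M, ?_⟩
    refine ⟨?_, ?_, ?_, ?_, ?_, ?_, ?_, ?_, ?_⟩ <;> linarith
  obtain ⟨l0, l1, l2, l11, l12, l22, lβ, lρ, lM⟩ := l
  have A1 : 1 ≤ A0 := hM.trans lM
  have A00 : 0 < A0 := by linarith
  have YB : Dat p0 A0 (Bd p0 μ) eU h h1 h2 := ⟨A, A00.le, fun _ => .inl rfl, b0.mono l0, b1.mono l1, b2.mono l2⟩
  have sup : ∀ {M f}, Bd p0 μ M f → Sb p0 M f := fun h z hz => h.1 z hz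
  have S := nmS hp
  have YS : Dat p0 A0 (Sb p0) eB h h1 h2 := ⟨S, A00.le, fun v => by cases v <;> simp [eB], sup YB.b0, sup YB.b1, sup YB.b2⟩
  obtain ⟨ε0, he0, kq⟩ := X.qstep YB hs A00 (b11.mono l11) (b12.mono l12) (b22.mono l22) (bβ.mono lβ) (bρ.mono lρ)
  obtain ⟨C, hC, kp⟩ := X.key YS hs
  obtain ⟨ε, e0, ee, e1, eC⟩ : ∃ ε > 0, ε ≤ ε0 ∧ ε ≤ 1 ∧ C * ε ≤ A0 / 2 := by
    refine ⟨min ε0 (min 1 (A0 / (2 * (C + 1)))), by positivity, min_le_left _ _, (min_le_right _ _).trans (min_le_left _ _), ?_⟩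
    have : min ε0 (min 1 (A0 / (2 * (C + 1)))) ≤ A0 / (2 * (C + 1)) := (min_le_right _ _).trans (min_le_right _ _)
    have p : 0 < min ε0 (min 1 (A0 / (2 * (C + 1)))) := by positivity
    rw [le_div_iff₀ (by positivity)] at this
    nlinarith
  obtain ⟨P, P1, P2, P3⟩ : ∃ P, 1 / ε ≤ P ∧ 4 * M / ε ≤ P ∧ 6 * A0 ^ 2 * (1 / ε) ≤ P :=
    ⟨max (1 / ε) (max (4 * M / ε) (6 * A0 ^ 2 * (1 / ε))), le_max_left _ _, (le_max_left _ _).trans (le_max_right _ _),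
      (le_max_right _ _).trans (le_max_right _ _)⟩
  have R0 : 0 < 1 / ε := by positivity
  have P0 : 0 < P := R0.trans_le P1
  have hω : ∀ v, 1 ≤ ε * om ε P v := by
    have : ε * (1 / ε) = 1 := mul_one_div_cancel e0.ne'
    intro v
    cases v <;> simp only [om, if_true]
    · simp only [Bool.false_eq_true, if_false]; nlinarith
    · exact this.ge
  have o0 := om_nonneg e0 hω
  refine ⟨A0, A1, om ε P, fun N => ?_⟩
  induction N with
  | zero => exact ⟨fun w hw => by omega, fun w hw => by omega, fun w hw => by omega⟩
  | succ N ih =>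
    obtain ⟨t11, t12, t22⟩ := ih
    have hP : Par p0 s (Sb p0) eB β ρ' h11 h12 h22 A0 N ε (om ε P) :=
      ⟨e0, e1, hω, t11, t12, t22, T_snd hp e0 e1 hM lM P2 cβ gβ _, T_snd hp e0 e1 hM lM P2 cρ gρ _⟩
    have key : ∀ b : ℕ, ∀ w : List Bool, w.count false = b → w.length = N →
        Sb p0 (wt (om ε P) w * (A0 * mm s w.length)) (Dw eB p0 w h11) ∧
        Sb p0 (wt (om ε P) w * (A0 * mm s w.length)) (Dw eB p0 w h12) ∧
        Sb p0 (wt (om ε P) w * (A0 * mm s w.length)) (Dw eB p0 w h22) := by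
      intro b
      induction b with
      | zero =>
        intro w hb hw
        have hr : w = List.replicate w.length true := List.eq_replicate_of_mem fun b hb' => by
          cases b
          · exact absurd hb' (List.count_eq_zero.1 hb)
          · rfl
        obtain ⟨q1, q2, q3⟩ := kq ε e0 ee (w.length + 1)
        have hl : (List.replicate w.length ()).length < w.length + 1 := by simp
        have q1 := sup (q1 _ hl)
        have q2 := sup (q2 _ hl)
        have q3 := sup (q3 _ hl)
        have ew : wt (om ε P) w = wt (fun _ => 1 / ε) (List.replicate w.length ()) := by
          rw [hr]; simp [wt, om]
        rw [← Dw_true, ← hr, ← ew, List.length_replicate] at q1 q2 q3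
        exact ⟨q1, q2, q3⟩
      | succ b ih =>
        intro w hb hw
        have hf : false ∈ w := List.count_pos_iff.1 (by omega)
        have pw := List.perm_cons_erase hf
        set w' := w.erase false
        have cw : w'.count false = b := by
          have := pw.count_eq false
          simp at this; omega
        have lw : w'.length + 1 = w.length := by simpa using pw.length_eq.symm
        obtain ⟨-, i12, i22⟩ := ih (true :: w') (by simpa using cw) (by simp; omega)
        have ww : wt (om ε P) w = P * wt (om ε P) w' := by
          have : wt (om ε P) w = wt (om ε P) (false :: w') := (pw.map _).prod_eq
          rw [this, wt_cons]; rfl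
        have wn := wt_nonneg o0 w'
        have wn1 := wt_nonneg o0 w
        rw [wt_cons, List.length_cons, lw] at i12 i22
        have mp := mm_pos s w.length
        have E11 : ∀ z ∈ Strip p0, Dw eB p0 w h11 z = Dw eB p0 (true :: w') h12 z := fun z hz =>
          (Dw_perm hp pw s11 z hz).trans (Dw_congr w' (fun z hz => by
            have a := dv_comm2 hp (1, 0) (0, 1) (Sm.two s1) z hz
            have b1 := dv_congr (v := (0, 1)) (fun z hz => (X.g1.eq hp z hz).1) z hz
            have b2 := dv_congr (v := (1, 0)) (fun z hz => (X.g1.eq hp z hz).2) z hz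
            first
              | exact b1.symm.trans (a.trans b2)
              | exact b1.symm.trans (a.symm.trans b2)) z hz)
        have E12 : ∀ z ∈ Strip p0, Dw eB p0 w h12 z = Dw eB p0 (true :: w') h22 z := fun z hz =>
          (Dw_perm hp pw s12 z hz).trans (Dw_congr w' (fun z hz => by
            have a := dv_comm2 hp (1, 0) (0, 1) (Sm.two s2) z hz
            have b1 := dv_congr (v := (0, 1)) (fun z hz => (X.g2.eq hp z hz).1) z hz
            have b2 := dv_congr (v := (1, 0)) (fun z hz => (X.g2.eq hp z hz).2) z hz
            first
              | exact b1.symm.trans (a.trans b2)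
              | exact b1.symm.trans (a.symm.trans b2)) z hz)
        have gain : om ε P true * wt (om ε P) w' * (A0 * mm s w.length) * (6 * A0 ^ 2) ≤ wt (om ε P) w * (A0 * mm s w.length) := by
          rw [ww]
          have := mul_le_mul_of_nonneg_right P3 (mul_nonneg wn (mul_nonneg A00.le mp.le))
          simp only [om, if_true]
          linarith
        set G := om ε P true * wt (om ε P) w' * (A0 * mm s w.length)
        set W := wt (om ε P) w * (A0 * mm s w.length) with hW
        have G0 : 0 ≤ G := mul_nonneg (mul_nonneg (o0 _) wn) (mul_nonneg A00.le mp.le)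
        have A2 : 1 ≤ A0 ^ 2 := one_le_pow₀ A1
        have GW : G ≤ W := by nlinarith
        have r11 : Sb p0 G (Dw eB p0 w h11) := fun z hz => by rw [E11 z hz]; exact i12 z hz
        have r12 : Sb p0 G (Dw eB p0 w h12) := fun z hz => by rw [E12 z hz]; exact i22 z hz
        refine ⟨fun z hz => (r11 z hz).trans GW, fun z hz => (r12 z hz).trans GW, fun z hz => ?_⟩
        have k := kp N ε _ hP (by omega) w hw z hz
        beta_reduce at k
        rw [← hw] at k
        have kC : C * (ε * (wt (om ε P) w * mm s w.length)) ≤ W / 2 := by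
          have := mul_le_mul_of_nonneg_right eC (mul_nonneg wn1 mp.le)
          rw [hW]; linarith
        have k := abs_le.1 (k.trans kC)
        have a1 := YS.b1 z hz
        have a2 := YS.b2 z hz
        have n1 := abs_nonneg (h1 z)
        have n2 := abs_nonneg (h2 z)
        have x1 : |h2 z * h2 z * Dw eB p0 w h11 z| ≤ A0 ^ 2 * G := by
          rw [abs_mul, abs_mul, sq]
          exact mul_le_mul (mul_le_mul a2 a2 n2 A00.le) (r11 z hz) (abs_nonneg _) (by positivity)
        have x2 : |h2 z * h1 z * Dw eB p0 w h12 z| ≤ A0 ^ 2 * G := by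
          rw [abs_mul, abs_mul, sq]
          exact mul_le_mul (mul_le_mul a2 a1 n1 A00.le) (r12 z hz) (abs_nonneg _) (by positivity)
        have x1 := abs_le.1 x1
        have x2 := abs_le.1 x2
        have x3 : |(1 + h1 z * h1 z) * Dw eB p0 w h22 z| ≤ W := by
          rw [abs_le]; constructor <;> linarith [k.1, k.2, x1.1, x1.2, x2.1, x2.2]
        refine le_trans ?_ x3
        have q := mul_self_nonneg (h1 z)
        rw [abs_mul, abs_of_pos (by linarith : 0 < 1 + h1 z * h1 z)]
        exact le_mul_of_one_le_left (abs_nonneg _) (by linarith)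
    refine ⟨fun w hw => ?_, fun w hw => ?_, fun w hw => ?_⟩
    · rcases Nat.lt_succ_iff_lt_or_eq.1 hw with h | h
      exacts [t11 w h, (key _ w rfl h).1]
    · rcases Nat.lt_succ_iff_lt_or_eq.1 hw with h | h
      exacts [t12 w h, (key _ w rfl h).2.1]
    · rcases Nat.lt_succ_iff_lt_or_eq.1 hw with h | h
      exacts [t22 w h, (key _ w rfl h).2.2]

lemma Sm.nat {f : ℝ × ℝ → ℝ} (h : Sm p0 f) (n : ℕ) : ContDiffOn ℝ n f (Strip p0) :=
  ContDiffOn.of_le h (by exact_mod_cast le_top)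

lemma itf_Dw (hp0 : p0 < 0) {V : Type} (e : V → ℝ × ℝ) {f : ℝ × ℝ → ℝ} (hf : Sm p0 f) : ∀ (n : ℕ) (w : Fin n → V), ∀ z ∈ Strip p0,
    iteratedFDerivWithin ℝ n f (Strip p0) z (fun i => e (w i)) = Dw e p0 (List.ofFn w) f z := by
  intro n
  induction n with
  | zero => intro w z _; simp [Dw]
  | succ n ih =>
    intro w z hz
    rw [iteratedFDerivWithin_succ_apply_left, List.ofFn_succ, Dw, ← Dw_dv hp0 _ _ hf z hz,
      ← dv_congr (v := e (w 0)) (ih fun i => w i.succ) z hz]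
    have hd : DifferentiableWithinAt ℝ (iteratedFDerivWithin ℝ n f (Strip p0)) (Strip p0) z :=
      (hf.nat (n + 1)).differentiableOn_iteratedFDerivWithin (by exact_mod_cast Nat.lt_succ_self n) (strip_ud hp0) z hz
    have h2 := (hd.hasFDerivWithinAt.continuousMultilinear_apply_const (fun i : Fin n => e (w i.succ))).fderivWithin (strip_ud hp0 z hz)
    rw [dv, h2]; rfl

def pw (a b : ℕ) : List Bool := List.ofFn fun i : Fin (a + b) => decide ((i : ℕ) < a)

lemma pw_len (a b : ℕ) : (pw a b).length = a + b := by simp [pw]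

lemma pd_Dw (hp0 : p0 < 0) {f : ℝ × ℝ → ℝ} (hf : Sm p0 f) (a b : ℕ) : ∀ z ∈ Strip p0, pd p0 a b f z = Dw eB p0 (pw a b) f z := by
  intro z hz
  rw [pw, ← itf_Dw hp0 eB hf _ _ z hz]
  simp [pd, mpw, eB]

lemma Dw_append {V : Type} {e : V → ℝ × ℝ} (w w' : List V) : ∀ f, Dw e p0 (w ++ w') f = Dw e p0 w' (Dw e p0 w f) := by
  induction w with
  | nil => exact fun f => rfl
  | cons v w ih => exact fun f => ih _

lemma supS_le (hp0 : p0 < 0) {f : ℝ × ℝ → ℝ} {M : ℝ} (h : ∀ z ∈ Strip p0, |f z| ≤ M) : supS p0 f ≤ M :=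
  csSup_le (Set.Nonempty.image _ ⟨(0, 0), hp0.le, le_rfl⟩) (by rintro _ ⟨z, hz, rfl⟩; exact h z hz)

lemma itf_norm (hp0 : p0 < 0) {f : ℝ × ℝ → ℝ} (hf : Sm p0 f) {n : ℕ} {M : ℝ} (z) (hz : z ∈ Strip p0)
    (h : ∀ w : List Bool, w.length = n → |Dw eB p0 w f z| ≤ M) : ‖iteratedFDerivWithin ℝ n f (Strip p0) z‖ ≤ 2 ^ n * M := by
  have M0 : 0 ≤ M := (abs_nonneg _).trans (h (List.replicate n true) (by simp))
  refine ContinuousMultilinearMap.opNorm_le_bound (by positivity) fun m => ?_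
  have hm : m = fun i => ∑ j : Bool, (if j then (m i).1 else (m i).2) • eB j := by
    funext i; ext <;> simp [eB]
  conv_lhs => rw [hm]
  rw [ContinuousMultilinearMap.map_sum]
  refine (norm_sum_le _ _).trans ?_
  calc ∑ r : Fin n → Bool, ‖iteratedFDerivWithin ℝ n f (Strip p0) z fun i => (if r i then (m i).1 else (m i).2) • eB (r i)‖
      ≤ ∑ r : Fin n → Bool, M * ∏ i, ‖m i‖ := Finset.sum_le_sum fun r _ => ?_
    _ = 2 ^ n * M * ∏ i, ‖m i‖ := by simp; ring
  rw [ContinuousMultilinearMap.map_smul_univ, itf_Dw hp0 eB hf n r z hz, norm_smul, norm_prod, mul_comm]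
  refine mul_le_mul (h _ (by simp)) (Finset.prod_le_prod (fun _ _ => norm_nonneg _) fun i _ => ?_)
    (Finset.prod_nonneg fun _ _ => norm_nonneg _) M0
  cases r i
  · exact norm_snd_le (m i)
  · exact norm_fst_le (m i)

lemma line_deriv (hp0 : p0 < 0) {x y : ℝ × ℝ} (hx : x ∈ Strip p0) (hy : x + y ∈ Strip p0) {f : ℝ × ℝ → ℝ} (hf : Sm p0 f) :
    ∀ (n : ℕ), ∀ t ∈ Icc (0:ℝ) 1, iteratedDerivWithin n (fun t : ℝ => f (x + t • y)) (Icc 0 1) t =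
      iteratedFDerivWithin ℝ n f (Strip p0) (x + t • y) (fun _ => y) := by
  have mt : MapsTo (fun t : ℝ => x + t • y) (Icc 0 1) (Strip p0) := fun t ht => by
    have := (convex_strip p0).add_smul_mem hx hy ht
    simpa using this
  intro n
  induction n with
  | zero => intro t _; simp
  | succ n ih =>
    intro t ht
    rw [iteratedDerivWithin_succ, derivWithin_congr ih (ih t ht), iteratedFDerivWithin_succ_apply_left]
    have hd : DifferentiableWithinAt ℝ (iteratedFDerivWithin ℝ n f (Strip p0)) (Strip p0) (x + t • y) :=
      (hf.nat (n + 1)).differentiableOn_iteratedFDerivWithin (by exact_mod_cast Nat.lt_succ_self n) (strip_ud hp0) _ (mt ht)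
    have h2 := hd.hasFDerivWithinAt.continuousMultilinear_apply_const (fun i : Fin n => y)
    have h3 : HasDerivWithinAt (fun t : ℝ => x + t • y) y (Icc 0 1) t := by
      simpa using (((hasDerivAt_id t).smul_const y).const_add x).hasDerivWithinAt
    have h4 := h2.comp_hasDerivWithinAt t h3 mt
    exact h4.derivWithin (uniqueDiffOn_Icc zero_lt_one t ht)

theorem analytic_of (hp0 : p0 < 0) {f : ℝ × ℝ → ℝ} (hf : Sm p0 f) {C : ℝ} (hC : 1 ≤ C)
    (h : ∀ w : List Bool, ∀ z ∈ Strip p0, |Dw eB p0 w f z| ≤ C ^ (w.length + 1) * (Nat.factorial w.length : ℝ)) :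
    AnalyticOn ℝ f (Strip p0) := by
  have C0 : 0 < C := by linarith
  have key : ∀ n, ∀ z ∈ Strip p0, ‖iteratedFDerivWithin ℝ n f (Strip p0) z‖ ≤ C * (2 * C) ^ n * (Nat.factorial n : ℝ) := fun n z hz => by
    refine (itf_norm hp0 hf z hz (M := C ^ (n + 1) * (Nat.factorial n : ℝ)) fun w hw => ?_).trans (le_of_eq (by ring))
    simpa [hw] using h w z hz
  intro x hx
  let p : FormalMultilinearSeries ℝ (ℝ × ℝ) ℝ := fun n => ((Nat.factorial n : ℝ)⁻¹) • iteratedFDerivWithin ℝ n f (Strip p0) x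
  have hpn : ∀ n, ‖p n‖ ≤ C * (2 * C) ^ n := fun n => by
    have fp : (0:ℝ) < Nat.factorial n := by exact_mod_cast Nat.factorial_pos n
    rw [norm_smul, norm_inv, Real.norm_of_nonneg fp.le, inv_mul_le_iff₀ fp]
    linarith [key n x hx]
  let r : NNReal := ⟨1 / (4 * C), by positivity⟩
  have hr : (r : ℝ) = 1 / (4 * C) := rfl
  refine ⟨p, r, p.le_radius_of_bound C fun n => ?_, ?_, fun {y} hy hyr => ?_⟩
  · have : (2 * C) * (r : ℝ) ≤ 1 := by rw [hr]; field_simp; norm_num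
    calc ‖p n‖ * (r : ℝ) ^ n ≤ C * (2 * C) ^ n * (r : ℝ) ^ n := by gcongr; exact hpn n
      _ = C * ((2 * C) * r) ^ n := by rw [mul_pow]; ring
      _ ≤ C * 1 := by gcongr; exact pow_le_one₀ (by positivity) this
      _ = C := mul_one C
  · have : (0:NNReal) < r := by rw [← NNReal.coe_pos, hr]; positivity
    exact_mod_cast this
  · rw [insert_eq_of_mem hx] at hy
    have yr : ‖y‖ < 1 / (4 * C) := by
      rw [Metric.eball_coe] at hyr
      simpa [hr] using hyr
    have y2 : 2 * C * ‖y‖ ≤ 1 / 2 := by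
      have := mul_le_mul_of_nonneg_left yr.le (by positivity : 0 ≤ 2 * C)
      refine this.trans (le_of_eq ?_); field_simp; norm_num
    have tb : ∀ n, ‖p n (fun _ => y)‖ ≤ C * (1 / 2) ^ n := fun n => by
      calc ‖p n (fun _ => y)‖ ≤ ‖p n‖ * ‖y‖ ^ n := by simpa using (p n).le_opNorm (fun _ => y)
        _ ≤ C * (2 * C) ^ n * ‖y‖ ^ n := by gcongr; exact hpn n
        _ = C * (2 * C * ‖y‖) ^ n := by rw [mul_pow (2 * C)]; ring
        _ ≤ C * (1 / 2) ^ n := by gcongr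
    have sm : Summable fun n => p n (fun _ => y) :=
      Summable.of_norm_bounded (summable_geometric_two.mul_left C) tb
    rw [sm.hasSum_iff_tendsto_nat, ← tendsto_add_atTop_iff_nat 1, tendsto_iff_norm_sub_tendsto_zero]
    have mt : MapsTo (fun t : ℝ => x + t • y) (Icc 0 1) (Strip p0) := fun t ht => by
      simpa using (convex_strip p0).add_smul_mem hx hy ht
    have err : ∀ n : ℕ, ‖∑ i ∈ Finset.range (n + 1), p i (fun _ => y) - f (x + y)‖ ≤ C * ((n + 1 : ℕ) * (1 / 2) ^ (n + 1)) := fun n => by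
      have fp : (0:ℝ) < Nat.factorial n := by exact_mod_cast Nat.factorial_pos n
      have cd : ContDiffOn ℝ (n + 1) (fun t : ℝ => f (x + t • y)) (Icc 0 1) := by
        have := hf.nat (n + 1)
        push_cast at this
        exact this.comp (by fun_prop) mt
      have t := taylor_mean_remainder_bound (zero_le_one) cd (right_mem_Icc.2 zero_le_one) (C := C * (1 / 2) ^ (n + 1) * (Nat.factorial (n + 1) : ℝ)) fun t ht => ?_
      · rw [taylor_within_apply, norm_sub_rev] at t
        have eq : ∑ k ∈ Finset.range (n + 1), ((Nat.factorial k : ℝ)⁻¹ * (1 - 0) ^ k) • iteratedDerivWithin k (fun t : ℝ => f (x + t • y)) (Icc 0 1) 0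
            = ∑ i ∈ Finset.range (n + 1), p i (fun _ => y) := Finset.sum_congr rfl fun k _ => by
          rw [line_deriv hp0 hx hy hf k 0 (left_mem_Icc.2 zero_le_one)]
          simp [p]
        rw [eq] at t
        simp only [one_smul] at t
        refine t.trans (le_of_eq ?_)
        rw [Nat.factorial_succ]; push_cast; field_simp; ring
      · rw [line_deriv hp0 hx hy hf _ t ht]
        calc ‖iteratedFDerivWithin ℝ (n + 1) f (Strip p0) (x + t • y) (fun _ => y)‖
            ≤ ‖iteratedFDerivWithin ℝ (n + 1) f (Strip p0) (x + t • y)‖ * ‖y‖ ^ (n + 1) := by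
              simpa using (iteratedFDerivWithin ℝ (n + 1) f (Strip p0) (x + t • y)).le_opNorm (fun _ => y)
          _ ≤ C * (2 * C) ^ (n + 1) * (Nat.factorial (n + 1) : ℝ) * ‖y‖ ^ (n + 1) := by gcongr; exact key _ _ (mt ht)
          _ = C * (2 * C * ‖y‖) ^ (n + 1) * (Nat.factorial (n + 1) : ℝ) := by rw [mul_pow (2 * C)]; ring
          _ ≤ C * (1 / 2) ^ (n + 1) * (Nat.factorial (n + 1) : ℝ) := by gcongr
    refine squeeze_zero (fun _ => norm_nonneg _) err ?_
    have := (tendsto_self_mul_const_pow_of_lt_one (r := (1:ℝ) / 2) (by norm_num) (by norm_num)).const_mul C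
    rw [mul_zero] at this
    exact (tendsto_add_atTop_iff_nat 1).2 this

lemma word_bd (hp0 : p0 < 0) {s A0 : ℝ} {ω : Bool → ℝ} (hA : 1 ≤ A0)
    {h h1 h2 h11 h12 h22 : ℝ × ℝ → ℝ} (g0 : Grad (Strip p0) h h1 h2) (g1 : Grad (Strip p0) h1 h11 h12) (g2 : Grad (Strip p0) h2 h12 h22)
    {m0 m1 m2 : ℝ} (b0 : Sb p0 m0 h) (b1 : Sb p0 m1 h1) (b2 : Sb p0 m2 h2)
    (H : ∀ N, T p0 (Sb p0) eB ω N (fun k => A0 * mm s k) h11 ∧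
      T p0 (Sb p0) eB ω N (fun k => A0 * mm s k) h12 ∧ T p0 (Sb p0) eB ω N (fun k => A0 * mm s k) h22) :
    ∃ C, 1 ≤ C ∧ ∀ w : List Bool, Sb p0 (C ^ (w.length + 1) * (Nat.factorial (w.length - 2) : ℝ) ^ s) (Dw eB p0 w h) := by
  obtain ⟨C, C1, c0, c1, c2, cA, ct, cf⟩ : ∃ C, 1 ≤ C ∧ m0 ≤ C ∧ m1 ≤ C ∧ m2 ≤ C ∧ A0 ≤ C ∧ |ω true| ≤ C ∧ |ω false| ≤ C := by
    have := (nmS hp0).nonneg b0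
    have := (nmS hp0).nonneg b1
    have := (nmS hp0).nonneg b2
    have := abs_nonneg (ω true)
    have := abs_nonneg (ω false)
    refine ⟨m0 + m1 + m2 + A0 + |ω true| + |ω false|, ?_⟩
    refine ⟨?_, ?_, ?_, ?_, ?_, ?_, ?_⟩ <;> linarith
  have C0 : 0 < C := by linarith
  have wb : ∀ w : List Bool, |wt ω w| ≤ C ^ w.length := fun w => by
    induction w with
    | nil => simp [wt]
    | cons v w ih =>
      rw [wt_cons, abs_mul, List.length_cons, pow_succ, mul_comm]
      refine mul_le_mul ih ?_ (abs_nonneg _) (by positivity)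
      cases v <;> assumption
  have C2 : C ≤ C ^ 2 := by nlinarith
  refine ⟨C, C1, fun w => ?_⟩
  match w with
  | [] =>
    intro z hz
    simpa [Dw] using (b0 z hz).trans c0
  | [v] =>
    intro z hz
    simp only [Dw, List.length_singleton]
    norm_num
    cases v with
    | true => exact (le_of_eq (congrArg abs (g0.eq hp0 z hz).1)).trans ((b1 z hz).trans (c1.trans C2))
    | false => exact (le_of_eq (congrArg abs (g0.eq hp0 z hz).2)).trans ((b2 z hz).trans (c2.trans C2))
  | u :: v :: w =>
    have main : ∀ f, (∀ N, T p0 (Sb p0) eB ω N (fun k => A0 * mm s k) f) →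
        (∀ z ∈ Strip p0, dv p0 (eB v) (dv p0 (eB u) h) z = f z) →
        Sb p0 (C ^ ((u :: v :: w).length + 1) * (Nat.factorial ((u :: v :: w).length - 2) : ℝ) ^ s) (Dw eB p0 (u :: v :: w) h) := by
      intro f hT hf z hz
      rw [Dw, Dw, Dw_congr w hf z hz]
      refine (hT _ w (Nat.lt_succ_self _) z hz).trans ?_
      simp only [List.length_cons]
      have m1 : mm s w.length ≤ (Nat.factorial w.length : ℝ) ^ s := by
        unfold mm
        refine div_le_self (by positivity) ?_
        have : (0:ℝ) ≤ w.length := by positivity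
        nlinarith
      have mp := mm_pos s w.length
      calc wt ω w * (A0 * mm s w.length) ≤ C ^ w.length * (C * (Nat.factorial w.length : ℝ) ^ s) := by
            refine mul_le_mul ((le_abs_self _).trans (wb w)) ?_ (by positivity) (by positivity)
            exact mul_le_mul cA m1 mp.le C0.le
        _ = C ^ (w.length + 1) * (Nat.factorial w.length : ℝ) ^ s := by ring
        _ ≤ _ := by
            rw [show w.length + 1 + 1 - 2 = w.length by omega]
            gcongr
            omega
    have e1 := fun z hz => (g0.eq hp0 z hz).1
    have e2 := fun z hz => (g0.eq hp0 z hz).2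
    cases u <;> cases v
    · exact main h22 (fun N => (H N).2.2) fun z hz => (dv_congr e2 z hz).trans (g2.eq hp0 z hz).2
    · exact main h12 (fun N => (H N).2.1) fun z hz => (dv_congr e2 z hz).trans (g2.eq hp0 z hz).1
    · exact main h12 (fun N => (H N).2.1) fun z hz => (dv_congr e1 z hz).trans (g1.eq hp0 z hz).2
    · exact main h11 (fun N => (H N).1) fun z hz => (dv_congr e1 z hz).trans (g1.eq hp0 z hz).1

lemma fact_le (m : ℕ) : ((Nat.factorial m : ℕ) : ℝ) ≤ 4 ^ m * (Nat.factorial (m - 2) : ℝ) := by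
  rcases m with _ | _ | m
  · simp
  · norm_num
  · have h1 : ((m : ℝ) + 1 + 1) ≤ 2 ^ (m + 2) := by exact_mod_cast (Nat.lt_two_pow_self (n := m + 2)).le
    have h2 : ((m : ℝ) + 1) ≤ 2 ^ (m + 2) := by linarith
    rw [Nat.factorial_succ, Nat.factorial_succ, show m + 1 + 1 - 2 = m by omega]
    push_cast
    rw [← mul_assoc, show (4:ℝ) ^ (m + 1 + 1) = 2 ^ (m + 2) * 2 ^ (m + 2) by rw [← mul_pow]; norm_num]
    gcongr

theorem final_pack (hp0 : p0 < 0) {s : ℝ} (hs : 1 ≤ s) {h : ℝ × ℝ → ℝ} (sh : Sm p0 h) {C : ℝ} (C1 : 1 ≤ C)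
    (H : ∀ w : List Bool, Sb p0 (C ^ (w.length + 1) * (Nat.factorial (w.length - 2) : ℝ) ^ s) (Dw eB p0 w h)) :
    (∃ L₁ L₂ : ℝ, 1 ≤ L₁ ∧ L₁ ≤ L₂ ∧ ∀ m : ℕ, 2 ≤ m → ∀ a b : ℕ, a + b = m →
      cknorm p0 2 (pd p0 a b h) ≤
        L₁ ^ ((a : ℤ) - 1) * L₂ ^ b * (Nat.factorial (m - 2) : ℝ) ^ s) ∧
    (∃ C : ℝ, 1 ≤ C ∧ ∀ a b : ℕ, ∀ z ∈ Strip p0,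
      |pd p0 a b h z| ≤ C ^ (a + b + 1) * (Nat.factorial (a + b) : ℝ) ^ s) ∧
    (s = 1 → AnalyticOn ℝ h (Strip p0)) := by
  have C0 : 0 < C := by linarith
  have H' : ∀ w : List Bool, Sb p0 (C ^ (w.length + 1) * (Nat.factorial w.length : ℝ) ^ s) (Dw eB p0 w h) := fun w z hz => by
    refine (H w z hz).trans ?_
    gcongr
    omega
  refine ⟨?_, ⟨C, C1, fun a b z hz => ?_⟩, fun e => ?_⟩
  · set D : ℝ := C * 4 ^ s with hD
    have D1 : 1 ≤ D := one_le_mul_of_one_le_of_one_le C1 (Real.one_le_rpow (by norm_num) (by linarith))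
    have L1 : 1 ≤ 6 * D ^ 5 := by have := one_le_pow₀ D1 (n := 5); linarith
    refine ⟨6 * D ^ 5, 6 * D ^ 5, L1, le_rfl, fun m hm a b hab => ?_⟩
    have sp : Sm p0 (pd p0 a b h) := ContDiffOn.congr (Dw_sm hp0 (pw a b) sh) fun z hz => pd_Dw hp0 sh a b z hz
    have each : ∀ a' b' : ℕ, a' + b' ≤ 2 → supS p0 (pd p0 a' b' (pd p0 a b h)) ≤ D ^ (m + 3) * (Nat.factorial (m - 2) : ℝ) ^ s := by
      intro a' b' hab'
      refine supS_le hp0 fun z hz => ?_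
      rw [pd_Dw hp0 sp a' b' z hz, Dw_congr _ (pd_Dw hp0 sh a b) z hz, ← Dw_append]
      refine (H _ z hz).trans ?_
      rw [List.length_append, pw_len, pw_len, hab]
      have k1 : ((Nat.factorial (m + (a' + b') - 2) : ℕ) : ℝ) ^ s ≤ (4 ^ s) ^ (m + 3) * (Nat.factorial (m - 2) : ℝ) ^ s := by
        rw [← Real.rpow_natCast (4 ^ s), ← Real.rpow_mul (by norm_num), mul_comm s, Real.rpow_mul (by norm_num), Real.rpow_natCast,
          ← Real.mul_rpow (by positivity) (by positivity)]
        refine Real.rpow_le_rpow (by positivity) ?_ (by linarith)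
        calc ((Nat.factorial (m + (a' + b') - 2) : ℕ) : ℝ) ≤ (Nat.factorial m : ℝ) := by
              exact_mod_cast Nat.factorial_le (by omega)
          _ ≤ 4 ^ m * (Nat.factorial (m - 2) : ℝ) := fact_le m
          _ ≤ 4 ^ (m + 3) * (Nat.factorial (m - 2) : ℝ) := by gcongr <;> norm_num
      have k2 : C ^ (m + (a' + b') + 1) ≤ C ^ (m + 3) := pow_le_pow_right₀ C1 (by omega)
      rw [hD, mul_pow, mul_assoc]
      exact mul_le_mul k2 k1 (by positivity) (by positivity)
    have e1 : (6 * D ^ 5) ^ ((a : ℤ) - 1) * (6 * D ^ 5) ^ b = (6 * D ^ 5) ^ (m - 1) := by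
      have x0 : 6 * D ^ 5 ≠ 0 := by positivity
      generalize 6 * D ^ 5 = x at x0
      rw [← zpow_natCast x b, ← zpow_natCast x (m - 1), ← zpow_add₀ x0]
      congr 1
      omega
    have k3 : 6 * D ^ (m + 3) ≤ (6 * D ^ 5) ^ (m - 1) := by
      rw [mul_pow 6, ← pow_mul]
      have : (6:ℝ) ≤ 6 ^ (m - 1) := le_self_pow₀ (by norm_num) (by omega)
      have : D ^ (m + 3) ≤ D ^ (5 * (m - 1)) := pow_le_pow_right₀ D1 (by omega)
      gcongr
    rw [e1]
    refine le_trans ?_ (mul_le_mul_of_nonneg_right k3 (by positivity))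
    unfold cknorm
    simp only [Finset.sum_range_succ, Finset.sum_range_zero, show 2 + 1 - 0 = 3 from rfl, show 2 + 1 - 1 = 2 from rfl, show 2 + 1 - 2 = 1 from rfl]
    linarith [each 0 0 (by norm_num), each 0 1 (by norm_num), each 0 2 (by norm_num), each 1 0 (by norm_num), each 1 1 (by norm_num), each 2 0 (by norm_num)]
  · rw [pd_Dw hp0 sh a b z hz]
    simpa [pw_len] using H' (pw a b) z hz
  · subst e
    exact analytic_of hp0 sh C1 fun w z hz => by simpa using H' w z hz

end


theorem height_function_gevrey_regularity
    (p₀ d g σ Q μ δ₁ δ₂ s : ℝ)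
    (hp₀ : p₀ < 0) (hd : 0 < d) (hg : 0 < g) (hσ : 0 < σ)
    (hμ : μ ∈ Set.Ioo (0 : ℝ) 1) (hδ₁ : 0 < δ₁) (hδ₁₂ : δ₁ ≤ δ₂) (hs : 1 ≤ s)
    (β ρ : ℝ → ℝ)
    (hβ : GevreyOnIcc s p₀ β)
    (hρpos : ∀ p ∈ Set.Icc p₀ 0, 0 < ρ p)
    (hρ : GevreyOnIcc s p₀ ρ)
    (h : ℝ × ℝ → ℝ)
    -- h ∈ C^{2,μ}(R̄)
    (hreg : MemCk p₀ μ 2 h)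
    -- Yih's equation in the open strip
    (hpde : ∀ z : ℝ × ℝ, p₀ < z.2 → z.2 < 0 →
      (1 + (pd p₀ 1 0 h z) ^ 2) * pd p₀ 0 2 h z
        - 2 * pd p₀ 0 1 h z * pd p₀ 1 0 h z * pd p₀ 1 1 h z
        + (pd p₀ 0 1 h z) ^ 2 * pd p₀ 2 0 h z
        - g * (h z - d) * derivWithin ρ (Set.Icc p₀ 0) z.2 * (pd p₀ 0 1 h z) ^ 3
        + β z.2 * (pd p₀ 0 1 h z) ^ 3 = 0)
    -- the capillary-gravity boundary condition on p = 0
    (hbc : ∀ q : ℝ,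
      1 + (pd p₀ 1 0 h (q, 0)) ^ 2
        + (2 * g * ρ 0 * h (q, 0)
            - 2 * σ * pd p₀ 2 0 h (q, 0) / (1 + (pd p₀ 1 0 h (q, 0)) ^ 2) ^ ((3 : ℝ) / 2)
            - Q) * (pd p₀ 0 1 h (q, 0)) ^ 2 = 0)
    -- flat bed condition on p = p₀
    (hbed : ∀ q : ℝ, h (q, p₀) = 0)
    -- no-stagnation bounds
    (hstag : ∀ z ∈ Strip p₀, δ₁ ≤ pd p₀ 0 1 h z ∧ pd p₀ 0 1 h z ≤ δ₂) :
    ContDiffOn ℝ (⊤ : ℕ∞) h (Strip p₀) ∧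
    (∃ L₁ L₂ : ℝ, 1 ≤ L₁ ∧ L₁ ≤ L₂ ∧ ∀ m : ℕ, 2 ≤ m → ∀ a b : ℕ, a + b = m →
      cknorm p₀ 2 (pd p₀ a b h) ≤
        L₁ ^ ((a : ℤ) - 1) * L₂ ^ b * (Nat.factorial (m - 2) : ℝ) ^ s) ∧
    (∃ C : ℝ, 1 ≤ C ∧ ∀ a b : ℕ, ∀ z ∈ Strip p₀,
      |pd p₀ a b h z| ≤ C ^ (a + b + 1) * (Nat.factorial (a + b) : ℝ) ^ s) ∧
    (s = 1 → AnalyticOn ℝ h (Strip p₀)) := by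
  obtain ⟨cβ, Mβ, Mβ1, gβ⟩ := hβ
  obtain ⟨cρ, Mρ, Mρ1, gρ⟩ := hρ
  have X := sol_of (μ := μ) d g σ Q δ₁ hp₀ hσ hμ.1 hμ.2 hδ₁ β ρ cβ cρ h hreg hpde hbc hbed fun z hz => (hstag z hz).1
  have gρ' : GB s p₀ (Mρ ^ 2 * 2 ^ s) (derivWithin ρ (Icc p₀ 0)) := GB.deriv hs Mρ1 gρ
  have gβ' : GB s p₀ Mβ β := gβ
  have z0 : 0 ≤ Mρ ^ 2 * 2 ^ s := by positivity
  have z1 : 0 ≤ Mβ := by linarith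
  obtain ⟨A0, A1, ω, H⟩ := X.pstep hs (M := Mβ + Mρ ^ 2 * 2 ^ s) (by linarith) cβ (dw_cd hp₀ cρ) (gβ'.mono z1 (by linarith)) (gρ'.mono z0 (by linarith))
  obtain ⟨m0, b0⟩ := X.b0
  obtain ⟨m1, b1⟩ := X.b1
  obtain ⟨m2, b2⟩ := X.b2
  obtain ⟨C, C1, HC⟩ := word_bd hp₀ A1 X.g0 X.g1 X.g2 (fun z hz => b0.1 z hz) (fun z hz => b1.1 z hz) (fun z hz => b2.1 z hz) H
  exact ⟨X.smooth.1, final_pack hp₀ hs X.smooth.1 C1 HC⟩
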